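/- Let R = ℤ[z^{±1}, q^{±1}, δ]/⟨z^{-1} − z = (q^{-1} − q)(δ − 1)⟩ be the generic ground ring and let W_i = W_i(R; z, q, δ) be the Birman–Murakami–Wenzl algebra. Then for each i ≥ 1 the set 𝒲_i = {d_s* c_{(λ,l)} d_t : (λ,l) ∈ Ŵ_i, s,t ∈ Ŵ_i^{(λ,l)}} is an R-basis of W_i, and (W_i, *, Ŵ_i, ⊵, 𝒲_i) is a cell datum for W_i. -/

import Mathlib

noncomputable section

/-! ### Combinatorics: permutations, row stabilisers, dominance, reflected branching -/

/-- `Equiv.Perm (Fin n)` viewed as permuting `{1, …, n} ⊆ ℕ`. -/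
def applyPerm (n : ℕ) (v : Equiv.Perm (Fin n)) (k : ℕ) : ℕ :=
  if h : 1 ≤ k ∧ k ≤ n then (v ⟨k - 1, by omega⟩).val + 1 else k

/-- The number of inversions of a permutation (its Coxeter length `ℓ(v)`). -/
def invCount {n : ℕ} (v : Equiv.Perm (Fin n)) : ℕ :=
  (Finset.univ.filter fun p : Fin n × Fin n => p.1 < p.2 ∧ v p.2 < v p.1).card

/-- The adjacent transposition `s_i = (i, i+1)` of `{1, …, n}` (`1 ≤ i ≤ n-1`). -/
def swN (n i : ℕ) : Equiv.Perm (Fin n) :=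
  if h : 1 ≤ i ∧ i < n then Equiv.swap ⟨i - 1, by omega⟩ ⟨i, by omega⟩ else 1

/-- The (0-indexed) row of the entry `k` of the superstandard tableau of shape `μ`. -/
def rowOfNum (μ : YoungDiagram) (k : ℕ) : ℕ :=
  ((Finset.range k).filter (fun r => (∑ i ∈ Finset.range (r+1), μ.rowLen i) < k)).card

/-- The row stabiliser `S_μ ⊆ S_n` of the superstandard tableau `t^μ`. -/
def RowStab (n : ℕ) (μ : YoungDiagram) : Finset (Equiv.Perm (Fin n)) :=
  Finset.univ.filter
    (fun v => ∀ k : Fin n, rowOfNum μ (applyPerm n v (k.val + 1)) = rowOfNum μ (k.val + 1))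

/-- The dominance order: `l` dominates `μ`. -/
def Dominates (l μ : YoungDiagram) : Prop :=
  ∀ k : ℕ, (∑ i ∈ Finset.range k, μ.rowLen i) ≤ ∑ i ∈ Finset.range k, l.rowLen i

/-- For `m = l ∪ {one node}`, the (0-indexed) row of the added node. -/
def addedRow (l m : YoungDiagram) : ℕ :=
  ∑ j ∈ Finset.range (m.card + 1), if m.rowLen j ≠ l.rowLen j then j else 0

/-- For `m = l ∪ {(j, m_j)}`, the value `a = m_1 + ⋯ + m_j` (sum of the row lengths
of `m` up to and including the row of the added node). -/
def aVal (l m : YoungDiagram) : ℕ :=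
  ∑ r ∈ Finset.range (addedRow l m + 1), m.rowLen r

/-- The edge relation of the branching diagram obtained by reflections from Young's
lattice: `(λ,l) → (μ,l)` iff `μ` is obtained from `λ` by adding a node, and
`(λ,l) → (μ,l+1)` iff `μ` is obtained from `λ` by removing a node. -/
def WEdge (a b : YoungDiagram × ℕ) : Prop :=
  (b.2 = a.2 ∧ a.1 ≤ b.1 ∧ b.1.card = a.1.card + 1) ∨
  (b.2 = a.2 + 1 ∧ b.1 ≤ a.1 ∧ a.1.card = b.1.card + 1)

/-- Vertices `(λ, l)` at level `i` of the reflected branching diagram: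
`0 ≤ l ≤ ⌊i/2⌋` and `λ ⊢ i - 2l`. -/
abbrev WLam (i : ℕ) : Type := {x : YoungDiagram × ℕ // 2 * x.2 ≤ i ∧ x.1.card = i - 2 * x.2}

/-- Paths on the reflected branching diagram from `(∅,0)` to `x` at level `i`. -/
def WPath (i : ℕ) (x : YoungDiagram × ℕ) : Type :=
  {pp : Fin (i + 1) → YoungDiagram × ℕ //
    pp 0 = (⊥, 0) ∧ pp (Fin.last i) = x ∧
    ∀ k : Fin i, WEdge (pp k.castSucc) (pp k.succ)}

/-- The strict order `m ▷ l` on the labels `(λ, l)`: larger second component, or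
equal second components and strict dominance of the diagrams. -/
def wGT (m l : YoungDiagram × ℕ) : Prop :=
  l.2 < m.2 ∨ (m.2 = l.2 ∧ Dominates m.1 l.1 ∧ m.1 ≠ l.1)

/-! ### The Birman–Murakami–Wenzl algebra, by generators and relations -/

/-- Generators `g_i`, `g_i⁻¹`, `e_i` (for `1 ≤ i ≤ n-1`) of the BMW algebra. -/
inductive BMWGen (n : ℕ) : Type
  | G (i : {i : ℕ // 1 ≤ i ∧ i < n}) : BMWGen n
  | GI (i : {i : ℕ // 1 ≤ i ∧ i < n}) : BMWGen n
  | E (i : {i : ℕ // 1 ≤ i ∧ i < n}) : BMWGen n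

open FreeAlgebra in
/-- The defining relations of the BMW algebra `W_n(R; z, q, δ)`. -/
inductive BMWRel (R : Type) [CommRing R] (z q : Rˣ) (δ : R) (n : ℕ) :
    FreeAlgebra R (BMWGen n) → FreeAlgebra R (BMWGen n) → Prop
  | invR (i) : BMWRel R z q δ n (ι R (BMWGen.G i) * ι R (BMWGen.GI i)) 1
  | invL (i) : BMWRel R z q δ n (ι R (BMWGen.GI i) * ι R (BMWGen.G i)) 1
  | idem (i) : BMWRel R z q δ n (ι R (BMWGen.E i) * ι R (BMWGen.E i))
      (algebraMap R _ δ * ι R (BMWGen.E i))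
  | braid (i j) (h : j.1 = i.1 + 1) :
      BMWRel R z q δ n (ι R (BMWGen.G i) * ι R (BMWGen.G j) * ι R (BMWGen.G i))
        (ι R (BMWGen.G j) * ι R (BMWGen.G i) * ι R (BMWGen.G j))
  | braidComm (i j) (h : i.1 + 1 < j.1 ∨ j.1 + 1 < i.1) :
      BMWRel R z q δ n (ι R (BMWGen.G i) * ι R (BMWGen.G j))
        (ι R (BMWGen.G j) * ι R (BMWGen.G i))
  | geComm (i j) (h : i.1 + 1 < j.1 ∨ j.1 + 1 < i.1) :
      BMWRel R z q δ n (ι R (BMWGen.G i) * ι R (BMWGen.E j))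
        (ι R (BMWGen.E j) * ι R (BMWGen.G i))
  | eeComm (i j) (h : i.1 + 1 < j.1 ∨ j.1 + 1 < i.1) :
      BMWRel R z q δ n (ι R (BMWGen.E i) * ι R (BMWGen.E j))
        (ι R (BMWGen.E j) * ι R (BMWGen.E i))
  | tangle1 (i j) (h : j.1 = i.1 + 1 ∨ i.1 = j.1 + 1) :
      BMWRel R z q δ n (ι R (BMWGen.E i) * ι R (BMWGen.E j) * ι R (BMWGen.E i))
        (ι R (BMWGen.E i))
  | tangle2 (i j) (h : j.1 = i.1 + 1 ∨ i.1 = j.1 + 1) :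
      BMWRel R z q δ n (ι R (BMWGen.G i) * ι R (BMWGen.G j) * ι R (BMWGen.E i))
        (ι R (BMWGen.E j) * ι R (BMWGen.E i))
  | tangle3 (i j) (h : j.1 = i.1 + 1 ∨ i.1 = j.1 + 1) :
      BMWRel R z q δ n (ι R (BMWGen.E i) * ι R (BMWGen.G j) * ι R (BMWGen.G i))
        (ι R (BMWGen.E i) * ι R (BMWGen.E j))
  | skein (i) :
      BMWRel R z q δ n (ι R (BMWGen.G i) - ι R (BMWGen.GI i))
        (algebraMap R _ ((q : R) - ((q⁻¹ : Rˣ) : R)) * (1 - ι R (BMWGen.E i)))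
  | untwistR (i) :
      BMWRel R z q δ n (ι R (BMWGen.G i) * ι R (BMWGen.E i))
        (algebraMap R _ ((z⁻¹ : Rˣ) : R) * ι R (BMWGen.E i))
  | untwistL (i) :
      BMWRel R z q δ n (ι R (BMWGen.E i) * ι R (BMWGen.G i))
        (algebraMap R _ ((z⁻¹ : Rˣ) : R) * ι R (BMWGen.E i))
  | untwistE (i j) (h : j.1 = i.1 + 1 ∨ i.1 = j.1 + 1) :
      BMWRel R z q δ n (ι R (BMWGen.E i) * ι R (BMWGen.G j) * ι R (BMWGen.E i))
        (algebraMap R _ ((z : Rˣ) : R) * ι R (BMWGen.E i))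

/-- The Birman–Murakami–Wenzl algebra `W_n(R; z, q, δ)`. -/
abbrev BMW (R : Type) [CommRing R] (z q : Rˣ) (δ : R) (n : ℕ) : Type :=
  RingQuot (BMWRel R z q δ n)

variable (R : Type) [CommRing R] (z q : Rˣ) (δ : R) (n : ℕ)

/-- The generator `g_i` (equal to `1` out of range). -/
def bmwG (i : ℕ) : BMW R z q δ n :=
  if h : 1 ≤ i ∧ i < n then
    RingQuot.mkAlgHom R (BMWRel R z q δ n) (FreeAlgebra.ι R (BMWGen.G ⟨i, h⟩))
  else 1

/-- The generator `e_i` (equal to `1` out of range). -/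
def bmwE (i : ℕ) : BMW R z q δ n :=
  if h : 1 ≤ i ∧ i < n then
    RingQuot.mkAlgHom R (BMWRel R z q δ n) (FreeAlgebra.ι R (BMWGen.E ⟨i, h⟩))
  else 1

/-- The ascending product `g_{a,b} = g_a g_{a+1} ⋯ g_{b-1}` (`a ≤ b`). -/
def gAsc (a b : ℕ) : BMW R z q δ n :=
  ((List.range (b - a)).map (fun k => bmwG R z q δ n (a + k))).prod

/-- The descending product `g_{b,a} = g_{b-1} g_{b-2} ⋯ g_a` (`b ≥ a`). -/
def gDesc (b a : ℕ) : BMW R z q δ n :=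
  ((List.range (b - a)).map (fun k => bmwG R z q δ n (b - 1 - k))).prod

/-- The element `e^{(l)}_{i-1} = e_{i-2l+1} e_{i-2l+3} ⋯ e_{i-1}` (`l` factors). -/
def eStairW (i l : ℕ) : BMW R z q δ n :=
  ((List.range l).map (fun t => bmwE R z q δ n (i - 2 * l + 1 + 2 * t))).prod

/-- The element `c_{(μ,m)} = (Σ_{v ∈ S_μ} q^{ℓ(v)} g_v) e^{(m)}_{i-1}` of `W_i`,
given the elements `g_v`. -/
def cBMW (gw : Equiv.Perm (Fin n) → BMW R z q δ n) (μ : YoungDiagram) (m : ℕ) :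
    BMW R z q δ n :=
  (∑ v ∈ RowStab n μ, ((q : R) ^ invCount v) • gw v) * eStairW R z q δ n n m

/-- The lifted branching coefficient
`\bar d^{(i)}_{λ→μ} = g_{a,i}` (for `μ = λ ∪ {(j, μ_j)}`, `a = μ_1 + ⋯ + μ_j`). -/
def dBarBMW (i : ℕ) (lam mu : YoungDiagram) : BMW R z q δ n :=
  gAsc R z q δ n (aVal lam mu) i

/-- The lifted branching coefficient
`\bar u^{(i)}_{λ→μ} = g_{i,a} Σ_{r=0}^{λ_j} q^r g_{a,a-r}`. -/
def uBarBMW (i : ℕ) (lam mu : YoungDiagram) : BMW R z q δ n :=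
  gDesc R z q δ n i (aVal lam mu) *
    ∑ r ∈ Finset.range (lam.rowLen (addedRow lam mu) + 1),
      ((q : R) ^ r) • gDesc R z q δ n (aVal lam mu) (aVal lam mu - r)

/-- The branching coefficient for one step of a path, into level `k+1`:
`d^{(k+1)}_{(λ,l)→(μ,l)} = \bar d^{(k-2l+1)}_{λ→μ} e^{(l)}_{k-1}` and
`d^{(k+1)}_{(λ,l)→(μ,l+1)} = \bar u^{(k-2l)}_{μ→λ} e^{(l)}_{k-1}`. -/
def dStepBMW (k : ℕ) (a b : YoungDiagram × ℕ) : BMW R z q δ n :=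
  if b.2 = a.2 then dBarBMW R z q δ n (k - 2 * a.2 + 1) a.1 b.1 * eStairW R z q δ n k a.2
  else uBarBMW R z q δ n (k - 2 * a.2) b.1 a.1 * eStairW R z q δ n k a.2

/-- The path element `d_t`. -/
def dPathBMW (i : ℕ)
    {x : YoungDiagram × ℕ} (t : WPath i x) : BMW R z q δ n :=
  ((List.ofFn (fun k : Fin i =>
      dStepBMW R z q δ n k.val (t.1 k.castSucc) (t.1 k.succ))).reverse).prod

/-! ### Products of generators in an abstract ring -/

section Words
variable {R W : Type*} [CommRing R] [Ring W] [Algebra R W]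

/-- The ascending product `g_a g_{a+1} ⋯ g_{b-1}`. -/
def ascW (g : ℕ → W) (a b : ℕ) : W := ((List.range (b - a)).map (fun k => g (a + k))).prod

/-- The descending product `g_{b-1} ⋯ g_a`. -/
def descW (g : ℕ → W) (b a : ℕ) : W := ((List.range (b - a)).map (fun k => g (b - 1 - k))).prod

/-- The product `e_{i-2l+1} e_{i-2l+3} ⋯ e_{i-1}`. -/
def stairW (e : ℕ → W) (i l : ℕ) : W :=
  ((List.range l).map (fun t => e (i - 2 * l + 1 + 2 * t))).prod

theorem ascW_of_le (g : ℕ → W) {a b : ℕ} (h : b ≤ a) : ascW g a b = 1 := by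
  simp [ascW, Nat.sub_eq_zero_of_le h]

@[simp] theorem ascW_self (g : ℕ → W) (a : ℕ) : ascW g a a = 1 := ascW_of_le g le_rfl

theorem ascW_succ (g : ℕ → W) {a b : ℕ} (h : a ≤ b) :
    ascW g a (b + 1) = ascW g a b * g b := by
  rw [ascW, Nat.succ_sub h, List.range_succ, List.map_append, List.prod_append]
  simp [ascW, Nat.add_sub_cancel' h]

theorem ascW_split (g : ℕ → W) {a b c : ℕ} (h : a ≤ b) (h' : b ≤ c) :
    ascW g a c = ascW g a b * ascW g b c := by
  induction c, h' using Nat.le_induction with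
  | base => simp
  | succ c hc ih => rw [ascW_succ g (h.trans hc), ascW_succ g hc, ih, mul_assoc]

theorem ascW_single (g : ℕ → W) (a : ℕ) : ascW g a (a + 1) = g a := by
  rw [ascW_succ g le_rfl]; simp

theorem ascW_head (g : ℕ → W) {a b : ℕ} (h : a < b) :
    ascW g a b = g a * ascW g (a + 1) b := by
  rw [ascW_split g (Nat.le_succ a) h, ascW_single]

theorem descW_of_le (g : ℕ → W) {a b : ℕ} (h : b ≤ a) : descW g b a = 1 := by
  simp [descW, Nat.sub_eq_zero_of_le h]

@[simp] theorem descW_self (g : ℕ → W) (a : ℕ) : descW g a a = 1 := descW_of_le g le_rfl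

theorem descW_succ (g : ℕ → W) {a b : ℕ} (h : a ≤ b) :
    descW g (b + 1) a = g b * descW g b a := by
  rw [descW, Nat.succ_sub h, List.range_succ_eq_map, List.map_cons, List.prod_cons, List.map_map]
  congr 1
  rw [descW]
  congr 1
  apply List.map_congr_left
  intro k _
  simp only [Function.comp]
  congr 1
  omega

theorem descW_split (g : ℕ → W) {a b c : ℕ} (h : a ≤ b) (h' : b ≤ c) :
    descW g c a = descW g c b * descW g b a := by
  induction c, h' using Nat.le_induction with
  | base => simp
  | succ c hc ih => rw [descW_succ g (h.trans hc), descW_succ g hc, ih, mul_assoc]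

theorem descW_single (g : ℕ → W) (a : ℕ) : descW g (a + 1) a = g a := by
  rw [descW_succ g le_rfl]; simp

theorem descW_tail (g : ℕ → W) {a b : ℕ} (h : a < b) :
    descW g b a = descW g b (a + 1) * g a := by
  rw [descW_split g (Nat.le_succ a) h, descW_single]

theorem ascW_intertwine {g : ℕ → W} {X : W} {c s t : ℕ}
    (h : ∀ j, s ≤ j → j < t → X * g j = g (j + c) * X) :
    X * ascW g s t = ascW g (s + c) (t + c) * X := by
  rcases lt_or_ge t s with hst | hst
  · rw [ascW_of_le g hst.le, ascW_of_le g (by omega)]; simp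
  induction t, hst using Nat.le_induction with
  | base => simp
  | succ t ht ih =>
    rw [ascW_succ g ht, show t + 1 + c = (t + c) + 1 by omega, ascW_succ g (by omega),
      ← mul_assoc, ih (fun j h1 h2 => h j h1 (by omega)), mul_assoc, h t ht (by omega), mul_assoc]

theorem ascW_intertwine' {g : ℕ → W} {X : W} {c s t : ℕ}
    (h : ∀ j, s ≤ j → j < t → g j * X = X * g (j + c)) :
    ascW g s t * X = X * ascW g (s + c) (t + c) := by
  rcases lt_or_ge t s with hst | hst
  · rw [ascW_of_le g hst.le, ascW_of_le g (by omega)]; simp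
  induction t, hst using Nat.le_induction with
  | base => simp
  | succ t ht ih =>
    rw [ascW_succ g ht, show t + 1 + c = (t + c) + 1 by omega, ascW_succ g (by omega),
      mul_assoc, h t ht (by omega), ← mul_assoc, ih (fun j h1 h2 => h j h1 (by omega)), mul_assoc]

theorem ascW_commute {g : ℕ → W} {X : W} {s t : ℕ}
    (h : ∀ j, s ≤ j → j < t → Commute X (g j)) : Commute X (ascW g s t) :=
  ascW_intertwine (c := 0) h

theorem descW_commute {g : ℕ → W} {X : W} {s t : ℕ}
    (h : ∀ j, s ≤ j → j < t → Commute X (g j)) : Commute X (descW g t s) := by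
  rcases lt_or_ge t s with hst | hst
  · rw [descW_of_le g hst.le]; exact Commute.one_right X
  induction t, hst using Nat.le_induction with
  | base => simp
  | succ t ht ih =>
    rw [descW_succ g ht]
    exact (h t ht (by omega)).mul_right (ih fun j h1 h2 => h j h1 (by omega))

theorem stairW_commute {e : ℕ → W} {X : W} {i l : ℕ}
    (h : ∀ j, i - 2 * l + 1 ≤ j → j < i → Commute X (e j)) (hl : 2 * l ≤ i) :
    Commute X (stairW e i l) := by
  apply Commute.list_prod_right
  intro y hy
  simp only [List.mem_map, List.mem_range] at hy
  obtain ⟨t, ht, rfl⟩ := hy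
  exact h _ (by omega) (by omega)

@[simp] theorem stairW_zero (e : ℕ → W) (i : ℕ) : stairW e i 0 = 1 := by simp [stairW]

theorem stairW_succ_right (e : ℕ → W) (i l : ℕ) (h : 2 * (l + 1) ≤ i + 1) :
    stairW e (i + 1) (l + 1) = stairW e (i - 1) l * e i := by
  rw [stairW, List.range_succ, List.map_append, List.prod_append, stairW]
  congr 1
  · congr 1
    apply List.map_congr_left
    intro k hk
    congr 1; omega
  · simp only [List.map_cons, List.map_nil, List.prod_cons, List.prod_nil, mul_one]
    congr 1; omega

theorem stairW_succ_left (e : ℕ → W) (i l : ℕ) (h : 2 * (l + 1) ≤ i) :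
    stairW e i (l + 1) = e (i - 2 * l - 1) * stairW e i l := by
  rw [stairW, List.range_succ_eq_map, List.map_cons, List.prod_cons, List.map_map, stairW]
  congr 2
  · omega
  · apply List.map_congr_left
    intro k hk
    simp only [Function.comp]
    congr 1; omega

end Words

/-! ### Abstract systems of BMW generators -/

section System
variable {R W : Type*} [CommRing R] [Ring W] [Algebra R W]

/-- Elements of an `R`-algebra satisfying the BMW relations in the range `1 ≤ i < n`. -/
structure BMWSys (z q : Rˣ) (δ : R) (n : ℕ) (g gi e : ℕ → W) : Prop where
  g_gi : ∀ i, 1 ≤ i → i < n → g i * gi i = 1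
  gi_g : ∀ i, 1 ≤ i → i < n → gi i * g i = 1
  idem : ∀ i, 1 ≤ i → i < n → e i * e i = δ • e i
  braid : ∀ i, 1 ≤ i → i + 1 < n → g i * g (i + 1) * g i = g (i + 1) * g i * g (i + 1)
  gg : ∀ i j, 1 ≤ i → i + 1 < j → j < n → g i * g j = g j * g i
  ge : ∀ i j, 1 ≤ i → i + 1 < j → j < n → g i * e j = e j * g i
  eg : ∀ i j, 1 ≤ i → i + 1 < j → j < n → e i * g j = g j * e i
  eec : ∀ i j, 1 ≤ i → i + 1 < j → j < n → e i * e j = e j * e i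
  eee : ∀ i, 1 ≤ i → i + 1 < n → e i * e (i + 1) * e i = e i
  eee' : ∀ i, 1 ≤ i → i + 1 < n → e (i + 1) * e i * e (i + 1) = e (i + 1)
  gge : ∀ i, 1 ≤ i → i + 1 < n → g (i + 1) * g i * e (i + 1) = e i * e (i + 1)
  gge' : ∀ i, 1 ≤ i → i + 1 < n → g i * g (i + 1) * e i = e (i + 1) * e i
  egg : ∀ i, 1 ≤ i → i + 1 < n → e (i + 1) * g i * g (i + 1) = e (i + 1) * e i
  egg' : ∀ i, 1 ≤ i → i + 1 < n → e i * g (i + 1) * g i = e i * e (i + 1)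
  skein : ∀ i, 1 ≤ i → i < n →
    g i - gi i = ((q : R) - ((q⁻¹ : Rˣ) : R)) • (1 - e i)
  untwR : ∀ i, 1 ≤ i → i < n → g i * e i = ((z⁻¹ : Rˣ) : R) • e i
  untwL : ∀ i, 1 ≤ i → i < n → e i * g i = ((z⁻¹ : Rˣ) : R) • e i
  untwE : ∀ i, 1 ≤ i → i + 1 < n → e (i + 1) * g i * e (i + 1) = (z : R) • e (i + 1)
  untwE' : ∀ i, 1 ≤ i → i + 1 < n → e i * g (i + 1) * e i = (z : R) • e i

variable {z q : Rˣ} {δ : R} {n : ℕ} {g gi e : ℕ → W}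

/-- The subalgebra generated by `g_j, e_j`, `1 ≤ j < k`. -/
def lvl (R : Type*) {W : Type*} [CommRing R] [Ring W] [Algebra R W] (g e : ℕ → W) (k : ℕ) :
    Subalgebra R W :=
  Algebra.adjoin R {x | ∃ j, 1 ≤ j ∧ j < k ∧ (x = g j ∨ x = e j)}

theorem g_mem_lvl {k j : ℕ} (h : 1 ≤ j) (h' : j < k) : g j ∈ lvl R g e k :=
  Algebra.subset_adjoin ⟨j, h, h', Or.inl rfl⟩

theorem e_mem_lvl {k j : ℕ} (h : 1 ≤ j) (h' : j < k) : e j ∈ lvl R g e k :=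
  Algebra.subset_adjoin ⟨j, h, h', Or.inr rfl⟩

theorem lvl_mono {k k' : ℕ} (h : k ≤ k') : lvl R g e k ≤ lvl R g e k' :=
  Algebra.adjoin_mono fun _ ⟨j, h1, h2, h3⟩ => ⟨j, h1, h2.trans_le h, h3⟩

theorem ascW_mem_lvl {a b k : ℕ} (h : 1 ≤ a) (h' : b ≤ k) : ascW g a b ∈ lvl R g e k := by
  apply Subalgebra.list_prod_mem
  intro x hx
  simp only [List.mem_map, List.mem_range] at hx
  obtain ⟨t, ht, rfl⟩ := hx
  exact g_mem_lvl (by omega) (by omega)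

theorem descW_mem_lvl {a b k : ℕ} (h : 1 ≤ a) (h' : b ≤ k) : descW g b a ∈ lvl R g e k := by
  apply Subalgebra.list_prod_mem
  intro x hx
  simp only [List.mem_map, List.mem_range] at hx
  obtain ⟨t, ht, rfl⟩ := hx
  exact g_mem_lvl (by omega) (by omega)

theorem stairW_mem_lvl {i l k : ℕ} (hl : 2 * l ≤ i) (h' : i ≤ k) : stairW e i l ∈ lvl R g e k := by
  apply Subalgebra.list_prod_mem
  intro x hx
  simp only [List.mem_map, List.mem_range] at hx
  obtain ⟨t, ht, rfl⟩ := hx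
  exact e_mem_lvl (by omega) (by omega)

/-- A submodule containing `1` and closed under left multiplication by generators contains the
subalgebra generated by them. -/
theorem lvl_le_of_left {k : ℕ} {P : Submodule R W} (h1 : (1 : W) ∈ P)
    (hg : ∀ j, 1 ≤ j → j < k → ∀ x ∈ P, g j * x ∈ P)
    (he : ∀ j, 1 ≤ j → j < k → ∀ x ∈ P, e j * x ∈ P) : ∀ x ∈ lvl R g e k, x ∈ P := by
  have key : ∀ x ∈ lvl R g e k, ∀ y ∈ P, x * y ∈ P := by
    intro x hx
    induction hx using Algebra.adjoin_induction with
    | mem x hx =>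
      obtain ⟨j, h1, h2, rfl | rfl⟩ := hx
      · exact hg j h1 h2
      · exact he j h1 h2
    | algebraMap r =>
      intro y hy
      rw [← Algebra.smul_def]
      exact P.smul_mem r hy
    | add x y _ _ hx hy =>
      intro w hw
      rw [add_mul]
      exact P.add_mem (hx w hw) (hy w hw)
    | mul x y _ _ hx hy =>
      intro w hw
      rw [mul_assoc]
      exact hx _ (hy w hw)
  intro x hx
  simpa using key x hx 1 h1

theorem lvl_le_of_right {k : ℕ} {P : Submodule R W} (h1 : (1 : W) ∈ P)
    (hg : ∀ j, 1 ≤ j → j < k → ∀ x ∈ P, x * g j ∈ P)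
    (he : ∀ j, 1 ≤ j → j < k → ∀ x ∈ P, x * e j ∈ P) : ∀ x ∈ lvl R g e k, x ∈ P := by
  have key : ∀ x ∈ lvl R g e k, ∀ y ∈ P, y * x ∈ P := by
    intro x hx
    induction hx using Algebra.adjoin_induction with
    | mem x hx =>
      obtain ⟨j, h1, h2, rfl | rfl⟩ := hx
      · exact hg j h1 h2
      · exact he j h1 h2
    | algebraMap r =>
      intro y hy
      rw [← Algebra.commutes, ← Algebra.smul_def]
      exact P.smul_mem r hy
    | add x y _ _ hx hy =>
      intro w hw
      rw [mul_add]
      exact P.add_mem (hx w hw) (hy w hw)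
    | mul x y _ _ hx hy =>
      intro w hw
      rw [← mul_assoc]
      exact hy _ (hx w hw)
  intro x hx
  simpa using key x hx 1 h1

theorem commute_lvl {k : ℕ} {X : W} (hg : ∀ j, 1 ≤ j → j < k → Commute X (g j))
    (he : ∀ j, 1 ≤ j → j < k → Commute X (e j)) {x : W} (hx : x ∈ lvl R g e k) : Commute X x := by
  induction hx using Algebra.adjoin_induction with
  | mem x hx =>
    obtain ⟨j, h1, h2, rfl | rfl⟩ := hx
    · exact hg j h1 h2
    · exact he j h1 h2
  | algebraMap r => exact (Algebra.commutes r X).symm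
  | add x y _ _ hx hy => exact hx.add_right hy
  | mul x y _ _ hx hy => exact hx.mul_right hy

namespace BMWSys
variable (S : BMWSys z q δ n g gi e)
include S

theorem commute_gg {i j : ℕ} (hi : 1 ≤ i) (hj : 1 ≤ j) (hin : i < n) (hjn : j < n)
    (h : i + 1 < j ∨ j + 1 < i) : Commute (g i) (g j) := by
  rcases h with h | h
  · exact S.gg i j hi h hjn
  · exact (S.gg j i hj h hin).symm

theorem commute_ge {i j : ℕ} (hi : 1 ≤ i) (hj : 1 ≤ j) (hin : i < n) (hjn : j < n)
    (h : i + 1 < j ∨ j + 1 < i) : Commute (g i) (e j) := by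
  rcases h with h | h
  · exact S.ge i j hi h hjn
  · exact (S.eg j i hj h hin).symm

theorem commute_ee {i j : ℕ} (hi : 1 ≤ i) (hj : 1 ≤ j) (hin : i < n) (hjn : j < n)
    (h : i + 1 < j ∨ j + 1 < i) : Commute (e i) (e j) := by
  rcases h with h | h
  · exact S.eec i j hi h hjn
  · exact (S.eec j i hj h hin).symm

theorem gi_eq {i : ℕ} (hi : 1 ≤ i) (hin : i < n) :
    gi i = g i - ((q : R) - ((q⁻¹ : Rˣ) : R)) • (1 - e i) := by
  rw [← S.skein i hi hin]; abel

theorem g_sq {i : ℕ} (hi : 1 ≤ i) (hin : i < n) :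
    g i * g i = 1 + ((q : R) - ((q⁻¹ : Rˣ) : R)) • g i
      - (((q : R) - ((q⁻¹ : Rˣ) : R)) * ((z⁻¹ : Rˣ) : R)) • e i := by
  have h1 := congrArg (fun x => g i * x) (S.skein i hi hin)
  simp only [mul_sub, mul_smul_comm, S.g_gi i hi hin, S.untwR i hi hin, mul_one] at h1
  rw [sub_eq_iff_eq_add] at h1
  rw [h1]
  module

/-- `g_i` shifts up past an ascending product. -/
theorem g_ascW {a b i : ℕ} (ha : 1 ≤ a) (hai : a ≤ i) (hib : i + 1 < b) (hb : b ≤ n) :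
    ascW g a b * g i = g (i + 1) * ascW g a b := by
  rw [ascW_split g (show a ≤ i by omega) (show i ≤ b by omega),
    ascW_head g (show i < b by omega), ascW_head g (show i + 1 < b by omega)]
  have c1 : Commute (g i) (ascW g (i + 1 + 1) b) :=
    ascW_commute fun j h1 h2 => S.commute_gg (by omega) (by omega) (by omega) (by omega) (by omega)
  have c2 : Commute (g (i + 1)) (ascW g a i) :=
    ascW_commute fun j h1 h2 => S.commute_gg (by omega) (by omega) (by omega) (by omega) (by omega)
  have hb := S.braid i (by omega) (by omega)
  calc ascW g a i * (g i * (g (i + 1) * ascW g (i + 1 + 1) b)) * g i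
      = ascW g a i * (g i * g (i + 1) * g i) * ascW g (i + 1 + 1) b := by
        simp only [mul_assoc]; rw [← c1.eq]
    _ = ascW g a i * (g (i + 1) * g i * g (i + 1)) * ascW g (i + 1 + 1) b := by rw [hb]
    _ = g (i + 1) * (ascW g a i * (g i * (g (i + 1) * ascW g (i + 1 + 1) b))) := by
        simp only [← mul_assoc]; rw [c2.eq]

/-- `g_i` shifts up past a descending product. -/
theorem g_descW {a b i : ℕ} (ha : 1 ≤ a) (hai : a ≤ i) (hib : i + 1 < b) (hb : b ≤ n) :
    g i * descW g b a = descW g b a * g (i + 1) := by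
  rw [descW_split g (show a ≤ i by omega) (show i ≤ b by omega),
    descW_tail g (show i < b by omega), descW_tail g (show i + 1 < b by omega)]
  have c1 : Commute (g i) (descW g b (i + 1 + 1)) :=
    descW_commute fun j h1 h2 => S.commute_gg (by omega) (by omega) (by omega) (by omega) (by omega)
  have c2 : Commute (g (i + 1)) (descW g i a) :=
    descW_commute fun j h1 h2 => S.commute_gg (by omega) (by omega) (by omega) (by omega) (by omega)
  have hb := S.braid i (by omega) (by omega)
  calc g i * (descW g b (i + 1 + 1) * g (i + 1) * g i * descW g i a)
      = descW g b (i + 1 + 1) * (g i * g (i + 1) * g i) * descW g i a := by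
        simp only [← mul_assoc]; rw [c1.eq]
    _ = descW g b (i + 1 + 1) * (g (i + 1) * g i * g (i + 1)) * descW g i a := by rw [hb]
    _ = descW g b (i + 1 + 1) * g (i + 1) * g i * descW g i a * g (i + 1) := by
        simp only [mul_assoc]; rw [c2.eq]

end BMWSys
end System

section LevelStructure
variable {R W : Type*} [CommRing R] [Ring W] [Algebra R W]
variable {z q : Rˣ} {δ : R} {n : ℕ} {g gi e : ℕ → W}

/-- The ideal of the level-`k` subalgebra generated by `e_{k-1}`. -/
def eIdeal (R : Type*) {W : Type*} [CommRing R] [Ring W] [Algebra R W] (g e : ℕ → W) (k : ℕ) :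
    Submodule R W :=
  Submodule.span R {w | ∃ x ∈ lvl R g e k, ∃ y ∈ lvl R g e k, w = x * e (k - 1) * y}

theorem mul_mem_eIdeal_left {k : ℕ} {a w : W} (ha : a ∈ lvl R g e k) (hw : w ∈ eIdeal R g e k) :
    a * w ∈ eIdeal R g e k := by
  have : eIdeal R g e k ≤ (eIdeal R g e k).comap (LinearMap.mulLeft R a) := by
    refine Submodule.span_le.2 ?_
    rintro _ ⟨x, hx, y, hy, rfl⟩
    exact Submodule.subset_span ⟨a * x, mul_mem ha hx, y, hy, by simp [mul_assoc]⟩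
  exact this hw

theorem mul_mem_eIdeal_right {k : ℕ} {a w : W} (ha : a ∈ lvl R g e k) (hw : w ∈ eIdeal R g e k) :
    w * a ∈ eIdeal R g e k := by
  have : eIdeal R g e k ≤ (eIdeal R g e k).comap (LinearMap.mulRight R a) := by
    refine Submodule.span_le.2 ?_
    rintro _ ⟨x, hx, y, hy, rfl⟩
    exact Submodule.subset_span ⟨x, hx, y * a, mul_mem hy ha, by simp [mul_assoc]⟩
  exact this hw

namespace BMWSys
variable (S : BMWSys z q δ n g gi e)
include S

theorem e_mem_eIdeal {k i : ℕ} (hi : 1 ≤ i) (hik : i < k) (hk : k ≤ n) : e i ∈ eIdeal R g e k := by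
  obtain ⟨m, rfl⟩ : ∃ m, k = i + 1 + m := ⟨k - (i + 1), by omega⟩
  clear hik
  induction m generalizing i with
  | zero =>
    refine Submodule.subset_span ⟨1, one_mem _, 1, one_mem _, ?_⟩
    simp
  | succ m ih =>
    have h1 := ih (i := i + 1) (by omega) (by omega)
    rw [show i + 1 + 1 + m = i + 1 + (m + 1) by omega] at h1
    rw [← S.eee i hi (by omega)]
    exact mul_mem_eIdeal_right (e_mem_lvl hi (by omega))
      (mul_mem_eIdeal_left (e_mem_lvl hi (by omega)) h1)

/-- Coset decomposition of the level-`k` subalgebra. -/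
theorem lvl_decomp {k : ℕ} (hk1 : 1 ≤ k) (hk : k ≤ n) {P : Submodule R W}
    (hP : eIdeal R g e k ≤ P)
    (hA : ∀ a, 1 ≤ a → a ≤ k → ∀ y ∈ lvl R g e (k - 1), ascW g a k * y ∈ P) :
    ∀ x ∈ lvl R g e k, x ∈ P := by
  suffices h : ∀ x ∈ lvl R g e k, x ∈ Submodule.span R
      {w | ∃ a, 1 ≤ a ∧ a ≤ k ∧ ∃ y ∈ lvl R g e (k - 1), w = ascW g a k * y} ⊔ eIdeal R g e k by
    intro x hx
    refine (sup_le (Submodule.span_le.2 ?_) hP : _ ≤ P) (h x hx)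
    rintro _ ⟨a, h1, h2, y, hy, rfl⟩
    exact hA a h1 h2 y hy
  set T := Submodule.span R
      {w | ∃ a, 1 ≤ a ∧ a ≤ k ∧ ∃ y ∈ lvl R g e (k - 1), w = ascW g a k * y} ⊔ eIdeal R g e k
    with hT
  have hI : eIdeal R g e k ≤ T := le_sup_right
  have hmem : ∀ a, 1 ≤ a → a ≤ k → ∀ y ∈ lvl R g e (k - 1), ascW g a k * y ∈ T :=
    fun a h1 h2 y hy => Submodule.mem_sup_left
      (Submodule.subset_span ⟨a, h1, h2, y, hy, rfl⟩)
  have hsub : lvl R g e (k - 1) ≤ lvl R g e k := lvl_mono (by omega)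
  refine lvl_le_of_left ?_ ?_ ?_
  · simpa using hmem k hk1 le_rfl 1 (one_mem _)
  · intro j hj hjk x hx
    have : T ≤ T.comap (LinearMap.mulLeft R (g j)) := by
      refine sup_le (Submodule.span_le.2 ?_) fun w hw =>
        hI (mul_mem_eIdeal_left (g_mem_lvl hj hjk) hw)
      rintro _ ⟨a, h1, h2, y, hy, rfl⟩
      simp only [Submodule.comap_coe, Set.mem_preimage, LinearMap.mulLeft_apply, SetLike.mem_coe]
      rcases lt_trichotomy j a with h | rfl | h
      · rcases Nat.lt_or_ge (j + 1) a with h' | h'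
        · have c : Commute (g j) (ascW g a k) := ascW_commute fun i h1 h2 =>
            S.commute_gg hj (by omega) (by omega) (by omega) (by omega)
          rw [← mul_assoc, c.eq, mul_assoc]
          exact hmem a h1 h2 _ (mul_mem (g_mem_lvl hj (by omega)) hy)
        · obtain rfl : a = j + 1 := by omega
          rw [← mul_assoc, ← ascW_head g hjk]
          exact hmem j hj (by omega) y hy
      · rw [ascW_head g hjk, ← mul_assoc, ← mul_assoc, S.g_sq hj (by omega)]
        simp only [sub_mul, add_mul, one_mul, smul_mul_assoc]
        refine T.sub_mem (T.add_mem (hmem _ (by omega) (by omega) y hy) (T.smul_mem _ ?_))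
          (T.smul_mem _ (hI ?_))
        · rw [← ascW_head g hjk]; exact hmem _ h1 h2 y hy
        · exact mul_mem_eIdeal_right (hsub hy) (mul_mem_eIdeal_right
            (ascW_mem_lvl (by omega) le_rfl) (S.e_mem_eIdeal hj hjk hk))
      · obtain ⟨i, rfl⟩ : ∃ i, j = i + 1 := ⟨j - 1, by omega⟩
        rw [← mul_assoc, ← S.g_ascW h1 (by omega) hjk hk, mul_assoc]
        exact hmem a h1 h2 _ (mul_mem (g_mem_lvl (by omega) (by omega)) hy)
    exact this hx
  · intro j hj hjk x hx
    have : T ≤ T.comap (LinearMap.mulLeft R (e j)) := by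
      refine sup_le (Submodule.span_le.2 ?_) fun w hw =>
        hI (mul_mem_eIdeal_left (e_mem_lvl hj hjk) hw)
      rintro _ ⟨a, h1, h2, y, hy, rfl⟩
      refine hI ?_
      rw [LinearMap.mulLeft_apply]
      exact mul_mem_eIdeal_right (mul_mem (ascW_mem_lvl h1 le_rfl) (hsub hy))
        (S.e_mem_eIdeal hj hjk hk)
    exact this hx

theorem gee {m : ℕ} (hm : 1 ≤ m) (hn : m + 1 < n) :
    g (m + 1) * e m * e (m + 1) =
      (g m - ((q : R) - ((q⁻¹ : Rˣ) : R)) • (1 - e m)) * e (m + 1) := by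
  have h1 : gi (m + 1) * (e m * e (m + 1)) = g m * e (m + 1) := by
    rw [← S.gge m hm hn, ← mul_assoc, ← mul_assoc, S.gi_g _ (by omega) hn, one_mul]
  rw [S.gi_eq (by omega) hn] at h1
  have h2 := S.eee' m hm hn
  simp only [sub_mul, smul_mul_assoc, one_mul] at h1 ⊢
  rw [← mul_assoc (e (m + 1)), h2] at h1
  rw [← h1, mul_assoc]
  module

theorem eeg {m : ℕ} (hm : 1 ≤ m) (hn : m + 1 < n) :
    e (m + 1) * e m * g (m + 1) =
      e (m + 1) * (g m - ((q : R) - ((q⁻¹ : Rˣ) : R)) • (1 - e m)) := by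
  have h1 : (e (m + 1) * e m) * gi (m + 1) = e (m + 1) * g m := by
    rw [← S.egg m hm hn, mul_assoc, S.g_gi _ (by omega) hn, mul_one]
  rw [S.gi_eq (by omega) hn] at h1
  have h2 := S.eee' m hm hn
  simp only [mul_sub, mul_smul_comm, mul_one] at h1 ⊢
  rw [h2] at h1
  rw [← h1]
  module

theorem commute_g_lvl {k i : ℕ} (hi : 1 ≤ i) (hk : k < i) (hin : i < n) {x : W}
    (hx : x ∈ lvl R g e k) : Commute (g i) x :=
  commute_lvl (fun j h1 h2 => S.commute_gg (by omega) (by omega) (by omega) (by omega) (by omega))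
    (fun j h1 h2 => S.commute_ge (by omega) (by omega) (by omega) (by omega) (by omega)) hx

theorem commute_e_lvl {k i : ℕ} (hi : 1 ≤ i) (hk : k < i) (hin : i < n) {x : W}
    (hx : x ∈ lvl R g e k) : Commute (e i) x :=
  commute_lvl
    (fun j h1 h2 => (S.commute_ge (by omega) (by omega) (by omega) (by omega) (by omega)).symm)
    (fun j h1 h2 => S.commute_ee (by omega) (by omega) (by omega) (by omega) (by omega)) hx

/-- `A_{m+1} e_m = A_m e_m` and `e_m A_{m+1} = e_m A_m`. -/
theorem lvl_mul_e_aux {m : ℕ} (hm : 1 ≤ m) (hn : m < n) :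
    (∀ x ∈ lvl R g e (m + 1), ∃ y ∈ lvl R g e m, x * e m = y * e m) ∧
    (∀ x ∈ lvl R g e (m + 1), ∃ y ∈ lvl R g e m, e m * x = e m * y) := by
  induction m, hm using Nat.le_induction with
  | base =>
    have hsc : ∀ x ∈ lvl R g e 1, ∃ r : R, x = algebraMap R W r := by
      intro x hx
      have : {x : W | ∃ j, 1 ≤ j ∧ j < 1 ∧ (x = g j ∨ x = e j)} = ∅ := by
        ext x; simp only [Set.mem_ofPred_eq, Set.mem_empty_iff_false, iff_false]
        rintro ⟨j, h1, h2, -⟩; omega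
      rw [lvl, this, Algebra.adjoin_empty, Algebra.mem_bot] at hx
      obtain ⟨r, hr⟩ := hx
      exact ⟨r, hr.symm⟩
    constructor
    · intro x hx
      have h : x ∈ ((lvl R g e 1).toSubmodule.map
        (LinearMap.mulRight R (e 1))).comap (LinearMap.mulRight R (e 1)) := by
       refine lvl_le_of_left ?_ ?_ ?_ x hx
       · exact ⟨1, Subalgebra.one_mem (lvl R g e 1), by simp⟩
       · rintro j h1 h2 x ⟨y, hy, hxy⟩
         obtain rfl : j = 1 := by omega
         obtain ⟨r, rfl⟩ := hsc y hy
         refine ⟨algebraMap R W (r * ((z⁻¹ : Rˣ) : R)),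
           Subalgebra.algebraMap_mem (lvl R g e 1) _, ?_⟩
         simp only [LinearMap.mulRight_apply] at hxy ⊢
         rw [mul_assoc, ← hxy, ← mul_assoc, ← Algebra.commutes, mul_assoc, S.untwR 1 le_rfl hn,
           map_mul, mul_assoc, ← Algebra.smul_def ((z⁻¹ : Rˣ) : R)]
       · rintro j h1 h2 x ⟨y, hy, hxy⟩
         obtain rfl : j = 1 := by omega
         obtain ⟨r, rfl⟩ := hsc y hy
         refine ⟨algebraMap R W (r * δ), Subalgebra.algebraMap_mem (lvl R g e 1) _, ?_⟩
         simp only [LinearMap.mulRight_apply] at hxy ⊢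
         rw [mul_assoc, ← hxy, ← mul_assoc, ← Algebra.commutes, mul_assoc, S.idem 1 le_rfl hn,
           map_mul, mul_assoc, ← Algebra.smul_def δ]
      obtain ⟨y, hy, hxy⟩ := h
      exact ⟨y, hy, hxy.symm⟩
    · intro x hx
      have h : x ∈ ((lvl R g e 1).toSubmodule.map
        (LinearMap.mulLeft R (e 1))).comap (LinearMap.mulLeft R (e 1)) := by
       refine lvl_le_of_right ?_ ?_ ?_ x hx
       · exact ⟨1, Subalgebra.one_mem (lvl R g e 1), by simp⟩
       · rintro j h1 h2 x ⟨y, hy, hxy⟩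
         obtain rfl : j = 1 := by omega
         obtain ⟨r, rfl⟩ := hsc y hy
         refine ⟨algebraMap R W (r * ((z⁻¹ : Rˣ) : R)),
           Subalgebra.algebraMap_mem (lvl R g e 1) _, ?_⟩
         simp only [LinearMap.mulLeft_apply] at hxy ⊢
         rw [← mul_assoc, ← hxy, mul_assoc, Algebra.commutes, ← mul_assoc, S.untwL 1 le_rfl hn,
           ← Algebra.commutes, ← Algebra.commutes, map_mul, mul_assoc, Algebra.smul_def]
       · rintro j h1 h2 x ⟨y, hy, hxy⟩
         obtain rfl : j = 1 := by omega
         obtain ⟨r, rfl⟩ := hsc y hy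
         refine ⟨algebraMap R W (r * δ), Subalgebra.algebraMap_mem (lvl R g e 1) _, ?_⟩
         simp only [LinearMap.mulLeft_apply] at hxy ⊢
         rw [← mul_assoc, ← hxy, mul_assoc, Algebra.commutes, ← mul_assoc, S.idem 1 le_rfl hn,
           ← Algebra.commutes, ← Algebra.commutes, map_mul, mul_assoc, Algebra.smul_def]
      obtain ⟨y, hy, hxy⟩ := h
      exact ⟨y, hy, hxy.symm⟩
  | succ m hm ih =>
    obtain ⟨ih1, ih2⟩ := ih (by omega)
    set V : Submodule R W := (lvl R g e m).toSubmodule ⊔ Submodule.span R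
      {w | ∃ x ∈ lvl R g e m, ∃ y ∈ lvl R g e m, w = x * g m * y ∨ w = x * e m * y} with hV
    have hdec : ∀ x ∈ lvl R g e (m + 1), x ∈ V := by
      refine S.lvl_decomp (by omega) hn.le ?_ ?_
      · refine Submodule.span_le.2 ?_
        rintro _ ⟨x, hx, y, hy, rfl⟩
        obtain ⟨x', hx', h1⟩ := ih1 x hx
        obtain ⟨y', hy', h2⟩ := ih2 y hy
        refine Submodule.mem_sup_right (Submodule.subset_span
          ⟨x', hx', y', hy', Or.inr ?_⟩)
        rw [Nat.add_sub_cancel, h1, mul_assoc, h2, mul_assoc]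
      · intro a h1 h2 y hy
        rcases Nat.lt_or_ge a (m + 1) with h | h
        · rw [ascW_succ g (by omega)]
          exact Submodule.mem_sup_right (Submodule.subset_span
            ⟨_, ascW_mem_lvl h1 le_rfl, y, hy, Or.inl rfl⟩)
        · obtain rfl : a = m + 1 := by omega
          rw [ascW_self, one_mul]
          exact Submodule.mem_sup_left hy
    have hlm : lvl R g e m ≤ lvl R g e (m + 1) := lvl_mono (by omega)
    have hgm : g m ∈ lvl R g e (m + 1) := g_mem_lvl hm (by omega)
    have hem : e m ∈ lvl R g e (m + 1) := e_mem_lvl hm (by omega)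
    have hgim : g m - ((q : R) - ((q⁻¹ : Rˣ) : R)) • (1 - e m) ∈ lvl R g e (m + 1) :=
      sub_mem hgm (Subalgebra.smul_mem _ (sub_mem (one_mem _) hem) _)
    constructor
    · set P : Submodule R W := ((lvl R g e (m + 1)).toSubmodule.map
        (LinearMap.mulRight R (e (m + 1)))).comap (LinearMap.mulRight R (e (m + 1))) with hP
      have hPi : ∀ x y, y ∈ lvl R g e (m + 1) → x * e (m + 1) = y * e (m + 1) → x ∈ P :=
        fun x y hy hxy => ⟨y, hy, by simpa using hxy.symm⟩
      have hPm : ∀ c, c ∈ lvl R g e (m + 1) → ∀ x ∈ P, c * x ∈ P := by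
        rintro c hc x ⟨y, hy, hxy⟩
        refine hPi _ (c * y) (mul_mem hc hy) ?_
        simp only [LinearMap.mulRight_apply] at hxy
        rw [mul_assoc, ← hxy, mul_assoc]
      have hPr : ∀ c, c ∈ lvl R g e m → ∀ x ∈ P, x * c ∈ P := by
        rintro c hc x ⟨y, hy, hxy⟩
        refine hPi _ (y * c) (mul_mem hy (hlm hc)) ?_
        simp only [LinearMap.mulRight_apply] at hxy
        have cc := S.commute_e_lvl (i := m + 1) (by omega) (by omega) (by omega) hc
        rw [mul_assoc, ← cc.eq, ← mul_assoc, ← hxy, mul_assoc, mul_assoc, ← cc.eq]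
      have hg1 : g (m + 1) ∈ P := hPi _ (algebraMap R W ((z⁻¹ : Rˣ) : R)) (algebraMap_mem _ _) <| by
        rw [S.untwR _ (by omega) hn, ← Algebra.smul_def]
      have he1 : e (m + 1) ∈ P := hPi _ (algebraMap R W δ) (algebraMap_mem _ _) <| by
        rw [S.idem _ (by omega) hn, ← Algebra.smul_def]
      have hgg : g (m + 1) * g m ∈ P := hPi _ (e m) hem (S.gge m hm hn)
      have hge : g (m + 1) * e m ∈ P := hPi _ _ hgim (S.gee hm hn)
      have heg : e (m + 1) * g m ∈ P :=
        hPi _ (algebraMap R W (z : R)) (algebraMap_mem _ _) <| by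
          rw [S.untwE _ hm hn, ← Algebra.smul_def]
      have hee : e (m + 1) * e m ∈ P := hPi _ 1 (one_mem _) <| by
          rw [S.eee' _ hm hn, one_mul]
      have main : ∀ c, (c = g (m + 1) ∨ c = e (m + 1)) → c ∈ P → c * g m ∈ P → c * e m ∈ P →
          ∀ y ∈ lvl R g e (m + 1), c * y ∈ P := by
        intro c hc hc0 hcg hce y hy
        have hcc : ∀ x ∈ lvl R g e m, Commute c x := by
          intro x hx
          rcases hc with rfl | rfl
          · exact S.commute_g_lvl (by omega) (by omega) (by omega) hx
          · exact S.commute_e_lvl (by omega) (by omega) (by omega) hx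
        have : V ≤ P.comap (LinearMap.mulLeft R c) := by
          refine sup_le (fun x hx => hPr x hx c hc0) (Submodule.span_le.2 ?_)
          rintro _ ⟨x, hx, y, hy, rfl | rfl⟩
          · simp only [Submodule.comap_coe, Set.mem_preimage, LinearMap.mulLeft_apply,
              SetLike.mem_coe]
            rw [← mul_assoc, ← mul_assoc, (hcc x hx).eq, mul_assoc x]
            exact hPr y hy _ (hPm x (hlm hx) _ hcg)
          · simp only [Submodule.comap_coe, Set.mem_preimage, LinearMap.mulLeft_apply,
              SetLike.mem_coe]
            rw [← mul_assoc, ← mul_assoc, (hcc x hx).eq, mul_assoc x]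
            exact hPr y hy _ (hPm x (hlm hx) _ hce)
        exact this (hdec y hy)
      have hcomp : ∀ c, (∀ y ∈ lvl R g e (m + 1), c * y ∈ P) → ∀ x ∈ P, c * x ∈ P := by
        rintro c hc x ⟨y, hy, hxy⟩
        obtain ⟨w, hw, hw'⟩ := hc y hy
        refine hPi _ w hw ?_
        simp only [LinearMap.mulRight_apply] at hxy hw'
        rw [hw', mul_assoc, ← hxy, mul_assoc]
      intro x hx
      have hx' : x ∈ P := by
        refine lvl_le_of_left ?_ ?_ ?_ x hx
        · exact hPi _ 1 (one_mem _) rfl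
        · intro j h1 h2
          rcases Nat.lt_or_ge j (m + 1) with h | h
          · exact hPm _ (g_mem_lvl h1 h)
          · obtain rfl : j = m + 1 := by omega
            exact hcomp _ (main _ (Or.inl rfl) hg1 hgg hge)
        · intro j h1 h2
          rcases Nat.lt_or_ge j (m + 1) with h | h
          · exact hPm _ (e_mem_lvl h1 h)
          · obtain rfl : j = m + 1 := by omega
            exact hcomp _ (main _ (Or.inr rfl) he1 heg hee)
      obtain ⟨y, hy, hxy⟩ := hx'
      exact ⟨y, hy, hxy.symm⟩
    · set P : Submodule R W := ((lvl R g e (m + 1)).toSubmodule.map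
        (LinearMap.mulLeft R (e (m + 1)))).comap (LinearMap.mulLeft R (e (m + 1))) with hP
      have hPi : ∀ x y, y ∈ lvl R g e (m + 1) → e (m + 1) * x = e (m + 1) * y → x ∈ P :=
        fun x y hy hxy => ⟨y, hy, by simpa using hxy.symm⟩
      have hPm : ∀ c, c ∈ lvl R g e (m + 1) → ∀ x ∈ P, x * c ∈ P := by
        rintro c hc x ⟨y, hy, hxy⟩
        refine hPi _ (y * c) (mul_mem hy hc) ?_
        simp only [LinearMap.mulLeft_apply] at hxy
        rw [← mul_assoc, ← hxy, mul_assoc]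
      have hPr : ∀ c, c ∈ lvl R g e m → ∀ x ∈ P, c * x ∈ P := by
        rintro c hc x ⟨y, hy, hxy⟩
        refine hPi _ (c * y) (mul_mem (hlm hc) hy) ?_
        simp only [LinearMap.mulLeft_apply] at hxy
        have cc := S.commute_e_lvl (i := m + 1) (by omega) (by omega) (by omega) hc
        rw [← mul_assoc, cc.eq, mul_assoc, ← hxy, ← mul_assoc, ← mul_assoc, cc.eq]
      have hg1 : g (m + 1) ∈ P := hPi _ (algebraMap R W ((z⁻¹ : Rˣ) : R)) (algebraMap_mem _ _) <| by
        rw [S.untwL _ (by omega) hn, ← Algebra.commutes, ← Algebra.smul_def]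
      have he1 : e (m + 1) ∈ P := hPi _ (algebraMap R W δ) (algebraMap_mem _ _) <| by
        rw [S.idem _ (by omega) hn, ← Algebra.commutes, ← Algebra.smul_def]
      have hgg : g m * g (m + 1) ∈ P := hPi _ (e m) hem <| by
        rw [← mul_assoc, S.egg m hm hn]
      have hge : e m * g (m + 1) ∈ P := hPi _ _ hgim <| by rw [← mul_assoc, S.eeg hm hn]
      have heg : g m * e (m + 1) ∈ P :=
        hPi _ (algebraMap R W (z : R)) (algebraMap_mem _ _) <| by
          rw [← mul_assoc, S.untwE _ hm hn, ← Algebra.commutes, ← Algebra.smul_def]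
      have hee : e m * e (m + 1) ∈ P := hPi _ 1 (one_mem _) <| by
          rw [← mul_assoc, S.eee' _ hm hn, mul_one]
      have main : ∀ c, (c = g (m + 1) ∨ c = e (m + 1)) → c ∈ P → g m * c ∈ P → e m * c ∈ P →
          ∀ y ∈ lvl R g e (m + 1), y * c ∈ P := by
        intro c hc hc0 hcg hce y hy
        have hcc : ∀ x ∈ lvl R g e m, Commute c x := by
          intro x hx
          rcases hc with rfl | rfl
          · exact S.commute_g_lvl (by omega) (by omega) (by omega) hx
          · exact S.commute_e_lvl (by omega) (by omega) (by omega) hx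
        have : V ≤ P.comap (LinearMap.mulRight R c) := by
          refine sup_le (fun x hx => hPr x hx c hc0) (Submodule.span_le.2 ?_)
          rintro _ ⟨x, hx, y, hy, rfl | rfl⟩
          · simp only [Submodule.comap_coe, Set.mem_preimage, LinearMap.mulRight_apply,
              SetLike.mem_coe]
            rw [mul_assoc, ← (hcc y hy).eq, mul_assoc x, ← mul_assoc (g m)]
            exact hPr x hx _ (hPm y (hlm hy) _ hcg)
          · simp only [Submodule.comap_coe, Set.mem_preimage, LinearMap.mulRight_apply,
              SetLike.mem_coe]
            rw [mul_assoc, ← (hcc y hy).eq, mul_assoc x, ← mul_assoc (e m)]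
            exact hPr x hx _ (hPm y (hlm hy) _ hce)
        exact this (hdec y hy)
      have hcomp : ∀ c, (∀ y ∈ lvl R g e (m + 1), y * c ∈ P) → ∀ x ∈ P, x * c ∈ P := by
        rintro c hc x ⟨y, hy, hxy⟩
        obtain ⟨w, hw, hw'⟩ := hc y hy
        refine hPi _ w hw ?_
        simp only [LinearMap.mulLeft_apply] at hxy hw'
        rw [hw', ← mul_assoc, ← hxy, mul_assoc]
      intro x hx
      have hx' : x ∈ P := by
        refine lvl_le_of_right ?_ ?_ ?_ x hx
        · exact hPi _ 1 (one_mem _) rfl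
        · intro j h1 h2
          rcases Nat.lt_or_ge j (m + 1) with h | h
          · exact hPm _ (g_mem_lvl h1 h)
          · obtain rfl : j = m + 1 := by omega
            exact hcomp _ (main _ (Or.inl rfl) hg1 hgg hge)
        · intro j h1 h2
          rcases Nat.lt_or_ge j (m + 1) with h | h
          · exact hPm _ (e_mem_lvl h1 h)
          · obtain rfl : j = m + 1 := by omega
            exact hcomp _ (main _ (Or.inr rfl) he1 heg hee)
      obtain ⟨y, hy, hxy⟩ := hx'
      exact ⟨y, hy, hxy.symm⟩

theorem lvl_mul_e {m : ℕ} (hm : 1 ≤ m) (hn : m < n) {x : W} (hx : x ∈ lvl R g e (m + 1)) :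
    ∃ y ∈ lvl R g e m, x * e m = y * e m := (S.lvl_mul_e_aux hm hn).1 x hx

theorem e_mul_lvl {m : ℕ} (hm : 1 ≤ m) (hn : m < n) {x : W} (hx : x ∈ lvl R g e (m + 1)) :
    ∃ y ∈ lvl R g e m, e m * x = e m * y := (S.lvl_mul_e_aux hm hn).2 x hx

end BMWSys
end LevelStructure

section Shuffle
variable {R W : Type*} [CommRing R] [Ring W] [Algebra R W]
variable {z q : Rˣ} {δ : R} {n : ℕ} {g gi e : ℕ → W}

/-- The weighted sum of the minimal coset representatives for two adjacent blocks of sizes `p`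
and `t`, placed on the strands `a+1, …, a+p+t`. -/
def shufW (q : Rˣ) (g : ℕ → W) (a : ℕ) : ℕ → ℕ → W
  | 0, _ => 1
  | _ + 1, 0 => 1
  | p + 1, t + 1 => shufW q g a (p + 1) t +
      ((q : R) ^ (t + 1)) • (ascW g (a + p + 1) (a + p + t + 2) * shufW q g a p (t + 1))
termination_by p t => p + t

@[simp] theorem shufW_zero_left (a t : ℕ) : shufW q g a 0 t = 1 := by rw [shufW]

@[simp] theorem shufW_zero_right (a p : ℕ) : shufW q g a p 0 = 1 := by
  cases p <;> rw [shufW]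

theorem shufW_succ (a p t : ℕ) : shufW q g a (p + 1) (t + 1) = shufW q g a (p + 1) t +
    ((q : R) ^ (t + 1)) • (ascW g (a + p + 1) (a + p + t + 2) * shufW q g a p (t + 1)) := by
  rw [shufW]

theorem shufW_one_right (a p : ℕ) :
    shufW q g a (p + 1) 1 = 1 + (q : R) • (g (a + p + 1) * shufW q g a p 1) := by
  rw [shufW_succ, shufW_zero_right, ascW_single]; simp

theorem shufW_one_left (a t : ℕ) :
    shufW q g a 1 (t + 1) = shufW q g a 1 t + ((q : R) ^ (t + 1)) • ascW g (a + 1) (a + t + 2) := by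
  rw [shufW_succ]; simp

theorem shufW_mem {k a p t : ℕ} (h : a + p + t ≤ k) : shufW q g a p t ∈ lvl R g e k := by
  induction p, t using shufW.induct with
  | case1 => simp
  | case2 => simp
  | case3 p t ih1 ih2 =>
    rw [shufW_succ]
    exact add_mem (ih1 (by omega)) (Subalgebra.smul_mem _
      (mul_mem (ascW_mem_lvl (by omega) (by omega)) (ih2 (by omega))) _)

theorem shufW_intertwine {X : W} {c a p t : ℕ}
    (h : ∀ j, a < j → j < a + p + t → X * g j = g (j + c) * X) :
    X * shufW q g a p t = shufW q g (a + c) p t * X := by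
  induction p, t using shufW.induct with
  | case1 => simp
  | case2 => simp
  | case3 p t ih1 ih2 =>
    rw [shufW_succ, shufW_succ, mul_add, add_mul, ih1 (fun j h1 h2 => h j h1 (by omega)),
      mul_smul_comm, smul_mul_assoc, ← mul_assoc,
      ascW_intertwine (fun j h1 h2 => h j (by omega) (by omega)), mul_assoc,
      ih2 (fun j h1 h2 => h j h1 (by omega)), mul_assoc,
      show a + p + 1 + c = a + c + p + 1 by omega,
      show a + p + t + 2 + c = a + c + p + t + 2 by omega]

theorem shufW_intertwine' {X : W} {c a p t : ℕ}
    (h : ∀ j, a < j → j < a + p + t → g j * X = X * g (j + c)) :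
    shufW q g a p t * X = X * shufW q g (a + c) p t := by
  induction p, t using shufW.induct with
  | case1 => simp
  | case2 => simp
  | case3 p t ih1 ih2 =>
    rw [shufW_succ, shufW_succ, mul_add, add_mul, ih1 (fun j h1 h2 => h j h1 (by omega)),
      mul_smul_comm, smul_mul_assoc, mul_assoc,
      ih2 (fun j h1 h2 => h j h1 (by omega)), ← mul_assoc,
      ascW_intertwine' (fun j h1 h2 => h j (by omega) (by omega)), mul_assoc,
      show a + p + 1 + c = a + c + p + 1 by omega,
      show a + p + t + 2 + c = a + c + p + t + 2 by omega]

theorem shufW_commute {X : W} {a p t : ℕ}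
    (h : ∀ j, a < j → j < a + p + t → Commute X (g j)) : Commute X (shufW q g a p t) :=
  shufW_intertwine (c := 0) h

namespace BMWSys
variable (S : BMWSys z q δ n g gi e)
include S

theorem shufW_commute_ascW {a p t s r : ℕ} (hs : a + p + t < s) (hr : r ≤ n) :
    Commute (shufW q g a p t) (ascW g s r) := by
  rcases Nat.lt_or_ge s r with h | h
  · exact (shufW_commute fun j h1 h2 => (ascW_commute fun i h3 h4 =>
      S.commute_gg (by omega) (by omega) (by omega) (by omega) (by omega)).symm).symm
  · rw [ascW_of_le g h]; exact Commute.one_right _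

theorem shufW_commute_descW {a p t s r : ℕ} (hs : a + p + t < s) (hr : r ≤ n) :
    Commute (shufW q g a p t) (descW g r s) := by
  rcases Nat.lt_or_ge s r with h | h
  · exact (shufW_commute fun j h1 h2 => (descW_commute fun i h3 h4 =>
      S.commute_gg (by omega) (by omega) (by omega) (by omega) (by omega)).symm).symm
  · rw [descW_of_le g h]; exact Commute.one_right _

theorem shufW_commute_shufW {a p t a' p' t' : ℕ} (hs : a + p + t ≤ a') (hr : a' + p' + t' ≤ n) :
    Commute (shufW q g a p t) (shufW q g a' p' t') :=
  shufW_commute fun j h1 h2 => (shufW_commute fun i h3 h4 =>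
    S.commute_gg (by omega) (by omega) (by omega) (by omega) (by omega)).symm

/-- `shufW` shifts up past an ascending product. -/
theorem ascW_mul_shufW {a p t s r : ℕ} (hs1 : 1 ≤ s) (hs : s ≤ a + 1) (h : a + p + t < r)
    (hr : r ≤ n) :
    ascW g s r * shufW q g a p t = shufW q g (a + 1) p t * ascW g s r :=
  shufW_intertwine fun j h1 h2 => S.g_ascW hs1 (by omega) (by omega) hr

/-- `shufW` shifts up past a descending product. -/
theorem shufW_mul_descW {a p t s r : ℕ} (hs1 : 1 ≤ s) (hs : s ≤ a + 1) (h : a + p + t < r)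
    (hr : r ≤ n) :
    shufW q g a p t * descW g r s = descW g r s * shufW q g (a + 1) p t :=
  shufW_intertwine' fun j h1 h2 => S.g_descW hs1 (by omega) (by omega) hr

theorem shufW_first {a p t : ℕ} (hn : a + p + t + 2 ≤ n) :
    shufW q g a (p + 1) (t + 1) = shufW q g (a + 1) p (t + 1) +
      ((q : R) ^ (p + 1)) • (descW g (a + p + 2) (a + 1) * shufW q g (a + 1) (p + 1) t) := by
  obtain ⟨m, hm⟩ : ∃ m, p + t = m := ⟨_, rfl⟩
  induction m using Nat.strong_induction_on generalizing p t with
  | _ m ih =>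
  have hd : descW g (a + p + 2) (a + 1) = g (a + p + 1) * descW g (a + p + 1) (a + 1) :=
    descW_succ g (by omega)
  rcases p with _ | p <;> rcases t with _ | t
  · rw [hd]; simp [shufW_one_right]
  · rw [shufW_one_left, ih t (by omega) (by omega) (by omega), shufW_one_left, hd,
      ascW_head g (show a + 1 < a + (t + 1) + 2 by omega)]
    simp only [mul_add, smul_add, mul_smul_comm, smul_smul, shufW_zero_left, descW_self, mul_one,
      Nat.add_zero, zero_add]
    rw [show a + 1 + t + 2 = a + (t + 1) + 2 by omega]
    module
  · rw [shufW_one_right, ih p (by omega) (by omega) (by omega), shufW_one_right, hd,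
      show a + 1 + p + 1 = a + (p + 1) + 1 by omega, show a + p + 2 = a + (p + 1) + 1 by omega]
    simp only [mul_add, smul_add, mul_smul_comm, smul_smul, shufW_zero_right, mul_one]
    module
  · rw [shufW_succ, ih (p + 1 + t) (by omega) (by omega) rfl,
      ih (p + (t + 1)) (by omega) (by omega) rfl, shufW_succ (a + 1) p (t + 1),
      shufW_succ (a + 1) (p + 1) t, hd,
      ascW_head g (show a + (p + 1) + 1 < a + (p + 1) + (t + 1) + 2 by omega)]
    have c : Commute (ascW g (a + (p + 1) + 1 + 1) (a + (p + 1) + (t + 1) + 2))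
        (descW g (a + (p + 1) + 1) (a + 1)) :=
      descW_commute fun j h1 h2 => (ascW_commute fun i h3 h4 =>
        S.commute_gg (by omega) (by omega) (by omega) (by omega) (by omega)).symm
    have c' : ∀ x, ascW g (a + (p + 1) + 1 + 1) (a + (p + 1) + (t + 1) + 2) *
        (descW g (a + (p + 1) + 1) (a + 1) * x) = descW g (a + (p + 1) + 1) (a + 1) *
        (ascW g (a + (p + 1) + 1 + 1) (a + (p + 1) + (t + 1) + 2) * x) := fun x => by
      rw [← mul_assoc, c.eq, mul_assoc]
    rw [show a + 1 + (p + 1) + 1 = a + (p + 1) + 1 + 1 by omega,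
      show a + 1 + (p + 1) + t + 2 = a + (p + 1) + (t + 1) + 2 by omega,
      show a + 1 + p + 1 = a + (p + 1) + 1 by omega,
      show a + 1 + p + (t + 1) + 2 = a + (p + 1) + (t + 1) + 2 by omega,
      show a + p + 2 = a + (p + 1) + 1 by omega,
      ascW_head g (show a + (p + 1) + 1 < a + (p + 1) + (t + 1) + 2 by omega)]
    simp only [mul_add, smul_add, mul_smul_comm, smul_smul, mul_assoc, c']
    module

theorem shufW_coassoc {a p s t : ℕ} (hn : a + p + s + t ≤ n) :
    shufW q g a p s * shufW q g a (p + s) t =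
      shufW q g (a + p) s t * shufW q g a p (s + t) := by
  obtain ⟨m, hm⟩ : ∃ m, p + s + t = m := ⟨_, rfl⟩
  induction m using Nat.strong_induction_on generalizing p s t with
  | _ m ih =>
  rcases p with _ | p
  · simp
  rcases s with _ | s
  · simp
  rcases t with _ | t
  · simp
  have ih1 := ih (p + 1 + (s + 1) + t) (by omega) (by omega) rfl
  have ih2 := ih (p + 1 + s + (t + 1)) (by omega) (by omega) rfl
  have ih3 := ih (p + (s + 1) + (t + 1)) (by omega) (by omega) rfl
  have e1 : shufW q g a (p + 1 + (s + 1)) (t + 1) = shufW q g a (p + 1 + (s + 1)) t +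
      ((q : R) ^ (t + 1)) • (ascW g (a + p + s + 2) (a + p + s + t + 3) *
        shufW q g a (p + 1 + s) (t + 1)) := by
    rw [show p + 1 + (s + 1) = (p + 1 + s) + 1 by omega, shufW_succ,
      show a + (p + 1 + s) + 1 = a + p + s + 2 by omega,
      show a + (p + 1 + s) + t + 2 = a + p + s + t + 3 by omega]
  have e2 : shufW q g a (p + 1) (s + 1) = shufW q g a (p + 1) s + ((q : R) ^ (s + 1)) •
      (ascW g (a + p + 1) (a + p + s + 2) * shufW q g a p (s + 1)) := shufW_succ _ _ _
  have e3 : shufW q g a (p + 1) (s + 1 + (t + 1)) = shufW q g a (p + 1) (s + 1 + t) +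
      ((q : R) ^ (s + 1 + (t + 1))) • (ascW g (a + p + 1) (a + p + s + t + 3) *
        shufW q g a p (s + 1 + (t + 1))) := by
    rw [show s + 1 + (t + 1) = (s + 1 + t) + 1 by omega, shufW_succ,
      show a + p + (s + 1 + t) + 2 = a + p + s + t + 3 by omega]
  have e4 : shufW q g (a + (p + 1)) (s + 1) (t + 1) = shufW q g (a + (p + 1)) (s + 1) t +
      ((q : R) ^ (t + 1)) • (ascW g (a + p + s + 2) (a + p + s + t + 3) *
        shufW q g (a + (p + 1)) s (t + 1)) := by
    rw [shufW_succ, show a + (p + 1) + s + 1 = a + p + s + 2 by omega,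
      show a + (p + 1) + s + t + 2 = a + p + s + t + 3 by omega]
  have hH : shufW q g (a + (p + 1)) (s + 1) (t + 1) * ascW g (a + p + 1) (a + p + s + t + 3) =
      ascW g (a + p + 1) (a + p + s + t + 3) * shufW q g (a + p) (s + 1) (t + 1) :=
    (S.ascW_mul_shufW (a := a + p) (by omega) (by omega) (by omega) (by omega)).symm
  have c1 := (S.shufW_commute_ascW (a := a) (p := p + 1) (t := s) (s := a + p + s + 2)
    (r := a + p + s + t + 3) (by omega) (by omega)).eq
  have c2 := (S.shufW_commute_ascW (a := a) (p := p) (t := s + 1) (s := a + p + s + 2)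
    (r := a + p + s + t + 3) (by omega) (by omega)).eq
  have hs : ascW g (a + p + 1) (a + p + s + 2) * ascW g (a + p + s + 2) (a + p + s + t + 3) =
      ascW g (a + p + 1) (a + p + s + t + 3) := (ascW_split g (by omega) (by omega)).symm
  rw [e1, mul_add, ih1, mul_smul_comm, e2, add_mul, smul_mul_assoc, ← mul_assoc, c1,
    mul_assoc (ascW g _ _), ih2, mul_assoc (ascW g _ _), ← mul_assoc (shufW q g a p (s + 1)),
    c2, mul_assoc (ascW g _ _), show p + 1 + s = p + (s + 1) by omega, ih3,
    ← mul_assoc (ascW g (a + p + 1) _), hs, e3, mul_add, mul_smul_comm, ← mul_assoc _ (ascW g _ _),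
    hH, e4, add_mul, smul_mul_assoc, show s + (t + 1) = s + 1 + t by omega, pow_add]
  simp only [mul_assoc, smul_add, smul_smul]
  rw [show s + 1 + (t + 1) = s + 1 + t + 1 by omega]
  module

end BMWSys

/-! ### Soft vectors -/

/-- `N` is stable under right multiplication by the level-`k` subalgebra. -/
def RStable (g e : ℕ → W) (k : ℕ) (N : Submodule R W) : Prop :=
  ∀ x ∈ N, ∀ a ∈ lvl R g e k, x * a ∈ N

theorem RStable.mono {k k' : ℕ} {N : Submodule R W} (h : RStable g e k' N) (hk : k ≤ k') :
    RStable g e k N := fun x hx a ha => h x hx a (lvl_mono hk ha)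

theorem sym_ascW {N : Submodule R W} {k : ℕ} (hN : RStable g e k N) {v : W} {s t : ℕ}
    (hs : 1 ≤ s) (hst : s ≤ t) (ht : t ≤ k)
    (h : ∀ j, s ≤ j → j < t → v * (g j - algebraMap R W q) ∈ N) :
    v * ascW g s t - ((q : R) ^ (t - s)) • v ∈ N := by
  induction t, hst using Nat.le_induction with
  | base => simp
  | succ t hst ih =>
    have h1 := N.add_mem (hN _ (ih (by omega) fun j h1 h2 => h j h1 (by omega)) (g t)
      (g_mem_lvl (by omega) (by omega))) (N.smul_mem ((q : R) ^ (t - s)) (h t hst (by omega)))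
    convert h1 using 1
    rw [ascW_succ g hst, Nat.succ_sub hst, pow_succ, sub_mul, mul_sub, ← Algebra.commutes,
      ← Algebra.smul_def, smul_sub, smul_mul_assoc, smul_smul, mul_assoc]
    abel

/-- The Gaussian-type weight by which `shufW` acts on a symmetric vector. -/
def gaussW (x : R) : ℕ → ℕ → R
  | 0, _ => 1
  | _ + 1, 0 => 1
  | p + 1, t + 1 => gaussW x (p + 1) t + x ^ (t + 1) * gaussW x p (t + 1)
termination_by p t => p + t

@[simp] theorem gaussW_zero_left (x : R) (t : ℕ) : gaussW x 0 t = 1 := by rw [gaussW]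

@[simp] theorem gaussW_zero_right (x : R) (p : ℕ) : gaussW x p 0 = 1 := by cases p <;> rw [gaussW]

theorem gaussW_succ (x : R) (p t : ℕ) :
    gaussW x (p + 1) (t + 1) = gaussW x (p + 1) t + x ^ (t + 1) * gaussW x p (t + 1) := by
  rw [gaussW]

theorem gaussW_alternating_partial (x : R) (m u : ℕ) (hu : u ≤ m) :
    ∑ i ∈ Finset.range (u + 1), (-1) ^ i * x ^ (i.choose 2) * gaussW x (m + 1 - i) i =
      (-1) ^ u * x ^ (u.choose 2 + u) * gaussW x (m - u) u := by
  induction u with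
  | zero => simp
  | succ u ih =>
    rw [Finset.sum_range_succ, ih (by omega)]
    obtain ⟨d, rfl⟩ : ∃ d, m = u + 1 + d := ⟨m - (u + 1), by omega⟩
    rw [show u + 1 + d + 1 - (u + 1) = d + 1 by omega, show u + 1 + d - u = d + 1 by omega,
      show u + 1 + d - (u + 1) = d by omega, gaussW_succ,
      show (u + 1).choose 2 = u.choose 2 + u by
        rw [Nat.choose_succ_succ' u 1, Nat.choose_one_right, Nat.add_comm]]
    ring

theorem gaussW_alternating (x : R) (m : ℕ) :
    ∑ i ∈ Finset.range (m + 2), (-1) ^ i * x ^ (i.choose 2) * gaussW x (m + 1 - i) i = 0 := by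
  rw [Finset.sum_range_succ, gaussW_alternating_partial x m m le_rfl]
  rw [show (m + 1).choose 2 = m.choose 2 + m by
        rw [Nat.choose_succ_succ' m 1, Nat.choose_one_right, Nat.add_comm]]
  simp
  ring

theorem sym_shufW {N : Submodule R W} {k : ℕ} (hN : RStable g e k N) {v : W} {a p t : ℕ}
    (hk : a + p + t ≤ k) (h : ∀ j, a < j → j < a + p + t → v * (g j - algebraMap R W q) ∈ N) :
    v * shufW q g a p t - gaussW ((q : R) ^ 2) p t • v ∈ N := by
  induction p, t using shufW.induct with
  | case1 => simp
  | case2 => simp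
  | case3 p t ih1 ih2 =>
    have h1 := ih1 (by omega) fun j h1 h2 => h j h1 (by omega)
    have h2 := ih2 (by omega) fun j h1 h2 => h j h1 (by omega)
    have h3 := hN _ (sym_ascW hN (v := v) (s := a + p + 1) (t := a + p + t + 2) (by omega)
      (by omega) (by omega) fun j h1 h2 => h j (by omega) (by omega)) (shufW q g a p (t + 1))
      (shufW_mem (by omega))
    have h4 := N.add_mem (N.add_mem h1 (N.smul_mem ((q : R) ^ (t + 1)) h3))
      (N.smul_mem ((q : R) ^ (2 * (t + 1))) h2)
    convert h4 using 1
    rw [shufW_succ, gaussW_succ, show a + p + t + 2 - (a + p + 1) = t + 1 by omega]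
    simp only [mul_add, add_smul, mul_smul_comm, sub_mul, smul_sub, smul_mul_assoc, smul_smul,
      mul_assoc, ← pow_mul, ← pow_add, two_mul]
    module

namespace BMWSys
variable (S : BMWSys z q δ n g gi e)
include S

theorem vanish_aux {N : Submodule R W} {k : ℕ} (hN : RStable g e k N) (hk : k ≤ n)
    (p' j m a : ℕ) (hpm : p' < m) (hak : a + p' + j + m ≤ k) (v : W)
    (h1 : ∀ i, a < i → i < a + p' + j → v * (g i - algebraMap R W q) ∈ N)
    (h2 : ∀ i, a + p' + j < i → i < a + p' + j + m → v * (g i - algebraMap R W q) ∈ N) :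
    ∑ u ∈ Finset.range (m + 1), ((-1) ^ u * ((q : R) ^ 2) ^ (u.choose 2)) •
      (v * shufW q g a (p' + j) (m - u) * shufW q g (a + p') (j + (m - u)) u) ∈ N := by
  induction p' generalizing j m a v with
  | zero =>
    obtain ⟨m, rfl⟩ : ∃ m', m = m' + 1 := ⟨m - 1, by omega⟩
    have h3 : ∀ u ∈ Finset.range (m + 1 + 1), ((-1) ^ u * ((q : R) ^ 2) ^ (u.choose 2)) •
        (v * shufW q g a (0 + j) (m + 1 - u) * shufW q g (a + 0) (j + (m + 1 - u)) u) -
        ((-1) ^ u * ((q : R) ^ 2) ^ (u.choose 2) * gaussW ((q : R) ^ 2) (m + 1 - u) u) •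
          (v * shufW q g a j (m + 1)) ∈ N := by
      intro u hu
      rw [Finset.mem_range] at hu
      have h4 := hN _ (sym_shufW hN (v := v) (a := a + j) (p := m + 1 - u) (t := u) (by omega)
        fun i h3 h4 => h2 i (by omega) (by omega)) (shufW q g a j (m + 1)) (shufW_mem (by omega))
      have h5 := S.shufW_coassoc (a := a) (p := j) (s := m + 1 - u) (t := u) (by omega)
      rw [show m + 1 - u + u = m + 1 by omega] at h5
      rw [zero_add, add_zero, mul_assoc, h5, mul_smul (_ * _), ← smul_sub, ← mul_assoc]
      refine N.smul_mem _ ?_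
      rwa [sub_mul, smul_mul_assoc] at h4
    have h6 := N.sum_mem h3
    rwa [Finset.sum_sub_distrib, ← Finset.sum_smul, gaussW_alternating, zero_smul, sub_zero] at h6
  | succ p' ih =>
    obtain ⟨m, rfl⟩ : ∃ m', m = m' + 1 := ⟨m - 1, by omega⟩
    have f1 := ih j (m + 1) (a + 1) (by omega) (by omega) v
      (fun i h3 h4 => h1 i (by omega) (by omega)) (fun i h3 h4 => h2 i (by omega) (by omega))
    have f2 := ih (j + 1) m (a + 1) (by omega) (by omega)
      (v * descW g (a + (p' + j) + 2) (a + 1)) (fun i h3 h4 => by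
        obtain ⟨i, rfl⟩ : ∃ i', i = i' + 1 := ⟨i - 1, by omega⟩
        have := hN _ (h1 i (by omega) (by omega)) (descW g (a + (p' + j) + 2) (a + 1))
          (descW_mem_lvl (by omega) (by omega))
        rwa [mul_assoc, sub_mul, S.g_descW (by omega) (by omega) (by omega) (by omega),
          Algebra.commutes, ← mul_sub, ← mul_assoc] at this)
      (fun i h3 h4 => by
        have := hN _ (h2 i (by omega) (by omega)) (descW g (a + (p' + j) + 2) (a + 1))
          (descW_mem_lvl (by omega) (by omega))
        have c : Commute (g i) (descW g (a + (p' + j) + 2) (a + 1)) := descW_commute fun s h5 h6 =>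
          S.commute_gg (by omega) (by omega) (by omega) (by omega) (by omega)
        rwa [mul_assoc, sub_mul, c.eq, Algebra.commutes, ← mul_sub, ← mul_assoc] at this)
    have f3 := N.add_mem f1 (N.smul_mem ((q : R) ^ (p' + j + 1)) f2)
    convert f3 using 1
    rw [Finset.sum_range_succ, Finset.sum_range_succ _ (m + 1),
      add_right_comm (Finset.sum _ _), Finset.smul_sum,
      ← Finset.sum_add_distrib]
    congr 1
    · refine Finset.sum_congr rfl fun u hu => ?_
      rw [Finset.mem_range] at hu
      rw [show m + 1 - u = m - u + 1 by omega, show p' + 1 + j = p' + j + 1 by omega,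
        S.shufW_first (by omega), show a + 1 + p' = a + (p' + 1) by omega,
        show j + 1 + (m - u) = j + (m - u + 1) by omega,
        show p' + (j + 1) = p' + j + 1 by omega]
      simp only [mul_add, add_mul, smul_add, mul_smul_comm, smul_mul_assoc, mul_assoc, smul_smul]
      congr 2
      ring
    · simp [show a + 1 + p' = a + (p' + 1) by omega]

theorem vanish {N : Submodule R W} {k : ℕ} (hN : RStable g e k N) (hk : k ≤ n)
    {a p r : ℕ} (hpr : p < r) (hak : a + p + r ≤ k) {v : W}
    (h1 : ∀ i, a < i → i < a + p → v * (g i - algebraMap R W q) ∈ N)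
    (h2 : ∀ i, a + p < i → i < a + p + r → v * (g i - algebraMap R W q) ∈ N)
    (h3 : ∀ t, 1 ≤ t → t ≤ r → v * shufW q g a p t ∈ N) : v ∈ N := by
  have h := S.vanish_aux hN hk p 0 r a hpr hak v h1 h2
  rw [Finset.sum_range_succ] at h
  have h' : ∑ u ∈ Finset.range r, ((-1) ^ u * ((q : R) ^ 2) ^ (u.choose 2)) •
      (v * shufW q g a (p + 0) (r - u) * shufW q g (a + p) (0 + (r - u)) u) ∈ N := by
    refine N.sum_mem fun u hu => N.smul_mem _ (hN _ ?_ _ (shufW_mem ?_))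
    · rw [Finset.mem_range] at hu
      exact h3 _ (by omega) (by omega)
    · rw [Finset.mem_range] at hu; omega
  have h'' := (N.add_mem_iff_right h').1 h
  simp only [Nat.sub_self, add_zero, shufW_zero_left, shufW_zero_right, mul_one] at h''
  have hu : IsUnit ((-1 : R) ^ r * ((q : R) ^ 2) ^ (r.choose 2)) :=
    (isUnit_one.neg.pow r).mul ((q.isUnit.pow 2).pow _)
  exact (N.smul_mem_iff_of_isUnit hu).1 h''

end BMWSys
end Shuffle

section Soft
variable {R W : Type*} [CommRing R] [Ring W] [Algebra R W]
variable {z q : Rˣ} {δ : R} {n : ℕ} {g gi e : ℕ → W}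

/-- Partial sums of a composition. -/
def off (κ : ℕ → ℕ) (i : ℕ) : ℕ := ∑ j ∈ Finset.range i, κ j

@[simp] theorem off_zero (κ : ℕ → ℕ) : off κ 0 = 0 := rfl

theorem off_succ (κ : ℕ → ℕ) (i : ℕ) : off κ (i + 1) = off κ i + κ i := Finset.sum_range_succ _ _

theorem off_mono (κ : ℕ → ℕ) {i j : ℕ} (h : i ≤ j) : off κ i ≤ off κ j :=
  Finset.sum_le_sum_of_subset (Finset.range_mono h)

theorem off_succ_le (κ : ℕ → ℕ) {i j : ℕ} (h : i < j) : off κ i + κ i ≤ off κ j :=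
  (off_succ κ i).symm.trans_le (off_mono κ h)

theorem off_update_of_le (κ : ℕ → ℕ) {i j c : ℕ} (h : i ≤ j) :
    off (Function.update κ j c) i = off κ i := by
  refine Finset.sum_congr rfl fun s hs => Function.update_of_ne ?_ _ _
  rw [Finset.mem_range] at hs
  omega

theorem off_update_of_lt (κ : ℕ → ℕ) {i j c : ℕ} (h : j < i) :
    off (Function.update κ j c) i + κ j = off κ i + c := by
  induction i, h using Nat.le_induction with
  | base => rw [off_succ, off_succ, off_update_of_le κ le_rfl, Function.update_self]; omega
  | succ i h ih => rw [off_succ, off_succ, Function.update_of_ne (by omega)]; omega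

theorem exists_row {κ : ℕ → ℕ} {m s : ℕ} (h1 : 1 ≤ s) (h : s ≤ off κ m) :
    ∃ i, off κ i < s ∧ s ≤ off κ i + κ i := by
  induction m with
  | zero => rw [off_zero] at h; omega
  | succ m ih =>
    rcases Nat.lt_or_ge (off κ m) s with h2 | h2
    · exact ⟨m, h2, by rwa [off_succ] at h⟩
    · exact ih h2

/-- The right `lvl k`-submodule generated by `N` and the vectors `V i`, `i ∈ I`. -/
def filt (g e : ℕ → W) (k : ℕ) (N : Submodule R W) (V : ℕ → W) (I : Set ℕ) : Submodule R W :=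
  N ⊔ ⨆ i ∈ I, (lvl R g e k).toSubmodule.map (LinearMap.mulLeft R (V i))

theorem le_filt {k : ℕ} {N : Submodule R W} {V : ℕ → W} {I : Set ℕ} : N ≤ filt g e k N V I :=
  le_sup_left

theorem mem_filt {k : ℕ} {N : Submodule R W} {V : ℕ → W} {I : Set ℕ} {i : ℕ} (hi : i ∈ I) {a : W}
    (ha : a ∈ lvl R g e k) : V i * a ∈ filt g e k N V I := by
  refine Submodule.mem_sup_right (Submodule.mem_iSup_of_mem i (Submodule.mem_iSup_of_mem hi ?_))
  exact ⟨a, ha, rfl⟩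

theorem mem_filt_self {k : ℕ} {N : Submodule R W} {V : ℕ → W} {I : Set ℕ} {i : ℕ} (hi : i ∈ I) :
    V i ∈ filt g e k N V I := by
  have := mem_filt (k := k) (N := N) (V := V) hi (one_mem (lvl R g e k))
  rwa [mul_one] at this

theorem filt_le {k : ℕ} {N P : Submodule R W} {V : ℕ → W} {I : Set ℕ} (hN : N ≤ P)
    (h : ∀ i ∈ I, ∀ a ∈ lvl R g e k, V i * a ∈ P) : filt g e k N V I ≤ P := by
  refine sup_le hN (iSup₂_le fun i hi => ?_)
  rintro _ ⟨a, ha, rfl⟩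
  exact h i hi a ha

theorem rstable_iff_le {k : ℕ} {N : Submodule R W} :
    RStable g e k N ↔ ∀ a ∈ lvl R g e k, N ≤ N.comap (LinearMap.mulRight R a) :=
  ⟨fun h a ha _ hx => h _ hx a ha, fun h _ hx a ha => h a ha hx⟩

theorem RStable.filt {k : ℕ} {N : Submodule R W} (hN : RStable g e k N) (V : ℕ → W) (I : Set ℕ) :
    RStable g e k (filt g e k N V I) := by
  rw [rstable_iff_le]
  refine fun a ha => filt_le (fun _ hx => le_filt (hN _ hx a ha)) fun i hi b hb => ?_
  change V i * b * a ∈ _root_.filt g e k N V I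
  rw [mul_assoc]
  exact mem_filt hi (mul_mem hb ha)

/-- The conditions on `v`, modulo `N`, that suffice to straighten `v * lvl k`: the vector behaves
like a cyclic generator of the cell module labelled by `(κ, l)`. -/
structure Soft (q : Rˣ) (g e : ℕ → W) (N : Submodule R W) (κ : ℕ → ℕ) (K k l : ℕ) (v : W) :
    Prop where
  size : K + 2 * l = k
  tot : ∀ i, off κ i ≤ K
  stair : ∃ w, v = w * stairW e k l
  sym : ∀ i j, off κ i < j → j < off κ i + κ i → v * (g j - algebraMap R W q) ∈ N
  kill : 2 ≤ K → ∀ x ∈ lvl R g e K, v * x * e (K - 1) ∈ N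
  garnir : ∀ i t, 1 ≤ t → t ≤ κ (i + 1) → v * shufW q g (off κ i) (κ i) t ∈ N

/-- The restriction vectors of `v`. -/
def vRes (g e : ℕ → W) (κ : ℕ → ℕ) (K k l : ℕ) (v : W) (i : ℕ) : W :=
  v * ascW g (off κ i + κ i) K * stairW e k l

/-- The induction vectors of `v`. -/
def vInd (q : Rˣ) (g e : ℕ → W) (κ : ℕ → ℕ) (K k l : ℕ) (v : W) (i : ℕ) : W :=
  v * descW g (K + 1) (off κ i + κ i + 1) * shufW q g (off κ i) (κ i) 1 * stairW e k l

theorem sym_transfer {N : Submodule R W} {k : ℕ} (hN : RStable g e k N) {v X : W} {s t : ℕ}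
    (hX : X ∈ lvl R g e k) (hXg : X * g s = g t * X) (h : v * (g t - algebraMap R W q) ∈ N) :
    v * X * (g s - algebraMap R W q) ∈ N := by
  have := hN _ h X hX
  rwa [mul_assoc, sub_mul, ← hXg, Algebra.commutes, ← mul_sub, ← mul_assoc] at this

namespace BMWSys
variable (S : BMWSys z q δ n g gi e)
include S

theorem commute_stairW_lvl {i l k : ℕ} (hl : 2 * l ≤ i) (hi : i ≤ n) (hk : k ≤ i - 2 * l) {x : W}
    (hx : x ∈ lvl R g e k) : Commute (stairW e i l) x :=
  commute_lvl (fun j h1 h2 => (stairW_commute (fun s h3 h4 =>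
      S.commute_ge (by omega) (by omega) (by omega) (by omega) (by omega)) hl).symm)
    (fun j h1 h2 => (stairW_commute (fun s h3 h4 =>
      S.commute_ee (by omega) (by omega) (by omega) (by omega) (by omega)) hl).symm) hx

theorem Soft.vanish {N : Submodule R W} {κ : ℕ → ℕ} {K k l : ℕ} {v : W}
    (h : Soft q g e N κ K k l v) (hN : RStable g e k N) (hk : k ≤ n) {i : ℕ}
    (hi : κ i < κ (i + 1)) : v ∈ N := by
  have hs := h.size
  have h1 := h.tot (i + 2)
  rw [off_succ, off_succ] at h1
  have h2 := h.sym (i + 1)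
  rw [off_succ] at h2
  exact S.vanish hN hk hi (by omega) (h.sym i) h2 (h.garnir i)

variable {N : Submodule R W} {κ : ℕ → ℕ} {K k l : ℕ} {v : W}

theorem lvl_decomp' {k : ℕ} (hk1 : 1 ≤ k) (hk : k ≤ n) {P : Submodule R W}
    (hP : 2 ≤ k → eIdeal R g e k ≤ P)
    (hA : ∀ a, 1 ≤ a → a ≤ k → ∀ y ∈ lvl R g e (k - 1), ascW g a k * y ∈ P) :
    ∀ x ∈ lvl R g e k, x ∈ P := by
  rcases Nat.lt_or_ge 1 k with h | h
  · exact S.lvl_decomp hk1 hk (hP h) hA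
  · obtain rfl : k = 1 := by omega
    refine lvl_le_of_left ?_ (fun j h1 h2 => by omega) (fun j h1 h2 => by omega)
    simpa using hA 1 le_rfl le_rfl 1 (one_mem _)

/-- Everything in `v * lvl K * e^{(l)}` is reached by the restriction vectors. -/
theorem Soft.res_span (h : Soft q g e N κ K (k + 1) l v) (hN : RStable g e (k + 1) N)
    (hk : k + 1 ≤ n) (hK : 1 ≤ K) {m : ℕ} (hm : off κ m = K) {x : W} (hx : x ∈ lvl R g e K)
    (hl : 2 * l ≤ k) :
    v * x * stairW e k l ∈ filt g e k N (vRes g e κ K k l v) {i | 1 ≤ κ i} := by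
  have hs := h.size
  have key : ∀ x ∈ lvl R g e K, x ∈ (filt g e k N (vRes g e κ K k l v) {i | 1 ≤ κ i}).comap
      ((LinearMap.mulRight R (stairW e k l)).comp (LinearMap.mulLeft R v)) := by
    have hF : stairW e k l ∈ lvl R g e (k + 1) := stairW_mem_lvl hl (by omega)
    refine S.lvl_decomp' hK (by omega) (fun h2 => ?_) ?_
    · refine Submodule.span_le.2 ?_
      rintro _ ⟨x, hx, y, hy, rfl⟩
      refine le_filt ?_
      change v * (x * e (K - 1) * y) * stairW e k l ∈ N
      rw [← mul_assoc, ← mul_assoc, mul_assoc _ y]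
      exact hN _ (h.kill h2 x hx) _ (mul_mem (lvl_mono (by omega) hy) hF)
    · intro s hs1 hs2 y hy
      obtain ⟨i, hi1, hi2⟩ := exists_row hs1 (hs2.trans hm.ge)
      have hiK := h.tot (i + 1)
      rw [off_succ] at hiK
      change v * (ascW g s K * y) * stairW e k l ∈
        filt g e k N (vRes g e κ K k l v) {i | 1 ≤ κ i}
      rw [mul_assoc, mul_assoc (ascW g s K),
        ← (S.commute_stairW_lvl hl (by omega) (by omega) hy).eq,
        ascW_split g hi2 hiK]
      have h3 := sym_ascW hN (v := v) hs1 hi2 (by omega) fun j h1 h2 => h.sym i j (by omega) h2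
      have h4 := hN _ h3 (ascW g (off κ i + κ i) K * (stairW e k l * y))
        (mul_mem (ascW_mem_lvl (by omega) (by omega)) (mul_mem hF (lvl_mono (by omega) hy)))
      have h5 : vRes g e κ K k l v i * y ∈ filt g e k N (vRes g e κ K k l v) {i | 1 ≤ κ i} :=
        mem_filt (show i ∈ {i | 1 ≤ κ i} by change 1 ≤ κ i; omega) (lvl_mono (by omega) hy)
      have h6 := Submodule.add_mem _ (le_filt h4) (Submodule.smul_mem _ (((q : R) ^
        (off κ i + κ i - s))) h5)
      convert h6 using 1
      rw [vRes]
      simp only [sub_mul, smul_mul_assoc, mul_assoc]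
      abel
  exact key x hx

/-- The restriction vector of row `j` is soft modulo those of the lower rows. -/
theorem Soft.res (h : Soft q g e N κ K (k + 1) l v) (hN : RStable g e (k + 1) N)
    (hk : k + 1 ≤ n) (hl : 2 * l ≤ k) {j : ℕ} (hj : 1 ≤ κ j) :
    Soft q g e (filt g e k N (vRes g e κ K k l v) {i | j < i ∧ 1 ≤ κ i})
      (Function.update κ j (κ j - 1)) (K - 1) k l (vRes g e κ K k l v j) := by
  have hs := h.size
  have hjK := h.tot (j + 1)
  rw [off_succ] at hjK
  set a := off κ j + κ j with ha
  set F := stairW e k l with hF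
  have hFm : F ∈ lvl R g e k := stairW_mem_lvl hl le_rfl
  have hX : ascW g a K ∈ lvl R g e (k + 1) := ascW_mem_lvl (by omega) (by omega)
  have hFc : ∀ x ∈ lvl R g e (K - 1), F * x = x * F := fun x hx =>
    (S.commute_stairW_lvl hl (by omega) (by omega) hx).eq
  have hXF : ascW g a K * F ∈ lvl R g e (k + 1) := mul_mem hX (lvl_mono (by omega) hFm)
  have low : ∀ s, s + 1 < a → 1 ≤ s → ascW g a K * g s = g s * ascW g a K := fun s h1 h2 =>
    (ascW_commute fun i h3 h4 =>
      S.commute_gg (by omega) (by omega) (by omega) (by omega) (by omega)).symm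
  have hV : vRes g e κ K k l v j = v * (ascW g a K * F) := mul_assoc _ _ _
  rw [hV]
  refine ⟨by omega, fun i => ?_, ⟨v * ascW g a K, (mul_assoc _ _ _).symm⟩, fun i s h1 h2 => ?_,
    fun h2 x hx => ?_, fun i t ht1 ht2 => ?_⟩
  · rcases Nat.lt_or_ge j i with h1 | h1
    · have := off_update_of_lt κ (c := κ j - 1) h1
      have := h.tot i
      omega
    · rw [off_update_of_le κ h1]
      have := off_mono κ h1
      omega
  · apply le_filt
    rcases Nat.lt_or_ge j i with hij | hij
    · have e1 := off_update_of_lt κ (c := κ j - 1) hij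
      have e2 := off_succ_le κ hij
      have e3 := h.tot (i + 1)
      rw [off_succ] at e3
      rw [Function.update_of_ne (by omega)] at h2
      refine sym_transfer hN hXF ?_ (h.sym i (s + 1) (by omega) (by omega))
      rw [mul_assoc, hFc _ (g_mem_lvl (by omega) (by omega)), ← mul_assoc,
        S.g_ascW (by omega) (by omega) (by omega) (by omega), mul_assoc]
    · rw [off_update_of_le κ hij] at h1 h2
      have e1 : s < off κ i + κ i ∧ s + 1 < a := by
        rcases hij.eq_or_lt with rfl | hij
        · rw [Function.update_self] at h2; omega
        · have := off_succ_le κ hij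
          rw [Function.update_of_ne (by omega)] at h2
          omega
      refine sym_transfer hN hXF ?_ (h.sym i s (by omega) (by omega))
      rw [mul_assoc, hFc _ (g_mem_lvl (by omega) (by omega)), ← mul_assoc,
        low _ (by omega) (by omega), mul_assoc]
  · apply le_filt
    have e1 : e (K - 1 - 1) = e (K - 1 - 1) * e (K - 1) * e (K - 1 - 1) := by
      obtain ⟨K, rfl⟩ : ∃ K', K = K' + 3 := ⟨K - 3, by omega⟩
      exact (S.eee (K + 1) (by omega) (by omega)).symm
    have hm : e (K - 1 - 1) ∈ lvl R g e (K - 1) := e_mem_lvl (by omega) (by omega)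
    have h3 := hN _ (h.kill (by omega) (ascW g a K * x * e (K - 1 - 1))
      (mul_mem (mul_mem (ascW_mem_lvl (by omega) le_rfl) (lvl_mono (by omega) hx))
        (lvl_mono (by omega) hm))) (e (K - 1 - 1) * F)
      (mul_mem (lvl_mono (by omega) hm) (lvl_mono (by omega) hFm))
    convert h3 using 1
    rw [mul_assoc, mul_assoc, mul_assoc (ascW g a K), ← mul_assoc F, hFc x hx, mul_assoc x,
      hFc _ hm]
    nth_rw 1 [e1]
    simp only [mul_assoc]
  · have hFB : ∀ o r s, o + r + s ≤ K - 1 → F * shufW q g o r s = shufW q g o r s * F :=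
      fun o r s h3 => hFc _ (shufW_mem h3)
    rcases Nat.lt_or_ge j i with hij | hij
    · have e1 := off_update_of_lt κ (c := κ j - 1) hij
      have e2 := off_succ_le κ hij
      have e3 := h.tot (i + 2)
      rw [off_succ, off_succ] at e3
      rw [Function.update_of_ne (by omega)] at ht2
      rw [Function.update_of_ne (by omega)]
      have h4 := hN _ (h.garnir i t ht1 ht2) _ hXF
      obtain ⟨o, ho⟩ : ∃ o, o = off (Function.update κ j (κ j - 1)) i := ⟨_, rfl⟩
      rw [← ho] at e1 ⊢
      obtain ho' : off κ i = o + 1 := by omega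
      apply le_filt
      rw [ho'] at h4
      convert h4 using 1
      rw [mul_assoc, mul_assoc (ascW g a K), hFB _ _ _ (by omega), ← mul_assoc (ascW g a K),
        S.ascW_mul_shufW (by omega) (by omega) (by omega) (by omega)]
      simp only [mul_assoc]
    · rw [off_update_of_le κ hij]
      rcases hij.lt_or_eq with hij | rfl
      · have e2 := off_succ_le κ hij
        rw [Function.update_of_ne (by omega)]
        have e3 : off κ i + κ i + t < a ∧ t ≤ κ (i + 1) := by
          rcases (show i + 1 ≤ j from hij).lt_or_eq with h1 | h1
          · have := off_succ_le κ h1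
            rw [off_succ] at this
            rw [Function.update_of_ne (by omega)] at ht2
            omega
          · rw [← h1, Function.update_self] at ht2
            rw [← h1, off_succ] at ha
            rw [← h1] at hj
            omega
        apply le_filt
        have h4 := hN _ (h.garnir i t ht1 e3.2) _ hXF
        convert h4 using 1
        rw [mul_assoc, mul_assoc (ascW g a K), hFB _ _ _ (by omega), ← mul_assoc (ascW g a K),
          ← (S.shufW_commute_ascW e3.1 (by omega)).eq]
        simp only [mul_assoc]
      · have e3 := h.tot (i + 2)
        rw [off_succ, off_succ] at e3
        rw [Function.update_of_ne (by omega)] at ht2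
        rw [Function.update_self]
        have hG := h.garnir i
        have hV1 := mem_filt_self (g := g) (e := e) (k := k) (N := N) (V := vRes g e κ K k l v)
          (I := {x | i < x ∧ 1 ≤ κ x}) (i := i + 1) ⟨by omega, by omega⟩
        have hsy := h.sym (i + 1)
        rw [vRes] at hV1
        rw [off_succ] at hV1 hsy
        obtain ⟨p, hp⟩ : ∃ p, κ i = p + 1 := ⟨κ i - 1, by omega⟩
        rw [hp] at hG ⊢
        obtain ⟨t, rfl⟩ : ∃ t', t = t' + 1 := ⟨t - 1, by omega⟩
        set o := off κ i
        rw [Nat.add_sub_cancel]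
        set Y := ascW g (a + (t + 1)) K * F with hY
        have hYm : Y ∈ lvl R g e (k + 1) :=
          mul_mem (ascW_mem_lvl (by omega) (by omega)) (lvl_mono (by omega) hFm)
        have h4 := hN _ (hG (t + 1) ht1 ht2) Y hYm
        have h5 : v * shufW q g o (p + 1) t * Y ∈
            filt g e k N (vRes g e κ K k l v) {x | i < x ∧ 1 ≤ κ x} := by
          rcases Nat.eq_zero_or_pos t with rfl | ht0
          · rw [shufW_zero_right, mul_one]
            have h6 := sym_ascW hN (v := v) (s := a + 1) (t := a + κ (i + 1)) (by omega)
              (by omega) (by omega) fun j h1 h2 => hsy j (by omega) (by omega)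
            have h7 := hN _ h6 (ascW g (a + κ (i + 1)) K * F)
              (mul_mem (ascW_mem_lvl (by omega) (by omega)) (lvl_mono (by omega) hFm))
            have h8 := add_mem (le_filt h7) (Submodule.smul_mem _
              ((q : R) ^ (a + κ (i + 1) - (a + 1))) hV1)
            convert h8 using 1
            rw [hY, ascW_split g (show a + 1 ≤ a + κ (i + 1) by omega) (by omega)]
            simp only [sub_mul, smul_mul_assoc, mul_assoc]
            abel
          · exact le_filt (hN _ (hG t ht0 (by omega)) Y hYm)
        have h6 : ((q : R) ^ (t + 1)) • (v * (ascW g a K * F) * shufW q g o p (t + 1)) ∈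
            filt g e k N (vRes g e κ K k l v) {x | i < x ∧ 1 ≤ κ x} := by
          have h9 := sub_mem (le_filt h4) h5
          convert h9 using 1
          rw [shufW_succ, mul_assoc v, mul_assoc (ascW g a K), hFB _ _ _ (by omega),
            ascW_split g (show a ≤ a + (t + 1) by omega) (by omega)]
          have := S.shufW_commute_ascW (q := q) (a := o) (p := p) (t := t + 1) (s := a + (t + 1))
            (r := K) (by omega) (by omega)
          rw [← mul_assoc (ascW g a (a + (t + 1)) * _), mul_assoc (ascW g a (a + (t + 1))),
            ← this.eq, hY, show o + p + 1 = a by omega, show o + p + t + 2 = a + (t + 1) by omega]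
          simp only [mul_add, add_mul, mul_smul_comm, smul_mul_assoc, mul_assoc]
          abel
        have h7 := Submodule.smul_mem _ ((((q ^ (t + 1))⁻¹ : Rˣ) : R)) h6
        rwa [smul_smul, ← Units.val_pow_eq_pow_val, Units.inv_mul, one_smul] at h7

end BMWSys
end Soft

section Induction
variable {R W : Type*} [CommRing R] [Ring W] [Algebra R W]
variable {z q : Rˣ} {δ : R} {n : ℕ} {g gi e : ℕ → W}

theorem shufW_one_split {o r t : ℕ} (ht : t ≤ r) :
    shufW q g o r 1 = shufW q g (o + t) (r - t) 1 + if t = 0 then 0 else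
      ((q : R) ^ (r + 1 - t)) • (descW g (o + r + 1) (o + t) * shufW q g o (t - 1) 1) := by
  rcases t with _ | t
  · simp
  rw [if_neg (Nat.succ_ne_zero t)]
  induction r, ht using Nat.le_induction with
  | base =>
    rw [shufW_one_right, Nat.sub_self, shufW_zero_left, descW_single]
    simp [add_assoc]
  | succ r hr ih =>
    rw [shufW_one_right, ih, descW_succ g (show o + (t + 1) ≤ o + (r + 1) by omega),
      show r + 1 - (t + 1) = (r - (t + 1)) + 1 by omega, shufW_one_right,
      show r + 1 + 1 - (t + 1) = (r - (t + 1)) + 1 + 1 by omega,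
      show o + (t + 1) + (r - (t + 1)) + 1 = o + r + 1 by omega, ← add_assoc o r 1]
    simp only [mul_add, mul_smul_comm, smul_add, smul_smul, ← pow_succ', mul_assoc, add_assoc]

namespace BMWSys
variable (S : BMWSys z q δ n g gi e)
include S

theorem g_sq' {i : ℕ} (hi : 1 ≤ i) (hin : i < n) :
    (q : R) • (g i * g i) = (q : R) • (1 : W) + ((q : R) ^ 2 - 1) • g i
      - (((q : R) ^ 2 - 1) * ((z⁻¹ : Rˣ) : R)) • e i := by
  rw [S.g_sq hi hin]
  have h : (q : R) * ((q⁻¹ : Rˣ) : R) = 1 := q.mul_inv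
  linear_combination (norm := module) h • (-(g i) + ((z⁻¹ : Rˣ) : R) • e i)

variable {M : Submodule R W} {K : ℕ}

/-- A row of length `p` stays symmetric after appending the induced strand. -/
theorem ind_sym_row (hM : RStable g e (K + 1) M) (hK : K + 1 ≤ n) {o p : ℕ} (hp : o + p ≤ K)
    {v : W} (hI : 1 ≤ K → ∀ x ∈ eIdeal R g e (K + 1), v * x ∈ M)
    (hs : ∀ s, o < s → s < o + p → v * (g s - algebraMap R W q) ∈ M) {s : ℕ} (h1 : o < s)
    (h2 : s < o + p + 1) : v * shufW q g o p 1 * (g s - algebraMap R W q) ∈ M := by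
  induction p generalizing v with
  | zero => omega
  | succ p ih =>
    have hIv' : 1 ≤ K → ∀ x ∈ eIdeal R g e (K + 1), v * g (o + p + 1) * x ∈ M := fun h x hx => by
      rw [mul_assoc]
      exact hI h _ (mul_mem_eIdeal_left (g_mem_lvl (by omega) (by omega)) hx)
    rw [shufW_one_right]
    rcases (show s < o + p + 1 ∨ s = o + p + 1 by omega) with h3 | rfl
    · have h4 := ih (by omega) hIv' (fun j hj1 hj2 => by
        have := hM _ (hs j hj1 (by omega)) (g (o + p + 1)) (g_mem_lvl (by omega) (by omega))
        rwa [mul_assoc, sub_mul, S.commute_gg (i := j) (j := o + p + 1) (by omega) (by omega)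
          (by omega) (by omega) (by omega), Algebra.commutes, ← mul_sub, ← mul_assoc] at this) h3
      have h5 := add_mem (hs s h1 (by omega)) (M.smul_mem (q : R) h4)
      convert h5 using 1
      simp only [mul_add, add_mul, mul_smul_comm, smul_mul_assoc, mul_one, mul_assoc]
    · have hq : ∀ i, 1 ≤ i → i ≤ K → v * (1 + (q : R) • g i) * (g i - algebraMap R W q) ∈ M := by
        intro i hi hiK
        have h5 := M.smul_mem (-(((q : R) ^ 2 - 1) * ((z⁻¹ : Rˣ) : R)))
          (hI (by omega) _ (S.e_mem_eIdeal (k := K + 1) hi (by omega) hK))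
        convert h5 using 1
        have h6 := congrArg (fun x => v * x) (S.g_sq' hi (by omega))
        simp only [mul_add, mul_sub, mul_smul_comm, mul_one] at h6
        simp only [Algebra.algebraMap_eq_smul_one, mul_add, mul_sub, add_mul, mul_smul_comm,
          mul_one, smul_mul_assoc, mul_assoc]
        linear_combination (norm := module) h6
      have h4 := hq (o + p + 1) (by omega) (by omega)
      rcases p with _ | p
      · simpa using h4
      · rw [shufW_one_right]
        have hc : Commute (shufW q g o p 1) (g (o + p + 2)) :=
          (shufW_commute fun j h1 h2 => S.commute_gg (by omega) (by omega) (by omega) (by omega)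
            (by omega)).symm
        have h5 := hM _ (hs (o + p + 1) (by omega) (by omega))
          (g (o + p + 2) * g (o + p + 1) * shufW q g o p 1)
          (mul_mem (mul_mem (g_mem_lvl (by omega) (by omega)) (g_mem_lvl (by omega) (by omega)))
            (shufW_mem (by omega)))
        have h6 := add_mem h4 (M.smul_mem ((q : R) ^ 2) h5)
        convert h6 using 1
        have h7 := congrArg (fun x => v * (x * shufW q g o p 1))
          (S.braid (o + p + 1) (by omega) (by omega))
        have h8 : shufW q g o p 1 * g (o + p + 2) = g (o + p + 2) * shufW q g o p 1 := hc
        simp only [mul_assoc] at h7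
        simp only [Algebra.algebraMap_eq_smul_one, mul_add, mul_sub, add_mul, sub_mul,
          mul_smul_comm, mul_one, smul_mul_assoc, mul_assoc, smul_add, smul_sub,
          show o + (p + 1) + 1 = o + p + 2 by ring, h8]
        simp only [show o + p + 1 + 1 = o + p + 2 by ring] at h7
        linear_combination (norm := module) -((q : R) ^ 2 • h7)

/-- The vectors obtained by moving the induced strand through the next row. -/
theorem ind_asc (hM : RStable g e (K + 1) M) (hK : K + 1 ≤ n) {c r : ℕ} (hr : c + r ≤ K)
    {v : W} (hI : 1 ≤ K → ∀ x ∈ eIdeal R g e (K + 1), v * x ∈ M)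
    (hs : ∀ s, c < s → s < c + r → v * (g s - algebraMap R W q) ∈ M) {t : ℕ} (ht : t + 1 ≤ r) :
    (q : R) ^ (t + 1) • (v * descW g (K + 1) (c + 1) * ascW g (c + 1) (c + t + 2)) -
      (q : R) ^ (t + 1) • (v * descW g (K + 1) (c + t + 2)) -
      ((q : R) ^ 2 - 1) • (v * descW g (K + 1) (c + 1) * shufW q g c 1 t) ∈ M := by
  have hstep : ∀ s, c < s → s ≤ K → (q : R) • (v * descW g (K + 1) s * g s) -
      (q : R) • (v * descW g (K + 1) (s + 1)) -
      ((q : R) ^ 2 - 1) • (v * descW g (K + 1) s) ∈ M := by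
    intro s hs1 hs2
    rw [descW_tail g (show s < K + 1 by omega)]
    have h5 := M.smul_mem (-(((q : R) ^ 2 - 1) * ((z⁻¹ : Rˣ) : R)))
      (hI (by omega) _ (mul_mem_eIdeal_left (descW_mem_lvl (a := s + 1) (by omega) le_rfl)
        (S.e_mem_eIdeal (k := K + 1) (i := s) (by omega) (by omega) hK)))
    convert h5 using 1
    have h6 := congrArg (fun x => v * (descW g (K + 1) (s + 1) * x))
      (S.g_sq' (i := s) (by omega) (by omega))
    simp only [mul_add, mul_sub, mul_smul_comm, mul_one] at h6
    simp only [mul_assoc]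
    linear_combination (norm := module) h6
  induction t with
  | zero =>
    have := hstep (c + 1) (by omega) (by omega)
    simpa [ascW_single] using this
  | succ t ih =>
    have ih := ih (by omega)
    have h1 := M.smul_mem (q : R) (hM _ ih (g (c + t + 2)) (g_mem_lvl (by omega) (by omega)))
    have h2 := hstep (c + t + 2) (by omega) (by omega)
    have h3 := hM _ (hs (c + t + 1) (by omega) (by omega))
      (descW g (K + 1) (c + 1) * shufW q g c 1 t)
      (mul_mem (descW_mem_lvl (by omega) (by omega)) (shufW_mem (by omega)))
    have h4 : g (c + t + 1) * descW g (K + 1) (c + 1) = descW g (K + 1) (c + 1) * g (c + t + 2) :=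
      S.g_descW (by omega) (by omega) (by omega) (by omega)
    have h5 : shufW q g c 1 t * g (c + t + 2) = g (c + t + 2) * shufW q g c 1 t :=
      (shufW_commute fun j h1 h2 => S.commute_gg (by omega) (by omega) (by omega) (by omega)
            (by omega)).symm
    have h6 : g (c + t + 1) * (descW g (K + 1) (c + 1) * shufW q g c 1 t) =
        descW g (K + 1) (c + 1) * (g (c + t + 2) * shufW q g c 1 t) := by
      rw [← mul_assoc, h4, mul_assoc]
    rw [← Submodule.Quotient.mk_eq_zero, ← Submodule.mkQ_apply] at *
    rw [show c + (t + 1) + 2 = c + t + 2 + 1 by ring,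
      ascW_succ g (show c + 1 ≤ c + t + 2 by omega), shufW_one_left]
    simp only [Algebra.algebraMap_eq_smul_one, mul_add, mul_sub, sub_mul,
          mul_smul_comm, mul_one, smul_mul_assoc, mul_assoc, smul_add, smul_sub, h6, h5,
          map_add, map_sub, map_smul] at h1 h2 h3 ih ⊢
    linear_combination (norm := module) h1 + (q : R) ^ (t + 1) • h2 +
      (((q : R) ^ 2 - 1) * q) • h3 - ((q : R) ^ 2 - 1) • ih

theorem ind_shuf (hM : RStable g e (K + 1) M) (hK : K + 1 ≤ n) {c r : ℕ} (hr : c + r ≤ K)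
    {v : W} (hI : 1 ≤ K → ∀ x ∈ eIdeal R g e (K + 1), v * x ∈ M)
    (hs : ∀ s, c < s → s < c + r → v * (g s - algebraMap R W q) ∈ M) {t : ℕ} (ht : t ≤ r) :
    v * descW g (K + 1) (c + 1) * shufW q g c 1 t -
      (q : R) ^ t • (v * descW g (K + 1) (c + t + 1) * shufW q g c t 1) ∈ M := by
  induction t with
  | zero => simp
  | succ t ih =>
    have ih := ih (by omega)
    have h1 := S.ind_asc hM hK hr hI hs ht
    have h2 := add_mem h1 (M.smul_mem ((q : R) ^ 2) ih)
    convert h2 using 1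
    rw [shufW_one_left, shufW_one_right, descW_tail g (show c + t + 1 < K + 1 by omega)]
    simp only [mul_add, mul_smul_comm, mul_one, mul_assoc,
      smul_add, smul_sub, show c + (t + 1) + 1 = c + t + 2 by ring,
      show c + t + 1 + 1 = c + t + 2 by ring]
    module

/-- The induction vector of row `j` is soft modulo the restriction vectors and the induction
vectors of the higher rows. -/
theorem Soft.ind {N P : Submodule R W} {κ : ℕ → ℕ} {k l : ℕ} {v : W}
    (h : Soft q g e N κ K (k + 1) (l + 1) v) (hN : RStable g e (k + 1) N)
    (hP : RStable g e k P) (hNP : N ≤ P) (hk : k + 1 ≤ n)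
    (hv : 1 ≤ K → ∀ x ∈ lvl R g e K, v * x * stairW e k (l + 1) ∈ P) {j : ℕ} :
    Soft q g e (filt g e k P (vInd q g e κ K k l v) {i | i < j})
      (Function.update κ j (κ j + 1)) (K + 1) k l (vInd q g e κ K k l v j) := by
  have hs := h.size
  have hjK := h.tot (j + 1)
  rw [off_succ] at hjK
  set F := stairW e k l with hF
  have hFm : F ∈ lvl R g e k := stairW_mem_lvl (by omega) le_rfl
  have hFc : ∀ x ∈ lvl R g e (K + 1), F * x = x * F := fun x hx =>
    (S.commute_stairW_lvl (by omega) (by omega) (by omega) hx).eq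
  set N' := filt g e k P (vInd q g e κ K k l v) {i | i < j} with hN'
  have hPN' : P ≤ N' := le_filt
  set M := N'.comap (LinearMap.mulRight R F) with hMdef
  have hMm : ∀ x, x ∈ M ↔ x * F ∈ N' := fun x => Iff.rfl
  have hM : RStable g e (K + 1) M := fun x hx a ha => by
    rw [hMm] at hx ⊢
    rw [mul_assoc, ← hFc a ha, ← mul_assoc]
    exact hP.filt _ _ _ hx _ (lvl_mono (by omega) ha)
  have hNM : N ≤ M := fun x hx => hPN' (hNP (hN _ hx _ (lvl_mono (by omega) hFm)))
  have hI : 1 ≤ K → ∀ x ∈ eIdeal R g e (K + 1), v * x ∈ M := by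
    intro hK x hx
    have : eIdeal R g e (K + 1) ≤ M.comap (LinearMap.mulLeft R v) := by
      refine Submodule.span_le.2 ?_
      rintro _ ⟨x, hx, y, hy, rfl⟩
      change v * (x * e (K + 1 - 1) * y) * F ∈ N'
      rw [Nat.add_sub_cancel]
      obtain ⟨x', hx', hxe⟩ := S.lvl_mul_e hK (by omega) hx
      have h1 := hP _ (hv hK x' hx') y (lvl_mono (by omega) hy)
      rw [stairW_succ_left e k l (by omega), show k - 2 * l - 1 = K by omega] at h1
      convert hPN' h1 using 1
      rw [hxe]
      simp only [mul_assoc]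
      rw [← hFc y hy]
    exact this hx
  have hlow : ∀ i < j, v * descW g (K + 1) (off κ i + κ i + 1) * shufW q g (off κ i) (κ i) 1 ∈ M :=
    fun i hi => by
      rw [hMm]
      exact mem_filt_self hi
  obtain ⟨o, ho⟩ : ∃ o, o = off κ j := ⟨_, rfl⟩
  obtain ⟨D, hD⟩ : ∃ D, D = descW g (K + 1) (o + κ j + 1) := ⟨_, rfl⟩
  have hDm : D ∈ lvl R g e (K + 1) := hD ▸ descW_mem_lvl (by omega) le_rfl
  have hBm : shufW q g o (κ j) 1 ∈ lvl R g e (K + 1) := shufW_mem (by omega)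
  have low : ∀ {s}, 1 ≤ s → s < o + κ j → D * g s = g s * D := fun h1 h2 => hD ▸
    (descW_commute fun i h3 h4 =>
      S.commute_gg (by omega) (by omega) (by omega) (by omega) (by omega)).symm
  have hB : ∀ {s}, 1 ≤ s → s < n → (s < o ∨ o + κ j + 1 < s) →
      shufW q g o (κ j) 1 * g s = g s * shufW q g o (κ j) 1 := fun h1 h2 h3 =>
    (shufW_commute fun i h3 h4 =>
      S.commute_gg (by omega) (by omega) (by omega) (by omega) (by omega)).symm
  have hV : vInd q g e κ K k l v j = v * (D * shufW q g o (κ j) 1) * F := by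
    rw [vInd, hD, ho, mul_assoc v]
  have hX := mul_mem hDm hBm
  have hGM : ∀ i t, 1 ≤ t → t ≤ κ (i + 1) → ∀ y ∈ lvl R g e (K + 1),
      v * shufW q g (off κ i) (κ i) t * y ∈ M := fun i t h1 h2 y hy =>
    hM _ (hNM (h.garnir i t h1 h2)) y hy
  rw [hV]
  refine ⟨by omega, fun i => ?_, ⟨_, rfl⟩, fun i s h1 h2 => ?_, fun h2 x hx => ?_,
    fun i t ht1 ht2 => ?_⟩
  · rcases Nat.lt_or_ge j i with h1 | h1
    · have := off_update_of_lt κ (c := κ j + 1) h1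
      have := h.tot i
      omega
    · rw [off_update_of_le κ h1]
      have := off_mono κ h1
      omega
  · have hsK : s < K + 1 := by
      have h3 := h.tot (i + 1)
      rw [off_succ] at h3
      rcases lt_trichotomy i j with hij | rfl | hij
      · rw [off_update_of_le κ hij.le, Function.update_of_ne (by omega)] at h2; omega
      · rw [off_update_of_le κ le_rfl, Function.update_self] at h2; omega
      · have := off_update_of_lt κ (c := κ j + 1) hij
        rw [Function.update_of_ne (by omega)] at h2; omega
    have hgs : g s - algebraMap R W q ∈ lvl R g e (K + 1) :=
      sub_mem (g_mem_lvl (by omega) hsK) (Subalgebra.algebraMap_mem _ _)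
    rw [mul_assoc, hFc _ hgs, ← mul_assoc, ← hMm]
    rcases lt_trichotomy i j with hij | rfl | hij
    · rw [off_update_of_le κ hij.le] at h1 h2
      rw [Function.update_of_ne (by omega)] at h2
      have h3 := off_succ_le κ hij
      refine sym_transfer hM hX ?_ (hNM (h.sym i s h1 h2))
      rw [mul_assoc, hB (by omega) (by omega) (by omega), ← mul_assoc,
        low (by omega) (by omega), mul_assoc]
    · rw [off_update_of_le κ le_rfl, ← ho] at h1 h2
      rw [Function.update_self] at h2
      rw [← mul_assoc]
      refine S.ind_sym_row hM (by omega) (by omega) (fun hK x hx => ?_) (fun s h3 h4 => ?_)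
        h1 (by omega)
      · rw [mul_assoc]
        exact hI hK _ (mul_mem_eIdeal_left hDm hx)
      · exact sym_transfer hM hDm (low (by omega) h4) (hNM (h.sym i s (by omega) (by omega)))
    · have h3 := off_update_of_lt κ (c := κ j + 1) hij
      have h4 := off_succ_le κ hij
      have h5 := h.tot (i + 1)
      rw [off_succ] at h5
      rw [Function.update_of_ne (by omega)] at h2
      obtain ⟨s, rfl⟩ : ∃ s', s = s' + 1 := ⟨s - 1, by omega⟩
      refine sym_transfer hM hX ?_ (hNM (h.sym i s (by omega) (by omega)))
      rw [mul_assoc, hB (by omega) (by omega) (by omega), ← mul_assoc, ← mul_assoc, hD,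
        S.g_descW (by omega) (by omega) (by omega) (by omega)]
  · rw [mul_assoc, mul_assoc, ← mul_assoc F, hFc x hx, mul_assoc x, Nat.add_sub_cancel,
      hFc _ (e_mem_lvl (by omega) (by omega)), ← mul_assoc x, ← mul_assoc, ← hMm, mul_assoc v]
    refine hI (by omega) _ (mul_mem_eIdeal_left hX (mul_mem_eIdeal_left hx ?_))
    exact S.e_mem_eIdeal (by omega) (by omega) (by omega)
  · have hBt : off (Function.update κ j (κ j + 1)) i + Function.update κ j (κ j + 1) i + t
        ≤ K + 1 := by
      have h3 := h.tot (i + 2)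
      have h4 := h.tot (i + 1)
      rw [off_succ, off_succ] at h3
      rcases lt_trichotomy i j with hij | rfl | hij
      · rw [off_update_of_le κ hij.le, Function.update_of_ne (by omega)]
        rcases (show i + 1 ≤ j from hij).lt_or_eq with h5 | rfl
        · rw [Function.update_of_ne (by omega)] at ht2; omega
        · rw [Function.update_self] at ht2; omega
      · rw [Function.update_of_ne (by omega)] at ht2
        rw [off_update_of_le κ le_rfl, Function.update_self]; omega
      · rw [Function.update_of_ne (by omega)] at ht2 ⊢
        have := off_update_of_lt κ (c := κ j + 1) hij
        omega
    rw [mul_assoc, hFc _ (shufW_mem hBt), ← mul_assoc, ← hMm]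
    rcases lt_trichotomy i j with hij | rfl | hij
    · rw [off_update_of_le κ hij.le, Function.update_of_ne (by omega)] at hBt ⊢
      have h4 := off_succ_le κ hij
      rcases (show i + 1 ≤ j from hij).lt_or_eq with h5 | rfl
      · rw [Function.update_of_ne (by omega)] at ht2
        have h6 := off_succ_le κ h5
        rw [off_succ] at h6
        have h7 := hGM i t ht1 ht2 _ hX
        convert h7 using 1
        rw [mul_assoc, mul_assoc, mul_assoc,
          ← (S.shufW_commute_shufW (a := off κ i) (a' := o) (by omega) (by omega)).eq,
          ← mul_assoc D, hD,
          ← (S.shufW_commute_descW (by omega) (by omega)).eq, mul_assoc]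
      · rw [Function.update_self] at ht2
        have ho2 : o = off κ i + κ i := ho.trans (off_succ κ i)
        obtain ⟨r, hr⟩ : ∃ r, r = κ (i + 1) := ⟨_, rfl⟩
        have hA : v * (D * shufW q g (o + t) (r - t) 1) * shufW q g (off κ i) (κ i) t ∈ M ∨
            t = r + 1 := by
          refine or_iff_not_imp_right.2 fun htr => ?_
          have h7 := hGM i t ht1 (by omega) (D * shufW q g (o + t) (r - t) 1)
            (mul_mem hDm (shufW_mem (by omega)))
          convert h7 using 1
          rw [mul_assoc, mul_assoc, mul_assoc,
            ← (S.shufW_commute_shufW (a := off κ i) (a' := o + t) (by omega) (by omega)).eq,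
            ← mul_assoc D, hD,
            ← (S.shufW_commute_descW (by omega) (by omega)).eq, mul_assoc]
        have hE : v * (descW g (K + 1) (o + t) * shufW q g o (t - 1) 1) *
            shufW q g (off κ i) (κ i) t ∈ M := by
          have h8 := S.shufW_coassoc (q := q) (a := off κ i) (p := κ i) (s := t - 1) (t := 1)
            (by omega)
          rw [Nat.sub_add_cancel ht1, ← ho2] at h8
          rw [mul_assoc, mul_assoc (descW g _ _), ← h8, ← mul_assoc (descW g _ _),
            ← (S.shufW_commute_descW (by omega) (by omega)).eq, mul_assoc, ← mul_assoc]
          rcases (show t = 1 ∨ 1 ≤ t - 1 by omega) with rfl | h9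
          · have h10 := hlow i (by omega)
            rw [Nat.sub_self, shufW_zero_right, mul_one, add_zero]
            rwa [mul_assoc, ← ho2] at h10
          · exact hGM i (t - 1) h9 (by omega) _
              (mul_mem (descW_mem_lvl (by omega) le_rfl) (shufW_mem (by omega)))
        rcases (show t ≤ r ∨ t = r + 1 by omega) with h9 | rfl
        · rw [← hr, shufW_one_split h9, if_neg (by omega)]
          have h10 := add_mem (hA.resolve_right (by omega)) (M.smul_mem ((q : R) ^ (r + 1 - t)) hE)
          convert h10 using 1
          rw [descW_split g (show o + t ≤ o + r + 1 by omega) (show o + r + 1 ≤ K + 1 by omega),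
            hD, hr]
          simp only [mul_add, add_mul, mul_smul_comm, smul_mul_assoc, mul_assoc]
        · rw [Nat.add_sub_cancel, ← add_assoc] at hE
          rwa [hD, ← hr]
    · rw [off_update_of_le κ le_rfl, Function.update_self, ← ho] at hBt ⊢
      rw [Function.update_of_ne (by omega)] at ht2
      have h3 := h.tot (i + 2)
      rw [off_succ, off_succ] at h3
      have h4 := S.ind_shuf hM (by omega) (c := o + κ i) (r := κ (i + 1)) (by omega) hI
        (fun s h5 h6 => hNM (h.sym (i + 1) s (by rw [off_succ]; omega) (by rw [off_succ]; omega)))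
        ht2
      have h5 := hM _ h4 (shufW q g o (κ i) (t + 1)) (shufW_mem (by omega))
      have h6 := hGM i t ht1 ht2 (descW g (K + 1) (o + κ i + t + 1) * shufW q g o (κ i + t) 1)
        (mul_mem (descW_mem_lvl (by omega) le_rfl) (shufW_mem (by omega)))
      have h7 := add_mem h5 (M.smul_mem ((q : R) ^ t) h6)
      convert h7 using 1
      have h8 := S.shufW_coassoc (q := q) (a := o) (p := κ i) (s := 1) (t := t) (by omega)
      have h9 := S.shufW_coassoc (q := q) (a := o) (p := κ i) (s := t) (t := 1) (by omega)
      have h10 := (S.shufW_commute_descW (q := q) (a := o) (p := κ i) (t := t)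
        (s := o + κ i + t + 1) (r := K + 1) (by omega) (by omega)).eq
      rw [mul_assoc v, mul_assoc D, h8, add_comm 1 t, sub_mul, smul_mul_assoc,
        mul_assoc _ (shufW q g (o + κ i) t 1), ← h9, ← ho, mul_assoc v (shufW q g o (κ i) t),
        ← mul_assoc (shufW q g o (κ i) t), h10, hD]
      simp only [mul_assoc, sub_add_cancel]
    · have h3 := off_update_of_lt κ (c := κ j + 1) hij
      have h4 := off_succ_le κ hij
      rw [Function.update_of_ne (by omega)] at ht2
      rw [Function.update_of_ne (by omega)] at hBt ⊢
      have h5 := h.tot (i + 2)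
      rw [off_succ, off_succ] at h5
      rw [show off (Function.update κ j (κ j + 1)) i = off κ i + 1 by omega]
      have h7 := hGM i t ht1 ht2 _ hX
      convert h7 using 1
      rw [mul_assoc, mul_assoc, mul_assoc,
        (S.shufW_commute_shufW (a := o) (a' := off κ i + 1) (by omega) (by omega)).eq,
        ← mul_assoc D, hD,
        ← S.shufW_mul_descW (by omega) (by omega) (by omega) (by omega), mul_assoc]

end BMWSys
end Induction

section Young

namespace YoungDiagram

theorem ext_rowLen {μ ν : YoungDiagram} (h : μ.rowLen = ν.rowLen) : μ = ν := by
  ext ⟨i, j⟩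
  rw [mem_cells, mem_cells, mem_iff_lt_rowLen, mem_iff_lt_rowLen, h]

theorem le_iff_rowLen {μ ν : YoungDiagram} : μ ≤ ν ↔ ∀ i, μ.rowLen i ≤ ν.rowLen i := by
  constructor
  · intro h i
    by_contra! hc
    have h1 : (i, ν.rowLen i) ∈ μ := mem_iff_lt_rowLen.2 hc
    have h2 := mem_iff_lt_rowLen.1 (h h1)
    omega
  · rintro h ⟨i, j⟩ hc
    exact mem_iff_lt_rowLen.2 ((mem_iff_lt_rowLen.1 hc).trans_le (h i))

theorem exists_of_antitone {f : ℕ → ℕ} {m : ℕ} (hf : Antitone f) (hm : f m = 0) :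
    ∃ ν : YoungDiagram, ν.rowLen = f := by
  have hlt : ∀ {i j}, j < f i → i < m := fun {i j} h => by
    by_contra! hc
    have := hf hc
    omega
  let ν : YoungDiagram :=
    { cells := (Finset.range m ×ˢ Finset.range (f 0)).filter fun c => c.2 < f c.1
      isLowerSet := by
        rintro ⟨i, j⟩ ⟨i', j'⟩ ⟨h1, h2⟩ h
        simp only [Finset.coe_filter, Finset.mem_product, Finset.mem_range,
          Set.mem_ofPred_eq] at h ⊢
        have h1' : i' ≤ i := h1
        have h2' : j' ≤ j := h2
        have := hf h1'
        omega }
  have hmem : ∀ i j, (i, j) ∈ ν ↔ j < f i := by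
    intro i j
    change (i, j) ∈ (Finset.range m ×ˢ Finset.range (f 0)).filter _ ↔ _
    simp only [Finset.mem_filter, Finset.mem_product, Finset.mem_range]
    refine ⟨fun h => h.2, fun h => ⟨⟨hlt h, h.trans_le (hf (Nat.zero_le _))⟩, h⟩⟩
  refine ⟨ν, funext fun i => ?_⟩
  apply le_antisymm
  · by_contra! hc
    exact absurd ((hmem _ _).1 (mem_iff_lt_rowLen.2 hc)) (lt_irrefl _)
  · by_contra! hc
    exact absurd (mem_iff_lt_rowLen.1 ((hmem _ _).2 hc)) (lt_irrefl _)

theorem card_eq_off {μ : YoungDiagram} {m : ℕ} (hm : μ.rowLen m = 0) :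
    μ.card = off μ.rowLen m := by
  have : μ.cells = (Finset.range m).biUnion fun i => μ.row i := by
    ext ⟨i, j⟩
    simp only [Finset.mem_biUnion, Finset.mem_range, mem_row_iff, mem_cells]
    constructor
    · intro h
      refine ⟨i, ?_, h, rfl⟩
      by_contra! hc
      have := μ.rowLen_anti _ _ hc
      have := mem_iff_lt_rowLen.1 h
      omega
    · rintro ⟨i', h1, h2, rfl⟩
      exact h2
  rw [YoungDiagram.card, this, Finset.card_biUnion, off]
  · exact Finset.sum_congr rfl fun i _ => (rowLen_eq_card μ).symm
  · intro i _ j _ hij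
    refine Finset.disjoint_left.2 fun c h1 h2 => hij ?_
    rw [mem_row_iff] at h1 h2
    exact h1.2.symm.trans h2.2

theorem rowLen_colLen (μ : YoungDiagram) : μ.rowLen (μ.colLen 0) = 0 := by
  by_contra hc
  have := mem_iff_lt_colLen.1 (mem_iff_lt_rowLen.2 (Nat.pos_of_ne_zero hc))
  omega

theorem rowLen_pos_iff {μ : YoungDiagram} {i : ℕ} : 1 ≤ μ.rowLen i ↔ i < μ.colLen 0 :=
  mem_iff_lt_rowLen.symm.trans mem_iff_lt_colLen

theorem off_le_card (μ : YoungDiagram) (i : ℕ) : off μ.rowLen i ≤ μ.card := by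
  have h : μ.rowLen (max i (μ.colLen 0)) = 0 := by
    have := μ.rowLen_anti _ _ (le_max_right i (μ.colLen 0))
    rw [rowLen_colLen] at this
    omega
  rw [card_eq_off h]
  exact off_mono _ (le_max_left _ _)

theorem lt_card_of_rowLen_pos {μ : YoungDiagram} {i : ℕ} (h : 1 ≤ μ.rowLen i) : i < μ.card := by
  refine lt_of_lt_of_le ?_ (μ.off_le_card (i + 1))
  rw [off]
  calc i < ∑ _j ∈ Finset.range (i + 1), 1 := by simp
    _ ≤ _ := Finset.sum_le_sum fun j hj => h.trans (μ.rowLen_anti _ _ (by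
      rw [Finset.mem_range] at hj; omega))

/-- `μ` arises from `ν` by adding a node in row `j`. -/
theorem exists_add (ν : YoungDiagram) {j : ℕ} (hj : ∀ i, i + 1 = j → ν.rowLen j < ν.rowLen i) :
    ∃ μ : YoungDiagram, μ.rowLen = Function.update ν.rowLen j (ν.rowLen j + 1) := by
  have hν : ∀ a, ν.rowLen (a + 1) ≤ ν.rowLen a := fun a => ν.rowLen_anti _ _ (Nat.le_succ a)
  have hz : ν.rowLen (max (j + 1) (ν.colLen 0)) = 0 := by
    have := ν.rowLen_anti _ _ (le_max_right (j + 1) (ν.colLen 0))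
    rw [rowLen_colLen] at this
    omega
  refine exists_of_antitone (m := max (j + 1) (ν.colLen 0)) (antitone_nat_of_succ_le fun a => ?_) ?_
  · have := hν a
    simp only [Function.update_apply]
    split_ifs with h1 h2 h2
    · omega
    · subst h1
      have := hj a rfl
      omega
    · subst h2; omega
    · assumption
  · rw [Function.update_apply, if_neg (by have := le_max_left (j + 1) (ν.colLen 0); omega), hz]

theorem exists_remove (ν : YoungDiagram) {j : ℕ} (hj : ν.rowLen (j + 1) < ν.rowLen j) :
    ∃ μ : YoungDiagram, μ.rowLen = Function.update ν.rowLen j (ν.rowLen j - 1) := by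
  have hν : ∀ a, ν.rowLen (a + 1) ≤ ν.rowLen a := fun a => ν.rowLen_anti _ _ (Nat.le_succ a)
  have hz : ν.rowLen (max (j + 1) (ν.colLen 0)) = 0 := by
    have := ν.rowLen_anti _ _ (le_max_right (j + 1) (ν.colLen 0))
    rw [rowLen_colLen] at this
    omega
  refine exists_of_antitone (m := max (j + 1) (ν.colLen 0)) (antitone_nat_of_succ_le fun a => ?_) ?_
  · have := hν a
    simp only [Function.update_apply]
    split_ifs with h1 h2 h2
    · omega
    · subst h1; omega
    · subst h2; omega
    · exact this
  · rw [Function.update_apply, if_neg (by have := le_max_left (j + 1) (ν.colLen 0); omega), hz]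

section Add
variable {ν μ : YoungDiagram} {j : ℕ} (h : μ.rowLen = Function.update ν.rowLen j (ν.rowLen j + 1))
include h

theorem le_of_add : ν ≤ μ := le_iff_rowLen.2 fun i => by
  rw [h, Function.update_apply]
  split_ifs with h1
  · subst h1; omega
  · rfl

theorem card_of_add : μ.card = ν.card + 1 := by
  set m := max (j + 1) (max (ν.colLen 0) (μ.colLen 0))
  have h1 : ν.rowLen m = 0 := by
    have := ν.rowLen_anti _ m ((le_max_left _ _).trans (le_max_right _ _))
    rw [rowLen_colLen] at this
    omega
  have h2 : μ.rowLen m = 0 := by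
    have := μ.rowLen_anti _ m ((le_max_right _ _).trans (le_max_right _ _))
    rw [rowLen_colLen] at this
    omega
  have h3 : j + 1 ≤ m := le_max_left _ _
  rw [card_eq_off h1, card_eq_off h2, h]
  have h4 : j ∈ Finset.range m := Finset.mem_range.2 h3
  rw [off, off, Finset.sum_update_of_mem h4, ← Finset.sum_sdiff (Finset.singleton_subset_iff.2 h4),
    Finset.sum_singleton]
  omega

theorem addedRow_of_add : addedRow ν μ = j := by
  have h1 : μ.rowLen j = ν.rowLen j + 1 := by rw [h]; simp
  rw [addedRow, Finset.sum_eq_single j]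
  · rw [if_pos (by omega)]
  · intro b _ hb
    rw [if_neg]
    rw [h, Function.update_of_ne hb]
    exact fun h => h rfl
  · intro hj
    refine absurd ?_ hj
    have := lt_card_of_rowLen_pos (μ := μ) (i := j) (by omega)
    rw [Finset.mem_range]
    omega

theorem aVal_of_add : aVal ν μ = off ν.rowLen j + ν.rowLen j + 1 := by
  rw [aVal, addedRow_of_add h, ← off, off_succ, h, off_update_of_le _ le_rfl, Function.update_self]
  ring

theorem off_of_add : off μ.rowLen j = off ν.rowLen j := by
  rw [h, off_update_of_le _ le_rfl]

end Add
end YoungDiagram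
end Young

section Straighten
variable {R W : Type*} [CommRing R] [Ring W] [Algebra R W]
variable {z q : Rˣ} {δ : R} {n : ℕ} {g gi e : ℕ → W}

theorem shufW_one_eq_sum (a p : ℕ) : shufW q g a p 1 =
    ∑ r ∈ Finset.range (p + 1), ((q : R) ^ r) • descW g (a + p + 1) (a + p + 1 - r) := by
  induction p with
  | zero => simp
  | succ p ih =>
    rw [shufW_one_right, ih, Finset.sum_range_succ' _ (p + 1), Finset.mul_sum, Finset.smul_sum,
      add_comm]
    congr 1
    · refine Finset.sum_congr rfl fun r hr => ?_
      rw [Finset.mem_range] at hr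
      rw [mul_smul_comm, smul_smul, ← pow_succ', show a + (p + 1) + 1 = a + p + 1 + 1 by ring,
        show a + p + 1 + 1 - (r + 1) = a + p + 1 - r by omega,
        descW_succ g (show a + p + 1 - r ≤ a + p + 1 by omega)]
    · simp

/-- The coefficient attached to the edge `a → b` of the branching diagram. -/
def dStepW (q : Rˣ) (g e : ℕ → W) (k : ℕ) (a b : YoungDiagram × ℕ) : W :=
  if b.2 = a.2 then ascW g (aVal a.1 b.1) (k - 2 * a.2 + 1) * stairW e k a.2
  else descW g (k - 2 * a.2) (aVal b.1 a.1) *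
    (∑ r ∈ Finset.range (b.1.rowLen (addedRow b.1 a.1) + 1),
      ((q : R) ^ r) • descW g (aVal b.1 a.1) (aVal b.1 a.1 - r)) * stairW e k a.2

/-- `w` is the path element of some path of length `k` ending in the given vertex. -/
inductive IsD (q : Rˣ) (g e : ℕ → W) : ℕ → YoungDiagram × ℕ → W → Prop
  | nil : IsD q g e 0 (⊥, 0) 1
  | cons {k : ℕ} {a b : YoungDiagram × ℕ} {w : W} (h : IsD q g e k a w) (hab : WEdge a b) :
      IsD q g e (k + 1) b (dStepW q g e k a b * w)

/-- The span of `N` and all `v * d_t`, `t` a path of length `k` to `x`. -/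
def dSpan (q : Rˣ) (g e : ℕ → W) (k : ℕ) (x : YoungDiagram × ℕ) (v : W) (N : Submodule R W) :
    Submodule R W :=
  Submodule.span R {y | ∃ w, IsD q g e k x w ∧ y = v * w} ⊔ N

theorem dSpan_le_succ {k : ℕ} {a b : YoungDiagram × ℕ} (hab : WEdge a b) {v : W}
    {N N' : Submodule R W} (hN : N' ≤ dSpan q g e (k + 1) b v N) :
    dSpan q g e k a (v * dStepW q g e k a b) N' ≤ dSpan q g e (k + 1) b v N := by
  refine sup_le (Submodule.span_le.2 ?_) hN
  rintro _ ⟨w, hw, rfl⟩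
  exact Submodule.mem_sup_left (Submodule.subset_span ⟨_, .cons hw hab, by rw [mul_assoc]⟩)

theorem vRes_eq_dStepW {μ ν : YoungDiagram} {k l j : ℕ} {v : W}
    (h : μ.rowLen = Function.update ν.rowLen j (ν.rowLen j + 1)) (hs : μ.card + 2 * l = k + 1) :
    vRes g e μ.rowLen μ.card k l v j = v * dStepW q g e k (ν, l) (μ, l) := by
  have hc := YoungDiagram.card_of_add h
  have h1 : μ.rowLen j = ν.rowLen j + 1 := by rw [h]; simp
  rw [vRes, dStepW, if_pos rfl, YoungDiagram.aVal_of_add h, YoungDiagram.off_of_add h, h1,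
    mul_assoc, ← add_assoc, show k - 2 * l + 1 = μ.card by omega]

theorem vInd_eq_dStepW {μ ν : YoungDiagram} {k l j : ℕ} {v : W}
    (h : ν.rowLen = Function.update μ.rowLen j (μ.rowLen j + 1))
    (hs : μ.card + 2 * (l + 1) = k + 1) :
    vInd q g e μ.rowLen μ.card k l v j = v * dStepW q g e k (ν, l) (μ, l + 1) := by
  rw [vInd, dStepW, if_neg (by simp), YoungDiagram.aVal_of_add h, YoungDiagram.addedRow_of_add h,
    shufW_one_eq_sum, show k - 2 * l = μ.card + 1 by omega]
  simp only [mul_assoc]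

namespace BMWSys
variable (S : BMWSys z q δ n g gi e)
include S

theorem stairW_absorb {k l : ℕ} (hl : 2 * (l + 1) ≤ k + 1) (hk : k + 1 ≤ n) :
    ∃ F ∈ lvl R g e k, stairW e (k + 1) (l + 1) * stairW e k l * F = stairW e (k + 1) (l + 1) := by
  induction l with
  | zero => exact ⟨1, one_mem _, by simp⟩
  | succ l ih =>
    obtain ⟨F, hF, h⟩ := ih (by omega)
    obtain ⟨c, hc, hc1⟩ : ∃ c, 1 ≤ c ∧ c + 2 * (l + 1) = k :=
      ⟨k - 2 * (l + 1), by omega, by omega⟩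
    refine ⟨e c * F, mul_mem (e_mem_lvl hc (by omega)) hF, ?_⟩
    rw [stairW_succ_left e (k + 1) (l + 1) (by omega), stairW_succ_left e k l (by omega),
      show k + 1 - 2 * (l + 1) - 1 = c by omega, show k - 2 * l - 1 = c + 1 by omega]
    set A := stairW e (k + 1) (l + 1)
    set B := stairW e k l
    have hA : e c * A = A * e c := stairW_commute (X := e c) (fun j h1 h2 =>
      S.commute_ee (by omega) (by omega) (by omega) (by omega) (by omega)) (by omega)
    have hB : e c * B = B * e c := stairW_commute (X := e c) (fun j h1 h2 =>
      S.commute_ee (by omega) (by omega) (by omega) (by omega) (by omega)) (by omega)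
    calc e c * A * (e (c + 1) * B) * (e c * F)
        = e c * A * e (c + 1) * (B * e c) * F := by simp only [mul_assoc]
      _ = A * (e c * e (c + 1) * e c) * B * F := by rw [← hB, hA]; simp only [mul_assoc]
      _ = e c * (A * B * F) := by
        rw [S.eee c hc (by omega), ← hA]; simp only [mul_assoc]
      _ = e c * A := by rw [h]

theorem Soft.mem_dSpan {k : ℕ} (hk : k ≤ n) {μ : YoungDiagram} {l : ℕ} {v : W}
    {N : Submodule R W} (h : Soft q g e N μ.rowLen μ.card k l v) (hN : RStable g e k N)
    {a : W} (ha : a ∈ lvl R g e k) : v * a ∈ dSpan q g e k (μ, l) v N := by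
  induction k generalizing μ l v N a with
  | zero =>
    have hs := h.size
    obtain rfl : l = 0 := by omega
    obtain rfl : μ = ⊥ := by
      have : μ.cells = ∅ := Finset.card_eq_zero.1 (show μ.card = 0 by omega)
      exact YoungDiagram.ext (by rw [this]; rfl)
    have h2 : lvl R g e 0 = ⊥ := by
      rw [lvl, show {x | ∃ j, 1 ≤ j ∧ j < 0 ∧ (x = g j ∨ x = e j)} = (∅ : Set W) by
        ext; simp, Algebra.adjoin_empty]
    rw [h2, Algebra.mem_bot] at ha
    obtain ⟨r, rfl⟩ := ha
    rw [← Algebra.commutes, ← Algebra.smul_def]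
    exact Submodule.smul_mem _ _ (Submodule.mem_sup_left
      (Submodule.subset_span ⟨1, .nil, by simp⟩))
  | succ k ih =>
    have hs := h.size
    have hN' := hN.mono (Nat.le_succ k)
    set T := dSpan q g e (k + 1) (μ, l) v N with hT
    have hNT : N ≤ T := le_sup_right
    set m := μ.colLen 0
    have hm : off μ.rowLen m = μ.card := (YoungDiagram.card_eq_off μ.rowLen_colLen).symm
    have hres : ∀ d j, m ≤ j + d → 1 ≤ μ.rowLen j → ∀ a ∈ lvl R g e k,
        vRes g e μ.rowLen μ.card k l v j * a ∈ T := by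
      intro d
      induction d with
      | zero =>
        intro j h1 h2
        have := YoungDiagram.rowLen_pos_iff.1 h2
        omega
      | succ d ihd =>
        intro j hj h1 a ha
        have hcard := YoungDiagram.lt_card_of_rowLen_pos h1
        have hsoft := Soft.res S h hN hk (by omega) h1
        set N1 := filt g e k N (vRes g e μ.rowLen μ.card k l v) {i | j < i ∧ 1 ≤ μ.rowLen i}
        have hN1 : N1 ≤ T := filt_le hNT fun i hi a ha => by
          have hi' : j < i ∧ 1 ≤ μ.rowLen i := hi
          exact ihd i (by omega) hi'.2 a ha
        have hN1s : RStable g e k N1 := hN'.filt _ _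
        by_cases hc : μ.rowLen (j + 1) < μ.rowLen j
        · obtain ⟨ν, hν⟩ := μ.exists_remove hc
          have hμ : μ.rowLen = Function.update ν.rowLen j (ν.rowLen j + 1) := by
            rw [hν]; simp [Nat.sub_add_cancel h1]
          have hcν := YoungDiagram.card_of_add hμ
          rw [← hν, show μ.card - 1 = ν.card by omega, vRes_eq_dStepW (q := q) hμ hs] at hsoft
          rw [vRes_eq_dStepW (q := q) hμ hs]
          exact dSpan_le_succ (a := (ν, l)) (b := (μ, l))
            (Or.inl ⟨rfl, YoungDiagram.le_of_add hμ, hcν⟩) hN1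
            (ih (by omega) hsoft hN1s ha)
        · refine hN1 (hN1s _ (Soft.vanish S hsoft hN1s (by omega) (i := j) ?_) a ha)
          rw [Function.update_self, Function.update_of_ne (by omega)]
          omega
    set P := filt g e k N (vRes g e μ.rowLen μ.card k l v) {i | 1 ≤ μ.rowLen i}
    have hPT : P ≤ T := filt_le hNT fun i hi a ha => hres m i (by omega) hi a ha
    rcases l with _ | l
    · have := Soft.res_span S h hN hk (by omega) hm (x := a)
        (by rwa [show μ.card = k + 1 by omega]) (by omega)
      rw [stairW_zero, mul_one] at this
      exact hPT this
    · have hPs : RStable g e k P := hN'.filt _ _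
      have hind : ∀ j, ∀ a ∈ lvl R g e k, vInd q g e μ.rowLen μ.card k l v j * a ∈ T := by
        intro j
        induction j using Nat.strong_induction_on with
        | _ j ihj =>
        intro a ha
        have hsoft := Soft.ind S h hN hPs le_filt hk (fun hK x hx =>
          Soft.res_span S h hN hk hK hm hx (by omega)) (j := j)
        set N1 := filt g e k P (vInd q g e μ.rowLen μ.card k l v) {i | i < j}
        have hN1 : N1 ≤ T := filt_le hPT fun i hi a ha => ihj i hi a ha
        have hN1s : RStable g e k N1 := hPs.filt _ _
        by_cases hc : ∀ i, i + 1 = j → μ.rowLen j < μ.rowLen i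
        · obtain ⟨ν, hν⟩ := μ.exists_add hc
          have hcν := YoungDiagram.card_of_add hν
          rw [← hν, ← hcν, vInd_eq_dStepW hν hs] at hsoft
          rw [vInd_eq_dStepW hν hs]
          exact dSpan_le_succ (a := (ν, l)) (b := (μ, l + 1))
            (Or.inr ⟨rfl, YoungDiagram.le_of_add hν, hcν⟩) hN1
            (ih (by omega) hsoft hN1s ha)
        · push Not at hc
          obtain ⟨i, rfl, hi⟩ := hc
          refine hN1 (hN1s _ (Soft.vanish S hsoft hN1s (by omega) (i := i) ?_) a ha)
          rw [Function.update_self, Function.update_of_ne (by omega)]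
          omega
      obtain ⟨w, hw⟩ := h.stair
      obtain ⟨y, hy, hay⟩ := S.e_mul_lvl (m := k) (by omega) (by omega) ha
      obtain ⟨F, hF, hF1⟩ := S.stairW_absorb (k := k) (l := l) (by omega) hk
      have h1 : v * a = v * y := by
        rw [hw, stairW_succ_right e k l (by omega)]
        simp only [mul_assoc]
        rw [hay]
      have h2 : vInd q g e μ.rowLen μ.card k l v m = v * stairW e k l := by
        rw [vInd, hm, μ.rowLen_colLen, shufW_zero_left]
        simp
      have h3 : v * a = vInd q g e μ.rowLen μ.card k l v m * (F * y) := by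
        rw [h1, h2]
        conv_lhs => rw [hw, ← hF1]
        rw [hw]
        simp only [mul_assoc]
      rw [h3]
      exact hind m _ (mul_mem hF hy)

end BMWSys
end Straighten

section RowSymmetrizers
variable {R W : Type*} [CommRing R] [Ring W] [Algebra R W]
variable {z q : Rˣ} {δ : R} {n : ℕ} {g gi e : ℕ → W}

/-- The `q`-symmetrizer on the strands `a + 1, …, a + p`. -/
def rowSym (q : Rˣ) (g : ℕ → W) (a : ℕ) : ℕ → W
  | 0 => 1
  | p + 1 => rowSym q g a p * shufW q g a p 1

/-- The mirror image of `shufW q g a p 1`. -/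
def mirW (q : Rˣ) (g : ℕ → W) (a : ℕ) : ℕ → W
  | 0 => 1
  | p + 1 => 1 + (q : R) • (mirW q g a p * g (a + p + 1))

@[simp] theorem rowSym_zero (a : ℕ) : rowSym q g a 0 = 1 := rfl

theorem rowSym_succ (a p : ℕ) : rowSym q g a (p + 1) = rowSym q g a p * shufW q g a p 1 := rfl

@[simp] theorem rowSym_one (a : ℕ) : rowSym q g a 1 = 1 := by simp [rowSym_succ]

@[simp] theorem mirW_zero (a : ℕ) : mirW q g a 0 = 1 := rfl

theorem mirW_succ (a p : ℕ) :
    mirW q g a (p + 1) = 1 + (q : R) • (mirW q g a p * g (a + p + 1)) := rfl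

theorem rowSym_mem {k a p : ℕ} (h : a + p ≤ k) : rowSym q g a p ∈ lvl R g e k := by
  induction p with
  | zero => exact one_mem _
  | succ p ih => exact mul_mem (ih (by omega)) (shufW_mem (by omega))

theorem rowSym_intertwine {X : W} {c a p : ℕ}
    (h : ∀ j, a < j → j < a + p → X * g j = g (j + c) * X) :
    X * rowSym q g a p = rowSym q g (a + c) p * X := by
  induction p with
  | zero => simp
  | succ p ih =>
    rw [rowSym_succ, rowSym_succ, ← mul_assoc, ih fun j h1 h2 => h j h1 (by omega), mul_assoc,
      shufW_intertwine fun j h1 h2 => h j h1 (by omega), mul_assoc]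

theorem rowSym_commute {X : W} {a p : ℕ} (h : ∀ j, a < j → j < a + p → Commute X (g j)) :
    Commute X (rowSym q g a p) := rowSym_intertwine (c := 0) h

theorem mirW_commute {X : W} {a p : ℕ} (h : ∀ j, a < j → j ≤ a + p → Commute X (g j)) :
    Commute X (mirW q g a p) := by
  induction p with
  | zero => exact Commute.one_right X
  | succ p ih =>
    exact (Commute.one_right X).add_right
      (((ih fun j h1 h2 => h j h1 (by omega)).mul_right (h _ (by omega) (by omega))).smul_right _)

theorem mirW_split (a p t : ℕ) : mirW q g a (p + t + 1) = mirW q g (a + p + 1) t +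
    ((q : R) ^ (t + 1)) • (mirW q g a p * ascW g (a + p + 1) (a + p + t + 2)) := by
  induction t with
  | zero => simp [mirW_succ, ascW_single]
  | succ t ih =>
    rw [← add_assoc p t 1, mirW_succ, ih, mirW_succ,
      show a + p + (t + 1) + 2 = a + p + t + 2 + 1 by ring,
      ascW_succ g (show a + p + 1 ≤ a + p + t + 2 by omega),
      show a + (p + t + 1) + 1 = a + p + t + 2 by ring,
      show a + p + 1 + t + 1 = a + p + t + 2 by ring, pow_succ' _ (t + 1)]
    simp only [add_mul, smul_add, smul_mul_assoc, smul_smul, mul_assoc, add_assoc]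

namespace BMWSys
variable (S : BMWSys z q δ n g gi e)
include S

theorem rowSym_commute_g {a p j : ℕ} (hp : a + p ≤ n) (hj : 1 ≤ j) (hjn : j < n)
    (h : j + 1 ≤ a ∨ a + p < j) : Commute (g j) (rowSym q g a p) :=
  rowSym_commute fun i h1 h2 =>
    S.commute_gg (by omega) (by omega) (by omega) (by omega) (by omega)

theorem rowSym_commute_rowSym {a p b r : ℕ} (h : a + p ≤ b) (hn : b + r ≤ n) :
    Commute (rowSym q g a p) (rowSym q g b r) :=
  rowSym_commute fun j h1 h2 =>
    (S.rowSym_commute_g (by omega) (by omega) (by omega) (by omega)).symm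

theorem rowSym_succ' {a p : ℕ} (h : a + p < n) :
    rowSym q g a (p + 1) = mirW q g a p * rowSym q g a p := by
  induction p with
  | zero => simp
  | succ p ih =>
    have ih := ih (by omega)
    have hc : Commute (g (a + p + 1)) (rowSym q g a p) :=
      S.rowSym_commute_g (by omega) (by omega) (by omega) (by omega)
    calc rowSym q g a (p + 1 + 1)
        = rowSym q g a (p + 1) * (1 + (q : R) • (g (a + p + 1) * shufW q g a p 1)) := by
          rw [rowSym_succ _ (p + 1), shufW_one_right]
      _ = rowSym q g a (p + 1) +
          (q : R) • (mirW q g a p * (rowSym q g a p * g (a + p + 1)) * shufW q g a p 1) := by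
          rw [mul_add, mul_one, mul_smul_comm]
          conv_lhs => rw [ih]
          rw [← ih, ← mul_assoc]
          conv_lhs => rw [ih]
          rw [ih]
          simp only [mul_assoc]
      _ = mirW q g a (p + 1) * rowSym q g a (p + 1) := by
          rw [← hc.eq, mirW_succ, add_mul, one_mul, smul_mul_assoc]
          conv_rhs => rw [rowSym_succ]
          rw [rowSym_succ]
          simp only [mul_assoc]

/-- The row symmetrizer factors through two adjacent shorter ones and their shuffles. -/
theorem rowSym_shuf {a p t : ℕ} (h : a + p + t ≤ n) :
    rowSym q g a p * rowSym q g (a + p) t * shufW q g a p t = rowSym q g a (p + t) := by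
  obtain ⟨m, hm⟩ : ∃ m, p + t = m := ⟨_, rfl⟩
  induction m generalizing p t with
  | zero =>
    obtain rfl : p = 0 := by omega
    obtain rfl : t = 0 := by omega
    simp
  | succ m ih =>
    rcases p with _ | p
    · simp [shufW_zero_left]
    rcases t with _ | t
    · simp [shufW_zero_right]
    have h1 := ih (p := p + 1) (t := t) (by omega) (by omega)
    have h2 := ih (p := p) (t := t + 1) (by omega) (by omega)
    have c1 : Commute (rowSym q g a (p + 1)) (mirW q g (a + (p + 1)) t) :=
      mirW_commute fun j h3 h4 =>
        (S.rowSym_commute_g (by omega) (by omega) (by omega) (by omega)).symm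
    have c2 : Commute (rowSym q g a p) (ascW g (a + p + 1) (a + p + t + 2)) :=
      ascW_commute fun j h3 h4 =>
        (S.rowSym_commute_g (by omega) (by omega) (by omega) (by omega)).symm
    have c3 : ascW g (a + p + 1) (a + p + t + 2) * rowSym q g (a + p) (t + 1) =
        rowSym q g (a + p + 1) (t + 1) * ascW g (a + p + 1) (a + p + t + 2) :=
      rowSym_intertwine fun j h3 h4 => S.g_ascW (by omega) (by omega) (by omega) (by omega)
    have e1 : rowSym q g a (p + 1) * rowSym q g (a + (p + 1)) (t + 1) * shufW q g a (p + 1) t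
        = mirW q g (a + p + 1) t * rowSym q g a (p + t + 1) := by
      rw [S.rowSym_succ' (a := a + (p + 1)) (p := t) (by omega), ← mul_assoc, c1.eq,
        mul_assoc _ _ (rowSym q g (a + (p + 1)) t), mul_assoc, h1,
        show p + 1 + t = p + t + 1 by ring, ← add_assoc]
    have e2 : rowSym q g a (p + 1) * rowSym q g (a + (p + 1)) (t + 1) *
        (ascW g (a + p + 1) (a + p + t + 2) * shufW q g a p (t + 1))
        = mirW q g a p * ascW g (a + p + 1) (a + p + t + 2) * rowSym q g a (p + t + 1) := by
      calc _ = rowSym q g a (p + 1) * (rowSym q g (a + p + 1) (t + 1) *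
            ascW g (a + p + 1) (a + p + t + 2)) * shufW q g a p (t + 1) := by
            simp only [mul_assoc, add_assoc]
        _ = mirW q g a p * (rowSym q g a p * ascW g (a + p + 1) (a + p + t + 2)) *
            (rowSym q g (a + p) (t + 1) * shufW q g a p (t + 1)) := by
            rw [← c3, S.rowSym_succ' (a := a) (p := p) (by omega)]; simp only [mul_assoc]
        _ = _ := by
            rw [c2.eq, show p + t + 1 = p + (t + 1) by ring, ← h2]; simp only [mul_assoc]
    rw [shufW_succ, mul_add, mul_smul_comm, e1, e2, show p + 1 + (t + 1) = p + t + 1 + 1 by ring,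
      S.rowSym_succ' (show a + (p + t + 1) < n by omega), mirW_split, add_mul, smul_mul_assoc]

/-- Modulo the ideal generated by the `e_i`, generators act on row symmetrizers by `q`. -/
theorem rowSym_sym {a p K : ℕ} (hp : a + p ≤ K) (hK : K ≤ n) {s : ℕ} (h1 : a < s)
    (h2 : s < a + p) : rowSym q g a p * (g s - algebraMap R W q) ∈ eIdeal R g e K := by
  induction p generalizing s with
  | zero => omega
  | succ p ih =>
    obtain ⟨K, rfl⟩ : ∃ k, K = k + 1 := ⟨K - 1, by omega⟩
    refine S.ind_sym_row (M := eIdeal R g e (K + 1)) (K := K)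
      (fun x hx b hb => mul_mem_eIdeal_right hb hx) hK (by omega)
      (fun _ x hx => mul_mem_eIdeal_left (rowSym_mem (by omega)) hx)
      (fun s hs1 hs2 => ih (by omega) hs1 hs2) h1 (by omega)

end BMWSys

/-- The product of the row symmetrizers of the first `m` rows of `κ`. -/
def symW (q : Rˣ) (g : ℕ → W) (κ : ℕ → ℕ) (m : ℕ) : W :=
  ascW (fun i => rowSym q g (off κ i) (κ i)) 0 m

theorem symW_congr {κ κ' : ℕ → ℕ} {m : ℕ} (h : ∀ i < m, κ i = κ' i) :
    symW q g κ m = symW q g κ' m := by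
  have ho : ∀ i ≤ m, off κ i = off κ' i := fun i hi =>
    Finset.sum_congr rfl fun j hj => h j (by rw [Finset.mem_range] at hj; omega)
  rw [symW, symW, ascW, ascW]
  congr 1
  refine List.map_congr_left fun k hk => ?_
  rw [List.mem_range] at hk
  rw [h (0 + k) (by omega), ho (0 + k) (by omega)]

theorem symW_mem {κ : ℕ → ℕ} {m k : ℕ} (h : off κ m ≤ k) : symW q g κ m ∈ lvl R g e k := by
  apply Subalgebra.list_prod_mem
  intro x hx
  simp only [List.mem_map, List.mem_range] at hx
  obtain ⟨t, ht, rfl⟩ := hx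
  refine rowSym_mem ?_
  have := off_succ_le κ (show 0 + t < m by omega)
  omega

theorem symW_succ (κ : ℕ → ℕ) (m : ℕ) :
    symW q g κ (m + 1) = symW q g κ m * rowSym q g (off κ m) (κ m) :=
  ascW_succ _ (Nat.zero_le m)

end RowSymmetrizers

section CellIdeal
variable {R W : Type*} [CommRing R] [Ring W] [Algebra R W]
variable {z q : Rˣ} {δ : R} {n : ℕ} {g gi e : ℕ → W}

theorem YoungDiagram.exists_column (r : ℕ) :
    ∃ ν : YoungDiagram, ν.card = r ∧ ∀ i, ν.rowLen i ≤ 1 := by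
  obtain ⟨ν, hν⟩ := YoungDiagram.exists_of_antitone (f := fun i => if i < r then 1 else 0) (m := r)
    (antitone_nat_of_succ_le fun i => by split_ifs <;> omega) (by simp)
  refine ⟨ν, ?_, fun i => ?_⟩
  · rw [YoungDiagram.card_eq_off (m := r) (by simp [hν]), hν, off]
    rw [Finset.sum_congr rfl fun i hi => if_pos (Finset.mem_range.1 hi)]
    simp
  · rw [hν]; dsimp only; split_ifs <;> omega

theorem symW_eq_one {κ : ℕ → ℕ} (h : ∀ i, κ i ≤ 1) (m : ℕ) : symW q g κ m = 1 := by
  apply List.prod_eq_one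
  intro x hx
  simp only [List.mem_map] at hx
  obtain ⟨t, -, rfl⟩ := hx
  rcases (show κ t = 0 ∨ κ t = 1 by have := h t; omega) with h | h <;> simp [h]

theorem symW_of_le {κ : ℕ → ℕ} {m m' : ℕ} (h : m ≤ m') (h0 : ∀ i, m ≤ i → κ i = 0) :
    symW q g κ m' = symW q g κ m := by
  induction m', h using Nat.le_induction with
  | base => rfl
  | succ m' hm ih => rw [symW_succ, ih, h0 m' hm]; simp

theorem symW_commute {κ : ℕ → ℕ} {m : ℕ} {X : W}
    (h : ∀ j, 0 < j → j < off κ m → Commute X (g j)) : Commute X (symW q g κ m) :=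
  ascW_commute fun j _ h2 => rowSym_commute fun s h3 h4 => h s (by omega) (by
    have := off_succ_le κ h2
    omega)

/-- Moving `t` nodes of row `i + 1` to row `i`. -/
def shiftRow (κ : ℕ → ℕ) (i t : ℕ) : ℕ → ℕ :=
  Function.update (Function.update κ i (κ i + t)) (i + 1) (κ (i + 1) - t)

theorem off_shiftRow {κ : ℕ → ℕ} {i t : ℕ} (ht : t ≤ κ (i + 1)) (k : ℕ) :
    off (shiftRow κ i t) k = off κ k + if k = i + 1 then t else 0 := by
  induction k with
  | zero => simp
  | succ k ih =>
    rw [off_succ, off_succ, ih]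
    rcases (show k < i ∨ k = i ∨ k = i + 1 ∨ i + 1 < k by omega) with h | rfl | rfl | h
    · rw [if_neg (by omega), if_neg (by omega), shiftRow, Function.update_of_ne (by omega),
        Function.update_of_ne (by omega)]
      ring
    · rw [if_neg (by omega), if_pos rfl, shiftRow, Function.update_of_ne (by omega),
        Function.update_self]
      ring
    · rw [if_pos rfl, if_neg (by omega), shiftRow, Function.update_self]
      omega
    · rw [if_neg (by omega), if_neg (by omega), shiftRow, Function.update_of_ne (by omega),
        Function.update_of_ne (by omega)]
      ring

/-- The generator of the cell ideal labelled by `(μ, l)`. -/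
def cellW (q : Rˣ) (g e : ℕ → W) (n : ℕ) (x : YoungDiagram × ℕ) : W :=
  symW q g x.1.rowLen (x.1.colLen 0) * stairW e n x.2

/-- The two-sided ideal generated by the cell generators with labels larger than `x`. -/
def cellN (q : Rˣ) (g e : ℕ → W) (n : ℕ) (x : YoungDiagram × ℕ) : Submodule R W :=
  Submodule.span R {y | ∃ (m : WLam n) (a b : W), wGT m.1 x ∧ y = a * cellW q g e n m.1 * b}

theorem mem_cellN {x : YoungDiagram × ℕ} (m : WLam n) (h : wGT m.1 x) (a b : W) :
    a * cellW q g e n m.1 * b ∈ cellN q g e n x :=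
  Submodule.subset_span ⟨m, a, b, h, rfl⟩

theorem mul_cellN_mul {x : YoungDiagram × ℕ} {w : W} (hw : w ∈ cellN q g e n x) (a b : W) :
    a * w * b ∈ cellN q g e n x := by
  have : cellN q g e n x ≤ (cellN q g e n x).comap
      ((LinearMap.mulRight R b).comp (LinearMap.mulLeft R a)) := by
    refine Submodule.span_le.2 ?_
    rintro _ ⟨m, a', b', h, rfl⟩
    refine Submodule.subset_span ⟨m, a * a', b' * b, h, ?_⟩
    change a * (a' * cellW q g e n m.1 * b') * b = _
    simp only [mul_assoc]
  exact this hw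

theorem mul_mem_cellN {x : YoungDiagram × ℕ} {w : W} (hw : w ∈ cellN q g e n x) (a : W) :
    a * w ∈ cellN q g e n x := by simpa using mul_cellN_mul hw a 1

theorem rstable_cellN {x : YoungDiagram × ℕ} {k : ℕ} : RStable g e k (cellN q g e n x) :=
  fun w hw b _ => by simpa using mul_cellN_mul hw 1 b

/-- An anti-involution fixing the generators. -/
structure AntiInv (st : W →ₗ[R] W) (g e : ℕ → W) : Prop where
  mul : ∀ x y, st (x * y) = st y * st x
  inv : ∀ x, st (st x) = x
  map_g : ∀ j, st (g j) = g j
  map_e : ∀ j, st (e j) = e j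

namespace AntiInv
variable {st : W →ₗ[R] W} (I : AntiInv st g e)
include I

theorem one : st 1 = 1 := by
  have := I.mul (st 1) 1
  rw [mul_one, I.inv, mul_one] at this
  exact this.symm

theorem commute {x y : W} (h : Commute x y) : Commute (st x) (st y) := by
  have := congrArg st h.eq
  rw [I.mul, I.mul] at this
  exact this.symm

theorem map_shufW_one (a p : ℕ) : st (shufW q g a p 1) = mirW q g a p := by
  induction p with
  | zero => simpa using I.one
  | succ p ih =>
    rw [shufW_one_right, mirW_succ, map_add, I.one, map_smul, I.mul, ih, I.map_g]

variable (S : BMWSys z q δ n g gi e)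
include S

theorem map_rowSym {a p : ℕ} (h : a + p ≤ n) : st (rowSym q g a p) = rowSym q g a p := by
  induction p with
  | zero => exact I.one
  | succ p ih =>
    rw [rowSym_succ, I.mul, ih (by omega), I.map_shufW_one, ← S.rowSym_succ' (by omega),
      rowSym_succ]

theorem map_symW {κ : ℕ → ℕ} {m : ℕ} (h : off κ m ≤ n) : st (symW q g κ m) = symW q g κ m := by
  induction m with
  | zero => simpa [symW] using I.one
  | succ m ih =>
    rw [off_succ] at h
    rw [symW_succ, I.mul, I.map_rowSym S (by omega), ih (by omega)]
    exact (symW_commute fun j h1 h2 =>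
      (S.rowSym_commute_g (by omega) (by omega) (by omega) (by omega)).symm).eq

theorem map_stairW {k l : ℕ} (h : k ≤ n) (hl : 2 * l ≤ k) :
    st (stairW e k l) = stairW e k l := by
  induction l with
  | zero => simpa using I.one
  | succ l ih =>
    rw [stairW_succ_left e k l hl, I.mul, I.map_e, ih (by omega)]
    exact (stairW_commute (fun j h1 h2 => S.commute_ee (by omega) (by omega) (by omega) (by omega)
      (by omega)) (by omega)).symm

end AntiInv

namespace BMWSys
variable (S : BMWSys z q δ n g gi e)
include S

theorem symW_sym {κ : ℕ → ℕ} {m i j K : ℕ} (hi : i < m) (hm : off κ m ≤ K) (hK : K ≤ n)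
    (h1 : off κ i < j) (h2 : j < off κ i + κ i) :
    symW q g κ m * (g j - algebraMap R W q) ∈ eIdeal R g e K := by
  have ho := off_succ_le κ hi
  have hc : Commute (rowSym q g (off κ i) (κ i))
      (ascW (fun i => rowSym q g (off κ i) (κ i)) (i + 1) m) :=
    ascW_commute fun s h3 h4 => by
      have h5 := off_succ_le κ h3
      have h6 := off_succ_le κ h4
      exact S.rowSym_commute_rowSym (by omega) (by omega)
  rw [symW, ascW_split _ (Nat.zero_le i) hi.le, ascW_head _ hi, hc.eq, ← mul_assoc, mul_assoc]
  refine mul_mem_eIdeal_left (mul_mem (symW_mem (by omega)) ?_) (S.rowSym_sym (by omega) hK h1 h2)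
  apply Subalgebra.list_prod_mem
  intro x hx
  simp only [List.mem_map, List.mem_range] at hx
  obtain ⟨t, ht, rfl⟩ := hx
  have := off_succ_le κ (show i + 1 + t < m by omega)
  exact rowSym_mem (by omega)

theorem symW_shuf {st : W →ₗ[R] W} (I : AntiInv st g e) {κ : ℕ → ℕ} {m i t : ℕ} (hi : i + 1 < m)
    (hm : off κ m ≤ n) (ht : t ≤ κ (i + 1)) :
    ∃ Z, symW q g κ m * shufW q g (off κ i) (κ i) t = Z * symW q g (shiftRow κ i t) m := by
  obtain ⟨s, hs⟩ : ∃ s, κ (i + 1) = t + s := ⟨κ (i + 1) - t, by omega⟩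
  have hi1 := off_succ κ i
  have hi2 := off_succ κ (i + 1)
  have ho := off_succ_le κ hi
  set κ' := shiftRow κ i t with hκ'
  have ho1 : off κ' i = off κ i := by rw [off_shiftRow ht, if_neg (by omega)]; rfl
  have ho2 : off κ' (i + 1) = off κ i + κ i + t := by rw [off_shiftRow ht, if_pos rfl, hi1]
  have hk1 : κ' i = κ i + t := by
    rw [hκ', shiftRow, Function.update_of_ne (by omega), Function.update_self]
  have hk2 : κ' (i + 1) = s := by rw [hκ', shiftRow, Function.update_self]; omega
  set X := fun i => rowSym q g (off κ i) (κ i) with hX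
  set X' := fun i => rowSym q g (off κ' i) (κ' i) with hX'
  set o := off κ i
  set p := κ i
  set A := symW q g κ i with hA
  set T := ascW X (i + 2) m with hT
  set B := shufW q g o p t
  set Z := st (shufW q g (o + p) t s)
  have hAκ' : symW q g κ' i = A := symW_congr fun j hj => by
    rw [hκ', shiftRow, Function.update_of_ne (by omega), Function.update_of_ne (by omega)]
  have hTκ' : ascW X' (i + 2) m = T := by
    rw [hT, ascW, ascW]
    congr 1
    refine List.map_congr_left fun j _ => ?_
    simp only [hX, hX', hκ']
    rw [off_shiftRow ht, if_neg (by omega), shiftRow, Function.update_of_ne (by omega),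
      Function.update_of_ne (by omega)]
    rfl
  have h1 : symW q g κ m = A * rowSym q g o p * rowSym q g (o + p) (t + s) * T := by
    rw [symW, ascW_split _ (Nat.zero_le i) (show i ≤ m by omega), ascW_head _ (show i < m by omega),
      ascW_head _ hi]
    simp only [mul_assoc, hA, hT, hX, symW, ← hi1, ← hs]
    rfl
  have h2 : symW q g κ' m = A * rowSym q g o (p + t) * rowSym q g (o + p + t) s * T := by
    rw [symW, ascW_split _ (Nat.zero_le i) (show i ≤ m by omega), ascW_head _ (show i < m by omega),
      ascW_head _ hi, ← hTκ', ← hAκ', ho1, ho2, hk1, hk2]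
    simp only [mul_assoc, hX', symW]
  have h3 : rowSym q g (o + p) (t + s) =
      Z * rowSym q g (o + p + t) s * rowSym q g (o + p) t := by
    rw [← I.map_rowSym S (show o + p + (t + s) ≤ n by omega), ← S.rowSym_shuf (by omega), I.mul,
      I.mul, I.map_rowSym S (by omega), I.map_rowSym S (by omega), mul_assoc]
  have hZ : ∀ j, 0 < j → j < o + p → Commute Z (g j) := fun j hj1 hj2 => by
    rw [← I.map_g j]
    exact I.commute (shufW_commute fun r h5 h6 =>
      S.commute_gg (by omega) (by omega) (by omega) (by omega) (by omega)).symm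
  have c1 : Commute Z (rowSym q g o p) := rowSym_commute fun j h5 h6 => hZ j (by omega) h6
  have c2 : Commute Z A := symW_commute fun j h5 h6 => hZ j h5 (by omega)
  have c3 : Commute B T := ascW_commute fun j h5 h6 => rowSym_commute fun r h7 h8 => by
    have := off_succ_le κ (show i + 1 < j by omega)
    have := off_succ_le κ h6
    exact (shufW_commute fun r' h9 h10 =>
      S.commute_gg (by omega) (by omega) (by omega) (by omega) (by omega)).symm
  have c4 : Commute (rowSym q g o p) (rowSym q g (o + p + t) s) :=
    S.rowSym_commute_rowSym (by omega) (by omega)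
  have c5 : Commute (rowSym q g o (p + t)) (rowSym q g (o + p + t) s) :=
    S.rowSym_commute_rowSym (by omega) (by omega)
  refine ⟨Z, ?_⟩
  calc symW q g κ m * B
      = A * (rowSym q g o p * Z) * rowSym q g (o + p + t) s * rowSym q g (o + p) t * (T * B) := by
        rw [h1, h3]; simp only [mul_assoc]
    _ = (A * Z) * (rowSym q g o p * rowSym q g (o + p + t) s) *
        rowSym q g (o + p) t * (B * T) := by
        rw [← c1.eq, c3.eq]; simp only [mul_assoc]
    _ = Z * (A * (rowSym q g (o + p + t) s * (rowSym q g o p * rowSym q g (o + p) t * B)) * T) := by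
        rw [c4.eq, ← c2.eq]; simp only [mul_assoc]
    _ = Z * symW q g κ' m := by
        rw [S.rowSym_shuf (by omega), ← c5.eq, h2]; simp only [mul_assoc]

variable {μ : YoungDiagram} {l : ℕ}

theorem eIdeal_stairW_mem {K : ℕ} (hs : K + 2 * l = n) (hK : 2 ≤ K) {w : W}
    (hw : w ∈ eIdeal R g e K) : w * stairW e n l ∈ cellN q g e n (μ, l) := by
  obtain ⟨ν, hν, hν1⟩ := YoungDiagram.exists_column (K - 2)
  have : eIdeal R g e K ≤ (cellN q g e n (μ, l)).comap (LinearMap.mulRight R (stairW e n l)) := by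
    refine Submodule.span_le.2 ?_
    rintro _ ⟨x, -, y, hy, rfl⟩
    have hc := S.commute_stairW_lvl (i := n) (l := l) (k := K) (by omega) le_rfl (by omega) hy
    have h1 : wGT (ν, l + 1) (μ, l) := Or.inl (Nat.lt_succ_self l)
    have h2 := mem_cellN (R := R) (q := q) (g := g) (e := e)
      (⟨(ν, l + 1), by dsimp only; omega, by dsimp only; omega⟩ : WLam n) h1 x y
    change x * e (K - 1) * y * stairW e n l ∈ cellN q g e n (μ, l)
    rwa [mul_assoc, ← hc.eq, ← mul_assoc, mul_assoc x, show K - 1 = n - 2 * l - 1 by omega,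
      ← stairW_succ_left e n l (by omega), ← one_mul (stairW e n (l + 1)),
      ← symW_eq_one (q := q) (g := g) hν1 (ν.colLen 0)]
  exact this hw

variable {K : ℕ} (hs : K + 2 * l = n)
include hs

theorem symW_stairW_sym {κ : ℕ → ℕ} {m i j : ℕ} (hi : i < m) (hm : off κ m ≤ K)
    (h1 : off κ i < j) (h2 : j < off κ i + κ i) :
    symW q g κ m * stairW e n l * (g j - algebraMap R W q) ∈ cellN q g e n (μ, l) := by
  have ho := off_succ_le κ hi
  have hg : g j - algebraMap R W q ∈ lvl R g e K :=
    sub_mem (g_mem_lvl (by omega) (by omega)) (Subalgebra.algebraMap_mem _ _)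
  have hc := S.commute_stairW_lvl (i := n) (l := l) (k := K) (by omega) le_rfl (by omega) hg
  rw [mul_assoc, hc.eq, ← mul_assoc]
  exact S.eIdeal_stairW_mem hs (by omega) (S.symW_sym hi hm (by omega) h1 h2)

theorem symW_stairW_shuf {st : W →ₗ[R] W} (I : AntiInv st g e) {κ : ℕ → ℕ} {m i t : ℕ}
    (hi : i + 1 < m) (hm : off κ m ≤ K) (ht : t ≤ κ (i + 1))
    (h : symW q g (shiftRow κ i t) m * stairW e n l ∈ cellN q g e n (μ, l)) :
    symW q g κ m * stairW e n l * shufW q g (off κ i) (κ i) t ∈ cellN q g e n (μ, l) := by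
  have ho := off_succ_le κ hi
  have ho' := off_succ κ i
  have hc := S.commute_stairW_lvl (i := n) (l := l) (k := K) (by omega) le_rfl (by omega)
    (shufW_mem (q := q) (a := off κ i) (p := κ i) (t := t) (by omega))
  obtain ⟨Z, hZ⟩ := S.symW_shuf I hi (by omega) ht
  rw [mul_assoc, hc.eq, ← mul_assoc, hZ, mul_assoc]
  exact mul_mem_cellN h Z

/-- The generators attached to compositions dominating `μ` lie in the cell ideal. -/
theorem symW_mem_cellN {st : W →ₗ[R] W} (I : AntiInv st g e) {κ : ℕ → ℕ} {m : ℕ}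
    (h0 : ∀ i, m ≤ i → κ i = 0) (hm : off κ m = K)
    (hd : ∀ k, off μ.rowLen k ≤ off κ k) (hne : μ.rowLen ≠ κ) :
    symW q g κ m * stairW e n l ∈ cellN q g e n (μ, l) := by
  obtain ⟨d, hd'⟩ : ∃ d, (m + 1) * K - ∑ k ∈ Finset.range (m + 1), off κ k = d := ⟨_, rfl⟩
  induction d using Nat.strong_induction_on generalizing κ with
  | _ d ih =>
  by_cases hanti : ∀ i, κ (i + 1) ≤ κ i
  · obtain ⟨ν, rfl⟩ := YoungDiagram.exists_of_antitone (antitone_nat_of_succ_le hanti)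
      (h0 m le_rfl)
    have hcol : ν.colLen 0 ≤ m := by
      by_contra! hc
      have := YoungDiagram.rowLen_pos_iff.2 hc
      have := h0 m le_rfl
      omega
    have hcard := YoungDiagram.card_eq_off (h0 m le_rfl)
    rw [symW_of_le hcol fun i hi => by
      have := (YoungDiagram.rowLen_pos_iff (μ := ν) (i := i)).not.2 (by omega)
      omega]
    have h1 : wGT (ν, l) (μ, l) :=
      Or.inr ⟨rfl, hd, fun h => hne (congrArg YoungDiagram.rowLen h).symm⟩
    have h2 := mem_cellN (R := R) (q := q) (g := g) (e := e)
      (⟨(ν, l), by dsimp only; omega, by dsimp only; omega⟩ : WLam n) h1 1 1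
    rwa [one_mul, mul_one] at h2
  · push Not at hanti
    obtain ⟨i, hi⟩ := hanti
    have him : i + 1 < m := by
      by_contra! hc
      have := h0 (i + 1) hc
      omega
    have ho := off_succ_le κ him
    have ho' := off_succ κ i
    refine S.vanish (rstable_cellN (k := n)) le_rfl hi (by omega)
      (fun j h1 h2 => S.symW_stairW_sym hs (i := i) (by omega) hm.le h1 h2)
      (fun j h1 h2 => S.symW_stairW_sym hs (i := i + 1) (by omega) hm.le (by omega) (by omega))
      (fun t h1 h2 => S.symW_stairW_shuf hs I him hm.le h2 ?_)
    have hoff := off_shiftRow (κ := κ) h2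
    have hlt : ∑ k ∈ Finset.range (m + 1), off κ k <
        ∑ k ∈ Finset.range (m + 1), off (shiftRow κ i t) k :=
      Finset.sum_lt_sum (fun k _ => by rw [hoff]; omega)
        ⟨i + 1, Finset.mem_range.2 (by omega), by rw [hoff, if_pos rfl]; omega⟩
    have hm' : off (shiftRow κ i t) m = K := by rw [hoff, if_neg (by omega), hm]; rfl
    have hle : ∑ k ∈ Finset.range (m + 1), off (shiftRow κ i t) k ≤ (m + 1) * K := by
      calc _ ≤ ∑ k ∈ Finset.range (m + 1), K := Finset.sum_le_sum fun k hk => by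
            rw [← hm']; exact off_mono _ (by rw [Finset.mem_range] at hk; omega)
        _ = _ := by simp
    refine ih _ (by omega) (fun j hj => ?_) hm' (fun k => ?_) (fun h => ?_) rfl
    · rw [shiftRow, Function.update_of_ne (by omega), Function.update_of_ne (by omega), h0 j hj]
    · rw [hoff]
      have := hd k
      omega
    · have h3 := hd (i + 1)
      rw [h, hoff, if_pos rfl] at h3
      omega

omit hs in
theorem cell_soft {st : W →ₗ[R] W} (I : AntiInv st g e) (hs : μ.card + 2 * l = n) :
    Soft q g e (cellN q g e n (μ, l)) μ.rowLen μ.card n l (cellW q g e n (μ, l)) where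
  size := hs
  tot := μ.off_le_card
  stair := ⟨_, rfl⟩
  sym i j h1 h2 := by
    have hi : i < μ.colLen 0 := YoungDiagram.rowLen_pos_iff.1 (by omega)
    exact S.symW_stairW_sym hs hi (μ.off_le_card _) h1 h2
  kill hK x hx := by
    have hxe : x * e (μ.card - 1) ∈ lvl R g e μ.card :=
      mul_mem hx (e_mem_lvl (by omega) (by omega))
    have hc := S.commute_stairW_lvl (i := n) (l := l) (by omega) le_rfl (by omega) hxe
    rw [cellW, mul_assoc, mul_assoc, hc.eq, ← mul_assoc]
    refine S.eIdeal_stairW_mem hs hK (mul_mem_eIdeal_left (symW_mem (μ.off_le_card _)) ?_)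
    exact mul_mem_eIdeal_left hx (S.e_mem_eIdeal (by omega) (by omega) (by omega))
  garnir i t h1 h2 := by
    have hi : i + 1 < μ.colLen 0 := YoungDiagram.rowLen_pos_iff.1 (by omega)
    have hm : off μ.rowLen (μ.colLen 0) = μ.card :=
      (YoungDiagram.card_eq_off μ.rowLen_colLen).symm
    have hoff := off_shiftRow (κ := μ.rowLen) h2
    have hz : ∀ j, μ.colLen 0 ≤ j → shiftRow μ.rowLen i t j = 0 := fun j hj => by
      have := (YoungDiagram.rowLen_pos_iff (μ := μ) (i := j)).not.2 (by omega)
      rw [shiftRow, Function.update_of_ne (by omega), Function.update_of_ne (by omega)]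
      omega
    refine S.symW_stairW_shuf hs I hi hm.le h2 (S.symW_mem_cellN hs I hz ?_
      (fun k => ?_) (fun h => ?_))
    · change off (shiftRow μ.rowLen i t) (μ.colLen 0) = μ.card
      rw [hoff, if_neg (by omega), hm]; rfl
    · rw [hoff]; omega
    · have h3 := hoff (i + 1)
      rw [← h, if_pos rfl] at h3
      omega

end BMWSys
end CellIdeal

section Labels

theorem YoungDiagram.mem_cells_lt {μ : YoungDiagram} {c : ℕ × ℕ} (h : c ∈ μ.cells) :
    c.1 < μ.card ∧ c.2 < μ.card := by
  have h1 : (Finset.range (c.1 + 1)).image (fun i => (i, c.2)) ⊆ μ.cells := by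
    intro x hx
    simp only [Finset.mem_image, Finset.mem_range] at hx
    obtain ⟨i, hi, rfl⟩ := hx
    exact μ.up_left_mem (by omega) le_rfl h
  have h2 : (Finset.range (c.2 + 1)).image (fun i => (c.1, i)) ⊆ μ.cells := by
    intro x hx
    simp only [Finset.mem_image, Finset.mem_range] at hx
    obtain ⟨i, hi, rfl⟩ := hx
    exact μ.up_left_mem le_rfl (by omega) h
  have h3 := Finset.card_le_card h1
  have h4 := Finset.card_le_card h2
  rw [Finset.card_image_of_injective _ fun a b h => (Prod.ext_iff.1 h).1, Finset.card_range] at h3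
  rw [Finset.card_image_of_injective _ fun a b h => (Prod.ext_iff.1 h).2, Finset.card_range] at h4
  exact ⟨h3, h4⟩

theorem YoungDiagram.finite_card_le (n : ℕ) : {μ : YoungDiagram | μ.card ≤ n}.Finite := by
  refine Set.Finite.of_finite_image (f := YoungDiagram.cells)
    (((Finset.range n ×ˢ Finset.range n).powerset.finite_toSet).subset ?_)
    fun a _ b _ h => YoungDiagram.ext h
  rintro _ ⟨μ, hμ, rfl⟩
  rw [Finset.mem_coe, Finset.mem_powerset]
  intro c hc
  have h := YoungDiagram.mem_cells_lt hc
  have h' : μ.card ≤ n := hμ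
  rw [Finset.mem_product, Finset.mem_range, Finset.mem_range]
  omega

instance finite_WLam (n : ℕ) : Finite (WLam n) :=
  Set.Finite.to_subtype (((YoungDiagram.finite_card_le n).prod (Set.finite_le_nat n)).subset
    fun x hx => ⟨show x.1.card ≤ n by have := hx.2; omega, show x.2 ≤ n by have := hx.1; omega⟩)

theorem Dominates.antisymm {μ ν : YoungDiagram} (h : Dominates μ ν) (h' : Dominates ν μ) :
    μ = ν := by
  refine YoungDiagram.ext_rowLen (funext fun i => ?_)
  have h1 : ∀ k, off μ.rowLen k = off ν.rowLen k := fun k => le_antisymm (h' k) (h k)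
  have h2 := h1 (i + 1)
  rw [off_succ, off_succ, h1 i] at h2
  omega

theorem wGT_trans {a b c : YoungDiagram × ℕ} (h : wGT a b) (h' : wGT b c) : wGT a c := by
  rcases h with h | ⟨h1, h2, h3⟩ <;> rcases h' with h' | ⟨h1', h2', h3'⟩
  · exact Or.inl (h'.trans h)
  · exact Or.inl (h1' ▸ h)
  · exact Or.inl (h1 ▸ h')
  · refine Or.inr ⟨h1.trans h1', fun k => (h2' k).trans (h2 k), fun h4 => h3' ?_⟩
    exact Dominates.antisymm h2' (h4 ▸ h2)

theorem wGT_irrefl (a : YoungDiagram × ℕ) : ¬ wGT a a := by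
  rintro (h | ⟨-, -, h⟩)
  · exact lt_irrefl _ h
  · exact h rfl

theorem wGT_wf (n : ℕ) : WellFounded fun a b : WLam n => wGT a.1 b.1 :=
  haveI : IsTrans (WLam n) fun a b => wGT a.1 b.1 := ⟨fun _ _ _ => wGT_trans⟩
  haveI : Std.Irrefl fun a b : WLam n => wGT a.1 b.1 := ⟨fun a => wGT_irrefl a.1⟩
  Finite.wellFounded_of_trans_of_irrefl _

end Labels

section Spanning
variable {R W : Type*} [CommRing R] [Ring W] [Algebra R W]
variable {z q : Rˣ} {δ : R} {n : ℕ} {g gi e : ℕ → W}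

/-- The candidate basis elements with labels satisfying `P`. -/
def cellSet (st : W →ₗ[R] W) (q : Rˣ) (g e : ℕ → W) (n : ℕ) (P : YoungDiagram × ℕ → Prop) :
    Set W :=
  {y | ∃ (m : WLam n) (u w : W), P m.1 ∧ IsD q g e n m.1 u ∧ IsD q g e n m.1 w ∧
    y = st u * cellW q g e n m.1 * w}

namespace BMWSys
variable (S : BMWSys z q δ n g gi e) {st : W →ₗ[R] W} (I : AntiInv st g e)
include S I

theorem map_cellW (x : WLam n) : st (cellW q g e n x.1) = cellW q g e n x.1 := by
  obtain ⟨⟨μ, l⟩, h1, h2⟩ := x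
  dsimp only at h1 h2
  have hm : off μ.rowLen (μ.colLen 0) ≤ μ.card := μ.off_le_card _
  change st (symW q g μ.rowLen (μ.colLen 0) * stairW e n l) =
    symW q g μ.rowLen (μ.colLen 0) * stairW e n l
  rw [I.mul, I.map_symW S (by omega), I.map_stairW S le_rfl h1]
  exact (S.commute_stairW_lvl (k := μ.card) h1 le_rfl (by omega) (symW_mem hm)).eq

theorem map_cellN {x : YoungDiagram × ℕ} {w : W} (hw : w ∈ cellN q g e n x) :
    st w ∈ cellN q g e n x := by
  have : cellN q g e n x ≤ (cellN q g e n x).comap st := by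
    refine Submodule.span_le.2 ?_
    rintro _ ⟨m, a, b, h, rfl⟩
    change st (a * cellW q g e n m.1 * b) ∈ cellN q g e n x
    rw [I.mul, I.mul, S.map_cellW I, ← mul_assoc]
    exact mem_cellN m h _ _
  exact this hw

variable (htop : ∀ w, w ∈ lvl R g e n)
include htop

theorem cellW_mul_mem (x : WLam n) (a : W) :
    cellW q g e n x.1 * a ∈ dSpan q g e n x.1 (cellW q g e n x.1) (cellN q g e n x.1) :=
  have hs : x.1.1.card + 2 * x.1.2 = n := by
    have h1 := x.2.1
    have h2 := x.2.2
    revert h1 h2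
    generalize x.1.1.card = c
    generalize x.1.2 = d
    omega
  Soft.mem_dSpan S le_rfl (S.cell_soft I hs) rstable_cellN (htop a)

theorem mul_cellW_mul_mem (x : WLam n) (a b : W) :
    a * cellW q g e n x.1 * b ∈
      Submodule.span R (cellSet st q g e n (· = x.1)) ⊔ cellN q g e n x.1 := by
  set U := Submodule.span R (cellSet st q g e n (· = x.1)) ⊔ cellN q g e n x.1
  have h1 : dSpan q g e n x.1 (cellW q g e n x.1) (cellN q g e n x.1) ≤
      U.comap (LinearMap.mulLeft R a) := by
    refine sup_le (Submodule.span_le.2 ?_) fun w hw => Submodule.mem_sup_right (mul_mem_cellN hw a)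
    rintro _ ⟨w, hw, rfl⟩
    have h2 : dSpan q g e n x.1 (cellW q g e n x.1) (cellN q g e n x.1) ≤
        U.comap ((LinearMap.mulRight R w).comp st) := by
      refine sup_le (Submodule.span_le.2 ?_) fun w' hw' => Submodule.mem_sup_right ?_
      · rintro _ ⟨u, hu, rfl⟩
        refine Submodule.mem_sup_left (Submodule.subset_span ⟨x, u, w, rfl, hu, hw, ?_⟩)
        change st (cellW q g e n x.1 * u) * w = _
        rw [I.mul, S.map_cellW I]
      · simpa using mul_cellN_mul (S.map_cellN I hw') 1 w
    have h3 := h2 (S.cellW_mul_mem I htop x (st a))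
    change st (cellW q g e n x.1 * st a) * w ∈ U at h3
    rw [I.mul, I.inv, S.map_cellW I, mul_assoc] at h3
    exact h3
  rw [mul_assoc]
  exact h1 (S.cellW_mul_mem I htop x b)

theorem cellN_le (x : WLam n) :
    cellN q g e n x.1 ≤ Submodule.span R (cellSet st q g e n fun m => wGT m x.1) := by
  induction x using (wGT_wf n).induction with
  | _ x ih =>
  refine Submodule.span_le.2 ?_
  rintro _ ⟨m, a, b, h, rfl⟩
  refine (sup_le (Submodule.span_mono ?_) ((ih m h).trans (Submodule.span_mono ?_)))
    (S.mul_cellW_mul_mem I htop m a b)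
  · rintro _ ⟨m', u, w, hm, h1, h2, rfl⟩
    exact ⟨m', u, w, hm ▸ h, h1, h2, rfl⟩
  · rintro _ ⟨m', u, w, hm, h1, h2, rfl⟩
    exact ⟨m', u, w, wGT_trans hm h, h1, h2, rfl⟩

theorem span_cellSet : Submodule.span R (cellSet st q g e n fun _ => True) = ⊤ := by
  refine eq_top_iff.2 fun a _ => ?_
  obtain ⟨ν, hν, hν1⟩ := YoungDiagram.exists_column n
  let x : WLam n := ⟨(ν, 0), by simp, by simpa using hν⟩
  have h := S.mul_cellW_mul_mem I htop x a 1
  have hx : cellW q g e n x.1 = 1 := by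
    rw [cellW, stairW_zero, mul_one]
    exact symW_eq_one hν1 _
  rw [hx, mul_one, mul_one] at h
  refine (sup_le (Submodule.span_mono ?_) ((S.cellN_le I htop x).trans (Submodule.span_mono ?_))) h
  · rintro _ ⟨m', u, w, -, h1, h2, rfl⟩
    exact ⟨m', u, w, trivial, h1, h2, rfl⟩
  · rintro _ ⟨m', u, w, -, h1, h2, rfl⟩
    exact ⟨m', u, w, trivial, h1, h2, rfl⟩

end BMWSys
end Spanning

section Paths
variable {R W : Type*} [CommRing R] [Ring W] [Algebra R W]
variable {q : Rˣ} {g e : ℕ → W}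

/-- The path element of a path. -/
def dPathW (q : Rˣ) (g e : ℕ → W) (i : ℕ) {x : YoungDiagram × ℕ} (t : WPath i x) : W :=
  ((List.ofFn (fun k : Fin i =>
      dStepW q g e k.val (t.1 k.castSucc) (t.1 k.succ))).reverse).prod

/-- Extending a path by one edge. -/
def WPath.snoc {k : ℕ} {a b : YoungDiagram × ℕ} (t : WPath k a) (h : WEdge a b) :
    WPath (k + 1) b :=
  ⟨Fin.snoc (α := fun _ => YoungDiagram × ℕ) t.1 b, by
    have := Fin.snoc_castSucc (α := fun _ => YoungDiagram × ℕ) b t.1 0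
    exact this.trans t.2.1, by rw [Fin.snoc_last], fun j => by
    induction j using Fin.lastCases with
    | last => rw [Fin.snoc_castSucc, Fin.succ_last, Fin.snoc_last, t.2.2.1]; exact h
    | cast j => rw [Fin.snoc_castSucc, Fin.succ_castSucc, Fin.snoc_castSucc]; exact t.2.2.2 j⟩

/-- Removing the last edge of a path. -/
def WPath.dropLast {k : ℕ} {b : YoungDiagram × ℕ} (t : WPath (k + 1) b) :
    WPath k (t.1 (Fin.last k).castSucc) :=
  ⟨fun j => t.1 j.castSucc, t.2.1, rfl, fun j => by
    have := t.2.2.2 j.castSucc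
    rwa [Fin.succ_castSucc] at this⟩

theorem WPath.edge {k : ℕ} {b : YoungDiagram × ℕ} (t : WPath (k + 1) b) :
    WEdge (t.1 (Fin.last k).castSucc) b := by
  have := t.2.2.2 (Fin.last k)
  rwa [Fin.succ_last, t.2.2.1] at this

theorem WPath.snoc_dropLast {k : ℕ} {b : YoungDiagram × ℕ} (t : WPath (k + 1) b) :
    t.dropLast.snoc t.edge = t := by
  refine Subtype.ext (funext fun j => ?_)
  change Fin.snoc (α := fun _ => YoungDiagram × ℕ) t.dropLast.1 b j = t.1 j
  induction j using Fin.lastCases with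
  | last => rw [Fin.snoc_last, t.2.2.1]
  | cast j => rw [Fin.snoc_castSucc]; rfl

theorem dPathW_snoc {k : ℕ} {a b : YoungDiagram × ℕ} (t : WPath k a) (h : WEdge a b) :
    dPathW q g e (k + 1) (t.snoc h) = dStepW q g e k a b * dPathW q g e k t := by
  have h1 : ∀ j : Fin (k + 1), (t.snoc h).1 j.castSucc = t.1 j := fun j =>
    Fin.snoc_castSucc (α := fun _ => YoungDiagram × ℕ) _ _ _
  have h2 : (t.snoc h).1 (Fin.last (k + 1)) = b := (t.snoc h).2.2.1
  rw [dPathW, List.ofFn_succ', List.concat_eq_append, List.reverse_append, List.reverse_singleton,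
    List.singleton_append, List.prod_cons, dPathW]
  congr 1
  · rw [Fin.succ_last, h1, h2, t.2.2.1]; rfl
  · congr 3
    funext j
    rw [h1, Fin.succ_castSucc, h1]
    rfl

theorem isD_iff {i : ℕ} {x : YoungDiagram × ℕ} {w : W} :
    IsD q g e i x w ↔ ∃ t : WPath i x, w = dPathW q g e i t := by
  constructor
  · intro h
    induction h with
    | nil => exact ⟨⟨fun _ => (⊥, 0), rfl, rfl, fun k => k.elim0⟩, by simp [dPathW]⟩
    | cons h hab ih =>
      obtain ⟨t, rfl⟩ := ih
      exact ⟨t.snoc hab, (dPathW_snoc t hab).symm⟩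
  · rintro ⟨t, rfl⟩
    induction i generalizing x with
    | zero =>
      have : x = (⊥, 0) := t.2.2.1.symm.trans t.2.1
      subst this
      simpa [dPathW] using IsD.nil
    | succ i ih =>
      rw [← t.snoc_dropLast, dPathW_snoc]
      exact .cons (ih _) t.edge

end Paths

section Inversions
variable {n : ℕ}

theorem swN_of {j : ℕ} (h1 : 1 ≤ j) (h2 : j < n) :
    swN n j = Equiv.swap ⟨j - 1, by omega⟩ ⟨j, h2⟩ := dif_pos ⟨h1, h2⟩

theorem invCount_swN_mul {v : Equiv.Perm (Fin n)} {j : ℕ} (h1 : 1 ≤ j) (h2 : j < n)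
    {a b : Fin n} (hab : a < b) (ha : (v a : ℕ) = j - 1) (hb : (v b : ℕ) = j) :
    invCount (swN n j * v) = invCount v + 1 := by
  rw [invCount, invCount, ← Finset.card_insert_of_notMem (a := (a, b))]
  · congr 1
    ext ⟨x, y⟩
    simp only [Finset.mem_filter, Finset.mem_univ, true_and, Finset.mem_insert, Prod.mk.injEq]
    rw [swN_of h1 h2, Equiv.Perm.mul_apply, Equiv.Perm.mul_apply, Equiv.swap_apply_def,
      Equiv.swap_apply_def]
    have e1 : v x = v a ↔ x = a := v.injective.eq_iff
    have e2 : v x = v b ↔ x = b := v.injective.eq_iff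
    have e3 : v y = v a ↔ y = a := v.injective.eq_iff
    have e4 : v y = v b ↔ y = b := v.injective.eq_iff
    have e5 : v x = v y ↔ x = y := v.injective.eq_iff
    simp only [Fin.ext_iff, Fin.lt_def, ha, hb] at *
    split_ifs <;> (try dsimp only) <;> omega
  · simp only [Finset.mem_filter, Finset.mem_univ, true_and, Fin.lt_def, ha, hb, not_and]
    omega

/-- The cycle `k ↦ k - r`, as a product of adjacent transpositions. -/
def cyc (n k : ℕ) : ℕ → Equiv.Perm (Fin n)
  | 0 => 1
  | r + 1 => swN n (k - r) * cyc n k r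

theorem cyc_apply {k : ℕ} (hk : k < n) {r : ℕ} (hr : r ≤ k) :
    (cyc n k r ⟨k, hk⟩ : ℕ) = k - r := by
  induction r with
  | zero => rfl
  | succ r ih =>
    have h : cyc n k r ⟨k, hk⟩ = ⟨k - r, by omega⟩ := Fin.ext (ih (by omega))
    rw [cyc, Equiv.Perm.mul_apply, swN_of (by omega) (by omega), h, Equiv.swap_apply_right]
    dsimp only; omega

theorem cyc_apply_of_lt {k r : ℕ} (hr : r ≤ k) {x : Fin n} (hx : k < x) :
    cyc n k r x = x := by
  induction r with
  | zero => rfl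
  | succ r ih =>
    rw [cyc, Equiv.Perm.mul_apply, swN_of (by omega) (by omega), ih (by omega),
      Equiv.swap_apply_of_ne_of_ne] <;> simp only [ne_eq, Fin.ext_iff] <;> omega

variable {ρ : ℕ → ℕ}

theorem cyc_row {k o : ℕ} (hk : k < n) (hρ : ∀ x, o ≤ x → x ≤ k → ρ x = ρ k) {r : ℕ}
    (hr : o + r ≤ k) (x : Fin n) : ρ (cyc n k r x) = ρ x := by
  induction r with
  | zero => rfl
  | succ r ih =>
    rw [cyc, Equiv.Perm.mul_apply, swN_of (by omega) (by omega), ← ih (by omega),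
      Equiv.swap_apply_def]
    have h1 := hρ (k - r) (by omega) (by omega)
    have h2 := hρ (k - r - 1) (by omega) (by omega)
    split_ifs with h h
    · rw [h]; dsimp only; rw [h1, h2]
    · rw [h]; dsimp only; rw [h1, h2]
    · rfl

/-- Permutations preserving `ρ` and fixing all entries `≥ k`. -/
def rowStabTo (n : ℕ) (ρ : ℕ → ℕ) (k : ℕ) : Finset (Equiv.Perm (Fin n)) :=
  Finset.univ.filter fun v => ∀ x : Fin n, ρ (v x) = ρ x ∧ (k ≤ x → v x = x)

theorem mem_rowStabTo {k : ℕ} {v : Equiv.Perm (Fin n)} :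
    v ∈ rowStabTo n ρ k ↔ ∀ x : Fin n, ρ (v x) = ρ x ∧ (k ≤ x → v x = x) := by
  simp [rowStabTo]

theorem invCount_cyc_mul {k : ℕ} (hk : k < n) {r : ℕ} (hr : r + 1 ≤ k)
    {v : Equiv.Perm (Fin n)} (hv : v ∈ rowStabTo n ρ k) :
    invCount (swN n (k - r) * (cyc n k r * v)) = invCount (cyc n k r * v) + 1 := by
  set u := cyc n k r * v with hu
  have hf := fun x => (mem_rowStabTo.1 hv x).2
  have h1 : (u ⟨k, hk⟩ : ℕ) = k - r := by
    rw [hu, Equiv.Perm.mul_apply, hf _ le_rfl, cyc_apply hk (by omega)]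
  obtain ⟨a, ha⟩ := u.surjective ⟨k - r - 1, by omega⟩
  have ha' : (u a : ℕ) = k - r - 1 := by rw [ha]
  refine invCount_swN_mul (a := a) (b := ⟨k, hk⟩) (by omega) (by omega) ?_ ha' h1
  by_contra hc
  rw [Fin.lt_def, not_lt] at hc
  rcases hc.eq_or_lt with h | h
  · have h3 : a = ⟨k, hk⟩ := Fin.ext h.symm
    rw [h3] at ha'
    omega
  · rw [hu, Equiv.Perm.mul_apply, hf a (le_of_lt h), cyc_apply_of_lt (k := k) (by omega) h] at ha'
    dsimp only at h
    omega

end Inversions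

section RowStabSum
variable {R W : Type*} [CommRing R] [Ring W] [Algebra R W]
variable {q : Rˣ} {n : ℕ} {g : ℕ → W} {ρ : ℕ → ℕ} {gw : Equiv.Perm (Fin n) → W}

theorem gw_cyc_mul
    (hmul : ∀ (v : Equiv.Perm (Fin n)) (j : ℕ), 1 ≤ j → j < n →
      invCount (swN n j * v) = invCount v + 1 → gw (swN n j * v) = gw v * g j)
    {k : ℕ} (hk : k < n) {r : ℕ} (hr : r ≤ k) {v : Equiv.Perm (Fin n)}
    (hv : v ∈ rowStabTo n ρ k) :
    gw (cyc n k r * v) = gw v * descW g (k + 1) (k + 1 - r) ∧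
      invCount (cyc n k r * v) = invCount v + r := by
  induction r with
  | zero => simp [cyc]
  | succ r ih =>
    have h := invCount_cyc_mul hk hr hv
    obtain ⟨h1, h2⟩ := ih (by omega)
    rw [cyc, mul_assoc, hmul _ _ (by omega) (by omega) h, h1, h, h2, mul_assoc]
    refine ⟨?_, by omega⟩
    rw [descW_split g (show k + 1 - (r + 1) ≤ k + 1 - r by omega) (by omega),
      show k + 1 - (r + 1) = k - r by omega, show k + 1 - r = k - r + 1 by omega, descW_single]

theorem sum_rowStabTo_succ
    (hmul : ∀ (v : Equiv.Perm (Fin n)) (j : ℕ), 1 ≤ j → j < n →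
      invCount (swN n j * v) = invCount v + 1 → gw (swN n j * v) = gw v * g j)
    {o p : ℕ} (hk : o + p < n) (hρ : ∀ x, x ≤ o + p → (ρ x = ρ (o + p) ↔ o ≤ x)) :
    ∑ v ∈ rowStabTo n ρ (o + p + 1), ((q : R) ^ invCount v) • gw v =
      (∑ v ∈ rowStabTo n ρ (o + p), ((q : R) ^ invCount v) • gw v) * shufW q g o p 1 := by
  rw [shufW_one_eq_sum, Finset.mul_sum]
  rw [← Finset.sum_fiberwise_of_maps_to (t := Finset.range (p + 1))
    (g := fun v => o + p - (v ⟨o + p, hk⟩ : ℕ))]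
  · refine Finset.sum_congr rfl fun r hr => ?_
    rw [Finset.mem_range] at hr
    rw [Finset.sum_mul]
    symm
    have hc := fun x => cyc_row (n := n) (ρ := ρ) hk (fun x h1 h2 => (hρ x h2).2 h1)
      (show o + r ≤ o + p by omega) x
    refine Finset.sum_bij' (fun v _ => cyc n (o + p) r * v) (fun v _ => (cyc n (o + p) r)⁻¹ * v)
      (fun v hv => ?_) (fun v hv => ?_) (fun v _ => by simp) (fun v _ => by simp) (fun v hv => ?_)
    · have hv' := mem_rowStabTo.1 hv
      rw [Finset.mem_filter, mem_rowStabTo]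
      refine ⟨fun x => ⟨?_, fun hx => ?_⟩, ?_⟩
      · rw [Equiv.Perm.mul_apply, hc, (hv' x).1]
      · rw [Equiv.Perm.mul_apply, (hv' x).2 (by omega), cyc_apply_of_lt (by omega) (by omega)]
      · rw [Equiv.Perm.mul_apply, (hv' ⟨o + p, hk⟩).2 le_rfl, cyc_apply hk (by omega)]
        omega
    · rw [Finset.mem_filter, mem_rowStabTo] at hv
      obtain ⟨hv', hvr⟩ := hv
      have h0 : v ⟨o + p, hk⟩ = cyc n (o + p) r ⟨o + p, hk⟩ := Fin.ext (by
        rw [cyc_apply hk (by omega)]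
        have h1 := (hv' ⟨o + p, hk⟩).1
        have h2 : (v ⟨o + p, hk⟩ : ℕ) ≤ o + p := by
          by_contra! h
          have := v.injective ((hv' (v ⟨o + p, hk⟩)).2 h)
          rw [this] at h
          exact lt_irrefl _ h
        omega)
      rw [mem_rowStabTo]
      refine fun x => ⟨?_, fun hx => ?_⟩
      · rw [← (hv' x).1, ← hc, ← Equiv.Perm.mul_apply, mul_inv_cancel_left]
      · rw [Equiv.Perm.mul_apply, Equiv.Perm.inv_eq_iff_eq]
        rcases hx.eq_or_lt with h | h
        · obtain rfl : x = ⟨o + p, hk⟩ := Fin.ext h.symm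
          exact h0
        · rw [(hv' x).2 h, cyc_apply_of_lt (by omega) h]
    · obtain ⟨h1, h2⟩ := gw_cyc_mul hmul hk (show r ≤ o + p by omega) hv
      rw [h1, h2, smul_mul_assoc, mul_smul_comm, smul_smul, pow_add]
  · intro v hv
    have hv' := mem_rowStabTo.1 hv
    have h2 : (v ⟨o + p, hk⟩ : ℕ) ≤ o + p := by
      by_contra! h
      have := v.injective ((hv' (v ⟨o + p, hk⟩)).2 h)
      rw [this] at h
      exact lt_irrefl _ h
    have h1 := (hρ _ h2).1 (hv' ⟨o + p, hk⟩).1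
    rw [Finset.mem_range]
    omega

theorem rowOfNum_of_row {μ : YoungDiagram} {i x : ℕ} (h1 : off μ.rowLen i ≤ x)
    (h2 : x < off μ.rowLen i + μ.rowLen i) : rowOfNum μ (x + 1) = i := by
  have hi : i ≤ off μ.rowLen i := by
    have h : ∀ j, j ≤ i → j ≤ off μ.rowLen j := fun j hj => by
      induction j with
      | zero => simp
      | succ j ih =>
        have h3 := μ.rowLen_anti j i (by omega)
        have := ih (by omega)
        rw [off_succ]; omega
    exact h i le_rfl
  rw [rowOfNum, show (Finset.range (x + 1)).filter
    (fun r => (∑ i ∈ Finset.range (r+1), μ.rowLen i) < x + 1) = Finset.range i from ?_,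
    Finset.card_range]
  ext r
  rw [Finset.mem_filter, Finset.mem_range, Finset.mem_range]
  change r < x + 1 ∧ off μ.rowLen (r + 1) < x + 1 ↔ r < i
  constructor
  · rintro ⟨h3, h4⟩
    by_contra! h5
    have := off_mono μ.rowLen (show i + 1 ≤ r + 1 by omega)
    rw [off_succ μ.rowLen i] at this
    omega
  · intro h3
    have := off_mono μ.rowLen (show r + 1 ≤ i by omega)
    omega

theorem rowOfNum_of_card_le {μ : YoungDiagram} {x : ℕ} (h : μ.card ≤ x) :
    rowOfNum μ (x + 1) = x + 1 := by
  rw [rowOfNum, Finset.filter_true_of_mem, Finset.card_range]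
  intro r _
  have : off μ.rowLen (r + 1) ≤ μ.card := μ.off_le_card _
  change off μ.rowLen (r + 1) < x + 1
  omega

theorem exists_row_of_lt_off {μ : YoungDiagram} {x m : ℕ} (h : x < off μ.rowLen m) :
    ∃ i < m, off μ.rowLen i ≤ x ∧ x < off μ.rowLen i + μ.rowLen i := by
  induction m with
  | zero => simp at h
  | succ m ih =>
    rcases lt_or_ge x (off μ.rowLen m) with h' | h'
    · obtain ⟨i, hi, h1⟩ := ih h'
      exact ⟨i, by omega, h1⟩
    · exact ⟨m, by omega, h', by rwa [← off_succ]⟩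

theorem rowOfNum_le {μ : YoungDiagram} {x : ℕ} (h : x < μ.card) : rowOfNum μ (x + 1) ≤ x := by
  have h1 : off μ.rowLen (μ.colLen 0) = μ.card := (YoungDiagram.card_eq_off μ.rowLen_colLen).symm
  rw [← h1] at h
  obtain ⟨i, -, h2, h3⟩ := exists_row_of_lt_off h
  rw [rowOfNum_of_row h2 h3]
  by_contra! hc
  have h4 : ∀ j, j ≤ i → j ≤ off μ.rowLen j := fun j hj => by
    induction j with
    | zero => simp
    | succ j ih =>
      have h3 := μ.rowLen_anti j i (by omega)
      have := ih (by omega)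
      rw [off_succ]; omega
  have := h4 i le_rfl
  omega

theorem rowStab_eq {μ : YoungDiagram} :
    RowStab n μ = rowStabTo n (fun x => rowOfNum μ (x + 1)) μ.card := by
  have happ : ∀ (v : Equiv.Perm (Fin n)) (x : Fin n), applyPerm n v (x + 1) = v x + 1 :=
    fun v x => by
      rw [applyPerm, dif_pos ⟨by omega, by omega⟩]
      rfl
  ext v
  rw [mem_rowStabTo, RowStab, Finset.mem_filter]
  constructor
  · rintro ⟨-, hv⟩ x
    have h := hv x
    rw [happ] at h
    refine ⟨h, fun hx => Fin.ext ?_⟩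
    rw [rowOfNum_of_card_le hx] at h
    rcases lt_or_ge (v x : ℕ) μ.card with h' | h'
    · have := rowOfNum_le h'
      omega
    · rw [rowOfNum_of_card_le h'] at h
      omega
  · exact fun hv => ⟨Finset.mem_univ _, fun x => by rw [happ]; exact (hv x).1⟩

theorem sum_rowStab (h1 : gw 1 = 1)
    (hmul : ∀ (v : Equiv.Perm (Fin n)) (j : ℕ), 1 ≤ j → j < n →
      invCount (swN n j * v) = invCount v + 1 → gw (swN n j * v) = gw v * g j)
    {μ : YoungDiagram} (hμ : μ.card ≤ n) :
    ∑ v ∈ RowStab n μ, ((q : R) ^ invCount v) • gw v = symW q g μ.rowLen (μ.colLen 0) := by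
  set ρ := fun x => rowOfNum μ (x + 1) with hρ
  have key : ∀ m, ∑ v ∈ rowStabTo n ρ (off μ.rowLen m), ((q : R) ^ invCount v) • gw v =
      symW q g μ.rowLen m := by
    intro m
    induction m with
    | zero =>
      have : rowStabTo n ρ (off μ.rowLen 0) = {1} := by
        ext v
        rw [mem_rowStabTo, Finset.mem_singleton]
        constructor
        · exact fun h => Equiv.ext fun x => (h x).2 (by simp)
        · rintro rfl x
          simp
      have hinv : invCount (1 : Equiv.Perm (Fin n)) = 0 := by
        rw [invCount, Finset.card_eq_zero, Finset.filter_eq_empty_iff]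
        rintro ⟨a, b⟩ - ⟨h, h'⟩
        exact lt_asymm h h'
      rw [this, Finset.sum_singleton, h1, hinv]
      simp [symW]
    | succ m ih =>
      rw [symW_succ, ← ih, off_succ]
      have hn : off μ.rowLen m + μ.rowLen m ≤ n := by
        rw [← off_succ]; exact (μ.off_le_card _).trans hμ
      have key : ∀ p, p ≤ μ.rowLen m →
          ∑ v ∈ rowStabTo n ρ (off μ.rowLen m + p), ((q : R) ^ invCount v) • gw v =
          (∑ v ∈ rowStabTo n ρ (off μ.rowLen m), ((q : R) ^ invCount v) • gw v) *
            rowSym q g (off μ.rowLen m) p := by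
        intro p hp
        induction p with
        | zero => simp [rowSym]
        | succ p ihp =>
          rw [rowSym_succ, ← mul_assoc, ← ihp (by omega), ← add_assoc]
          refine sum_rowStabTo_succ hmul (by omega) fun x hx => ?_
          simp only [hρ]
          rw [rowOfNum_of_row (i := m) (x := off μ.rowLen m + p) (by omega) (by omega)]
          refine ⟨fun h => ?_, fun h => rowOfNum_of_row h (by omega)⟩
          by_contra! hc
          obtain ⟨i, hi, h2, h3⟩ := exists_row_of_lt_off hc
          rw [rowOfNum_of_row h2 h3] at h
          omega
      exact key _ le_rfl
  rw [rowStab_eq, ← key, YoungDiagram.card_eq_off μ.rowLen_colLen]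

end RowStabSum

section Quotient
variable {R : Type} [CommRing R] {z q : Rˣ} {δ : R} {n : ℕ}

/-- The generator `g_i⁻¹` (equal to `1` out of range). -/
def bmwGI (R : Type) [CommRing R] (z q : Rˣ) (δ : R) (n i : ℕ) : BMW R z q δ n :=
  if h : 1 ≤ i ∧ i < n then
    RingQuot.mkAlgHom R (BMWRel R z q δ n) (FreeAlgebra.ι R (BMWGen.GI ⟨i, h⟩))
  else 1

theorem mkAlgHom_G (i : {i : ℕ // 1 ≤ i ∧ i < n}) :
    RingQuot.mkAlgHom R (BMWRel R z q δ n) (FreeAlgebra.ι R (BMWGen.G i)) = bmwG R z q δ n i := by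
  rw [bmwG, dif_pos i.2]

theorem mkAlgHom_GI (i : {i : ℕ // 1 ≤ i ∧ i < n}) :
    RingQuot.mkAlgHom R (BMWRel R z q δ n) (FreeAlgebra.ι R (BMWGen.GI i)) =
      bmwGI R z q δ n i := by
  rw [bmwGI, dif_pos i.2]

theorem mkAlgHom_E (i : {i : ℕ // 1 ≤ i ∧ i < n}) :
    RingQuot.mkAlgHom R (BMWRel R z q δ n) (FreeAlgebra.ι R (BMWGen.E i)) = bmwE R z q δ n i := by
  rw [bmwE, dif_pos i.2]

theorem BMWRel.mk_eq {x y : FreeAlgebra R (BMWGen n)} (h : BMWRel R z q δ n x y) :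
    RingQuot.mkAlgHom R (BMWRel R z q δ n) x = RingQuot.mkAlgHom R (BMWRel R z q δ n) y :=
  RingQuot.mkAlgHom_rel R h

theorem bmwSys : BMWSys z q δ n (bmwG R z q δ n) (bmwGI R z q δ n) (bmwE R z q δ n) where
  g_gi i h1 h2 := by
    have := (BMWRel.invR (R := R) (z := z) (q := q) (δ := δ) ⟨i, h1, h2⟩).mk_eq
    simpa only [map_mul, map_one, mkAlgHom_G, mkAlgHom_GI, mkAlgHom_E] using this
  gi_g i h1 h2 := by
    have := (BMWRel.invL (R := R) (z := z) (q := q) (δ := δ) ⟨i, h1, h2⟩).mk_eq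
    simpa only [map_mul, map_one, mkAlgHom_G, mkAlgHom_GI, mkAlgHom_E] using this
  idem i h1 h2 := by
    have := (BMWRel.idem (R := R) (z := z) (q := q) (δ := δ) ⟨i, h1, h2⟩).mk_eq
    simpa only [map_mul, ← Algebra.smul_def, map_smul, mkAlgHom_E] using this
  braid i h1 h2 := by
    have := (BMWRel.braid (R := R) (z := z) (q := q) (δ := δ) ⟨i, h1, by omega⟩
      ⟨i + 1, by omega, h2⟩ rfl).mk_eq
    simpa only [map_mul, mkAlgHom_G] using this
  gg i j h1 h2 h3 := by
    have := (BMWRel.braidComm (R := R) (z := z) (q := q) (δ := δ) ⟨i, h1, by omega⟩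
      ⟨j, by omega, h3⟩ (Or.inl h2)).mk_eq
    simpa only [map_mul, mkAlgHom_G] using this
  ge i j h1 h2 h3 := by
    have := (BMWRel.geComm (R := R) (z := z) (q := q) (δ := δ) ⟨i, h1, by omega⟩
      ⟨j, by omega, h3⟩ (Or.inl h2)).mk_eq
    simpa only [map_mul, mkAlgHom_G, mkAlgHom_E] using this
  eg i j h1 h2 h3 := by
    have := (BMWRel.geComm (R := R) (z := z) (q := q) (δ := δ) ⟨j, by omega, h3⟩
      ⟨i, h1, by omega⟩ (Or.inr h2)).mk_eq
    simpa only [map_mul, mkAlgHom_G, mkAlgHom_E] using this.symm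
  eec i j h1 h2 h3 := by
    have := (BMWRel.eeComm (R := R) (z := z) (q := q) (δ := δ) ⟨i, h1, by omega⟩
      ⟨j, by omega, h3⟩ (Or.inl h2)).mk_eq
    simpa only [map_mul, mkAlgHom_E] using this
  eee i h1 h2 := by
    have := (BMWRel.tangle1 (R := R) (z := z) (q := q) (δ := δ) ⟨i, h1, by omega⟩
      ⟨i + 1, by omega, h2⟩ (Or.inl rfl)).mk_eq
    simpa only [map_mul, mkAlgHom_E] using this
  eee' i h1 h2 := by
    have := (BMWRel.tangle1 (R := R) (z := z) (q := q) (δ := δ) ⟨i + 1, by omega, h2⟩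
      ⟨i, h1, by omega⟩ (Or.inr rfl)).mk_eq
    simpa only [map_mul, mkAlgHom_E] using this
  gge i h1 h2 := by
    have := (BMWRel.tangle2 (R := R) (z := z) (q := q) (δ := δ) ⟨i + 1, by omega, h2⟩
      ⟨i, h1, by omega⟩ (Or.inr rfl)).mk_eq
    simpa only [map_mul, mkAlgHom_G, mkAlgHom_E] using this
  gge' i h1 h2 := by
    have := (BMWRel.tangle2 (R := R) (z := z) (q := q) (δ := δ) ⟨i, h1, by omega⟩
      ⟨i + 1, by omega, h2⟩ (Or.inl rfl)).mk_eq
    simpa only [map_mul, mkAlgHom_G, mkAlgHom_E] using this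
  egg i h1 h2 := by
    have := (BMWRel.tangle3 (R := R) (z := z) (q := q) (δ := δ) ⟨i + 1, by omega, h2⟩
      ⟨i, h1, by omega⟩ (Or.inr rfl)).mk_eq
    simpa only [map_mul, mkAlgHom_G, mkAlgHom_E] using this
  egg' i h1 h2 := by
    have := (BMWRel.tangle3 (R := R) (z := z) (q := q) (δ := δ) ⟨i, h1, by omega⟩
      ⟨i + 1, by omega, h2⟩ (Or.inl rfl)).mk_eq
    simpa only [map_mul, mkAlgHom_G, mkAlgHom_E] using this
  skein i h1 h2 := by
    have := (BMWRel.skein (R := R) (z := z) (q := q) (δ := δ) ⟨i, h1, h2⟩).mk_eq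
    simpa only [map_mul, map_sub, map_one, AlgHom.commutes, Algebra.smul_def, mkAlgHom_G,
      mkAlgHom_GI, mkAlgHom_E] using this
  untwR i h1 h2 := by
    have := (BMWRel.untwistR (R := R) (z := z) (q := q) (δ := δ) ⟨i, h1, h2⟩).mk_eq
    simpa only [map_mul, ← Algebra.smul_def, map_smul, mkAlgHom_G, mkAlgHom_E] using this
  untwL i h1 h2 := by
    have := (BMWRel.untwistL (R := R) (z := z) (q := q) (δ := δ) ⟨i, h1, h2⟩).mk_eq
    simpa only [map_mul, ← Algebra.smul_def, map_smul, mkAlgHom_G, mkAlgHom_E] using this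
  untwE i h1 h2 := by
    have := (BMWRel.untwistE (R := R) (z := z) (q := q) (δ := δ) ⟨i + 1, by omega, h2⟩
      ⟨i, h1, by omega⟩ (Or.inr rfl)).mk_eq
    simpa only [map_mul, ← Algebra.smul_def, map_smul, mkAlgHom_G, mkAlgHom_E] using this
  untwE' i h1 h2 := by
    have := (BMWRel.untwistE (R := R) (z := z) (q := q) (δ := δ) ⟨i, h1, by omega⟩
      ⟨i + 1, by omega, h2⟩ (Or.inl rfl)).mk_eq
    simpa only [map_mul, ← Algebra.smul_def, map_smul, mkAlgHom_G, mkAlgHom_E] using this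

theorem mem_lvl_bmw (w : BMW R z q δ n) :
    w ∈ lvl R (bmwG R z q δ n) (bmwE R z q δ n) n := by
  obtain ⟨x, rfl⟩ := RingQuot.mkAlgHom_surjective R (BMWRel R z q δ n) w
  induction x using FreeAlgebra.induction with
  | grade0 r => rw [AlgHom.commutes]; exact Subalgebra.algebraMap_mem _ r
  | grade1 x =>
    cases x with
    | G i => rw [mkAlgHom_G]; exact g_mem_lvl i.2.1 i.2.2
    | GI i =>
      have h := (bmwSys (z := z) (q := q) (δ := δ)).skein i i.2.1 i.2.2
      rw [mkAlgHom_GI, ← sub_sub_cancel (bmwG R z q δ n i) (bmwGI R z q δ n i), h]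
      exact sub_mem (g_mem_lvl i.2.1 i.2.2)
        (Subalgebra.smul_mem _ (sub_mem (one_mem _) (e_mem_lvl i.2.1 i.2.2)) _)
    | E i => rw [mkAlgHom_E]; exact e_mem_lvl i.2.1 i.2.2
  | mul a b ha hb => rw [map_mul]; exact mul_mem ha hb
  | add a b ha hb => rw [map_add]; exact add_mem ha hb

end Quotient

section Counting
theorem finite_up (μ : YoungDiagram) : {ν : YoungDiagram | μ ≤ ν ∧ ν.card = μ.card + 1}.Finite :=
  (YoungDiagram.finite_card_le (μ.card + 1)).subset fun _ h => h.2.le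

theorem finite_down (μ : YoungDiagram) : {ν : YoungDiagram | ν ≤ μ ∧ μ.card = ν.card + 1}.Finite :=
  (YoungDiagram.finite_card_le μ.card).subset fun ν h => show ν.card ≤ μ.card by
    have := h.2; omega

/-- The diagrams obtained by adding a node. -/
noncomputable def upF (μ : YoungDiagram) : Finset YoungDiagram := (finite_up μ).toFinset

/-- The diagrams obtained by removing a node. -/
noncomputable def downF (μ : YoungDiagram) : Finset YoungDiagram := (finite_down μ).toFinset

theorem mem_upF {μ ν : YoungDiagram} : ν ∈ upF μ ↔ μ ≤ ν ∧ ν.card = μ.card + 1 := by simp [upF]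

theorem mem_downF {μ ν : YoungDiagram} : ν ∈ downF μ ↔ ν ≤ μ ∧ μ.card = ν.card + 1 := by
  simp [downF]

theorem mem_downF_iff {μ ν : YoungDiagram} : ν ∈ downF μ ↔ μ ∈ upF ν := by
  rw [mem_upF, mem_downF]

theorem YoungDiagram.eq_of_le_of_card_le {μ ν : YoungDiagram} (h : μ ≤ ν) (hc : ν.card ≤ μ.card) :
    μ = ν := YoungDiagram.ext (Finset.eq_of_subset_of_card_le h hc)

theorem YoungDiagram.card_sup_add_card_inf (μ ν : YoungDiagram) :
    (μ ⊔ ν).card + (μ ⊓ ν).card = μ.card + ν.card := by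
  have h := Finset.card_union_add_card_inter μ.cells ν.cells
  exact h

/-- The row-indexed form of a covering relation. -/
theorem YoungDiagram.rowLen_of_covers {μ ν : YoungDiagram} (h : μ ≤ ν) (hc : ν.card = μ.card + 1) :
    ∃ j, ν.rowLen = Function.update μ.rowLen j (μ.rowLen j + 1) := by
  have hle := YoungDiagram.le_iff_rowLen.1 h
  obtain ⟨j, hj⟩ : ∃ j, μ.rowLen j < ν.rowLen j := by
    by_contra! hcon
    have : μ = ν := YoungDiagram.ext_rowLen (funext fun i => le_antisymm (hle i) (hcon i))
    rw [this] at hc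
    omega
  refine ⟨j, funext fun i => ?_⟩
  set m := max (max (μ.colLen 0) (ν.colLen 0)) (max (i + 1) (j + 1)) with hm
  have h1 : μ.card = off μ.rowLen m := YoungDiagram.card_eq_off (by
    have := (YoungDiagram.rowLen_pos_iff (μ := μ) (i := m)).not.2 (by omega)
    omega)
  have h2 : ν.card = off ν.rowLen m := YoungDiagram.card_eq_off (by
    have := (YoungDiagram.rowLen_pos_iff (μ := ν) (i := m)).not.2 (by omega)
    omega)
  have h3 : off (Function.update μ.rowLen j (μ.rowLen j + 1)) m = off μ.rowLen m + 1 := by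
    rw [off, Finset.sum_update_of_mem (Finset.mem_range.2 (by omega)), off,
      ← Finset.add_sum_erase _ _ (Finset.mem_range.2 (show j < m by omega)),
      Finset.sdiff_singleton_eq_erase]
    omega
  have h4 : ∀ i ∈ Finset.range m, Function.update μ.rowLen j (μ.rowLen j + 1) i ≤ ν.rowLen i :=
    fun i _ => by
      rcases eq_or_ne i j with rfl | hij
      · rw [Function.update_self]; exact hj
      · rw [Function.update_of_ne hij]; exact hle i
  have h5 := (Finset.sum_eq_sum_iff_of_le h4).1 (by
    change off _ m = off _ m
    rw [h3, ← h1, ← h2, hc])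
  exact (h5 i (Finset.mem_range.2 (by omega))).symm

/-- The rows in which a node can be removed. -/
def remRows (μ : YoungDiagram) : Finset ℕ :=
  (Finset.range (μ.colLen 0)).filter fun j => μ.rowLen (j + 1) < μ.rowLen j

theorem mem_remRows {μ : YoungDiagram} {j : ℕ} :
    j ∈ remRows μ ↔ μ.rowLen (j + 1) < μ.rowLen j := by
  rw [remRows, Finset.mem_filter, Finset.mem_range, and_iff_right_iff_imp]
  intro h
  exact YoungDiagram.rowLen_pos_iff.1 (by omega)

theorem update_injective {κ : ℕ → ℕ} {i j : ℕ}
    (h : Function.update κ i (κ i + 1) = Function.update κ j (κ j + 1)) : i = j := by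
  by_contra hij
  have := congrFun h i
  rw [Function.update_self, Function.update_of_ne hij] at this
  omega

theorem card_remRows_le (μ : YoungDiagram) : (remRows μ).card ≤ (downF μ).card := by
  have h : ∀ j ∈ remRows μ, ∃ ν : YoungDiagram,
      ν.rowLen = Function.update μ.rowLen j (μ.rowLen j - 1) :=
    fun j hj => μ.exists_remove (mem_remRows.1 hj)
  choose! f hf using h
  have hpos : ∀ j ∈ remRows μ, 0 < μ.rowLen j := fun j hj => by
    have := mem_remRows.1 hj
    omega
  have hμ : ∀ j ∈ remRows μ, μ.rowLen = Function.update (f j).rowLen j ((f j).rowLen j + 1) :=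
    fun j hj => by
      have := hpos j hj
      rw [hf j hj, Function.update_self, Function.update_idem, Nat.sub_add_cancel this,
        Function.update_eq_self]
  refine Finset.card_le_card_of_injOn f (fun j hj => ?_) (fun i hi j hj hij => ?_)
  · exact mem_downF.2 ⟨YoungDiagram.le_of_add (hμ j hj), YoungDiagram.card_of_add (hμ j hj)⟩
  · refine update_injective (κ := (f i).rowLen) ?_
    rw [← hμ i hi, hμ j hj, hij]

theorem card_upF_le (μ : YoungDiagram) : (upF μ).card ≤ (downF μ).card + 1 := by
  classical
  have h : ∀ ν ∈ upF μ, ∃ j, ν.rowLen = Function.update μ.rowLen j (μ.rowLen j + 1) :=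
    fun ν hν => YoungDiagram.rowLen_of_covers (mem_upF.1 hν).1 (mem_upF.1 hν).2
  choose! f hf using h
  calc (upF μ).card ≤ (insert 0 ((remRows μ).image Nat.succ)).card := by
        refine Finset.card_le_card_of_injOn f (fun ν hν => ?_) (fun ν hν κ hκ hij => ?_)
        · rw [Finset.mem_coe, Finset.mem_insert, Finset.mem_image]
          rcases Nat.eq_zero_or_pos (f ν) with h0 | h0
          · exact .inl h0
          · refine .inr ⟨f ν - 1, mem_remRows.2 ?_, by omega⟩
            have h1 := ν.rowLen_anti (i1 := f ν - 1) (i2 := f ν) (by omega)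
            rw [hf ν hν, Function.update_self, Function.update_of_ne (by omega)] at h1
            rw [Nat.sub_add_cancel h0]
            omega
        · refine YoungDiagram.ext_rowLen ?_
          rw [hf ν hν, hf κ hκ, hij]
    _ ≤ (remRows μ).card + 1 := (Finset.card_insert_le _ _).trans
        (Nat.succ_le_succ Finset.card_image_le)
    _ ≤ _ := Nat.succ_le_succ (card_remRows_le μ)

theorem sum_upF_downF_le (f : YoungDiagram → ℕ) (lam : YoungDiagram) :
    ∑ κ ∈ upF lam, ∑ ν ∈ downF κ, f ν ≤ ∑ ρ ∈ downF lam, ∑ ν ∈ upF ρ, f ν + f lam := by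
  classical
  rw [Finset.sum_sigma', Finset.sum_sigma',
    ← Finset.sum_filter_add_sum_filter_not _ (fun x => x.2 = lam),
    ← Finset.sum_filter_add_sum_filter_not (downF lam |>.sigma _) (fun x => x.2 = lam)]
  have h1 : ∑ x ∈ ((upF lam).sigma fun κ => downF κ).filter (fun x => x.2 = lam), f x.2 =
      (upF lam).card * f lam := by
    rw [← smul_eq_mul, ← Finset.sum_const]
    refine Finset.sum_nbij' (fun x => x.1) (fun κ => ⟨κ, lam⟩) ?_ ?_ ?_ ?_ ?_ <;>
      simp +contextual [mem_downF_iff, Sigma.forall]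
  have h2 : ∑ x ∈ ((downF lam).sigma fun κ => upF κ).filter (fun x => x.2 = lam), f x.2 =
      (downF lam).card * f lam := by
    rw [← smul_eq_mul, ← Finset.sum_const]
    refine Finset.sum_nbij' (fun x => x.1) (fun κ => ⟨κ, lam⟩) ?_ ?_ ?_ ?_ ?_ <;>
      simp +contextual [mem_downF_iff, Sigma.forall]
  have h3 : ∑ x ∈ ((upF lam).sigma fun κ => downF κ).filter (fun x => ¬ x.2 = lam), f x.2 =
      ∑ x ∈ ((downF lam).sigma fun κ => upF κ).filter (fun x => ¬ x.2 = lam), f x.2 := by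
    have hs : ∀ κ ν : YoungDiagram, lam ≤ κ → κ.card = lam.card + 1 → ν ≤ κ →
        κ.card = ν.card + 1 → ν ≠ lam → lam ⊔ ν = κ := fun κ ν h1 h2 h3 h4 h5 => by
      refine YoungDiagram.eq_of_le_of_card_le (sup_le h1 h3) ?_
      by_contra hcon
      have h6 : lam = lam ⊔ ν := YoungDiagram.eq_of_le_of_card_le le_sup_left (by omega)
      exact h5 (YoungDiagram.eq_of_le_of_card_le (h6 ▸ le_sup_right) (by omega))
    have hi : ∀ κ ν : YoungDiagram, κ ≤ lam → lam.card = κ.card + 1 → κ ≤ ν →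
        ν.card = κ.card + 1 → ν ≠ lam → lam ⊓ ν = κ := fun κ ν h1 h2 h3 h4 h5 => by
      refine (YoungDiagram.eq_of_le_of_card_le (le_inf h1 h3) ?_).symm
      by_contra hcon
      have h6 : lam ⊓ ν = lam := YoungDiagram.eq_of_le_of_card_le inf_le_left (by omega)
      exact h5 (YoungDiagram.eq_of_le_of_card_le (h6 ▸ inf_le_right) (by omega)).symm
    refine Finset.sum_nbij' (fun x => ⟨lam ⊓ x.2, x.2⟩) (fun x => ⟨lam ⊔ x.2, x.2⟩)
      ?_ ?_ ?_ ?_ ?_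
    · rintro ⟨κ, ν⟩ hx
      simp only [Finset.mem_filter, Finset.mem_sigma, mem_upF, mem_downF] at hx ⊢
      obtain ⟨⟨⟨a, b⟩, c, d⟩, e⟩ := hx
      have h7 := hs κ ν a b c d e
      have h8 := YoungDiagram.card_sup_add_card_inf lam ν
      rw [h7] at h8
      exact ⟨⟨⟨inf_le_left, by omega⟩, inf_le_right, by omega⟩, e⟩
    · rintro ⟨κ, ν⟩ hx
      simp only [Finset.mem_filter, Finset.mem_sigma, mem_upF, mem_downF] at hx ⊢
      obtain ⟨⟨⟨a, b⟩, c, d⟩, e⟩ := hx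
      have h7 := hi κ ν a b c d e
      have h8 := YoungDiagram.card_sup_add_card_inf lam ν
      rw [h7] at h8
      exact ⟨⟨⟨le_sup_left, by omega⟩, le_sup_right, by omega⟩, e⟩
    · rintro ⟨κ, ν⟩ hx
      simp only [Finset.mem_filter, Finset.mem_sigma, mem_upF, mem_downF] at hx ⊢
      obtain ⟨⟨⟨a, b⟩, c, d⟩, e⟩ := hx
      rw [hs κ ν a b c d e]
    · rintro ⟨κ, ν⟩ hx
      simp only [Finset.mem_filter, Finset.mem_sigma, mem_upF, mem_downF] at hx ⊢
      obtain ⟨⟨⟨a, b⟩, c, d⟩, e⟩ := hx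
      rw [hi κ ν a b c d e]
    · exact fun _ _ => rfl
  rw [h1, h2, h3]
  nlinarith [card_upF_le lam]

/-- The number of paths of length `i` from the empty diagram to a given diagram in the
undirected Young graph. -/
noncomputable def walkCount : ℕ → YoungDiagram → ℕ
  | 0, lam => open Classical in if lam = ⊥ then 1 else 0
  | i + 1, lam => ∑ ν ∈ downF lam, walkCount i ν + ∑ ν ∈ upF lam, walkCount i ν

theorem sum_upF_walkCount_le (i : ℕ) (lam : YoungDiagram) :
    ∑ κ ∈ upF lam, walkCount (i + 1) κ ≤ (i + 1) * walkCount i lam := by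
  induction i generalizing lam with
  | zero =>
    have h0 : ∀ μ : YoungDiagram, ∑ ν ∈ upF μ, walkCount 0 ν = 0 := fun μ =>
      Finset.sum_eq_zero fun ν hν => if_neg fun h => by
        have := (mem_upF.1 hν).2
        rw [h] at this
        exact absurd this (by simp [YoungDiagram.card])
    have h := sum_upF_downF_le (walkCount 0) lam
    simp only [walkCount.eq_2, h0, Finset.sum_const_zero, add_zero, zero_add, one_mul] at h ⊢
    exact h
  | succ i ih =>
    have h := sum_upF_downF_le (walkCount (i + 1)) lam
    have h1 : ∑ κ ∈ upF lam, walkCount (i + 2) κ =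
        ∑ κ ∈ upF lam, ∑ ν ∈ downF κ, walkCount (i + 1) ν +
          ∑ κ ∈ upF lam, ∑ ν ∈ upF κ, walkCount (i + 1) ν := by
      rw [← Finset.sum_add_distrib]
      rfl
    have h2 := Finset.sum_le_sum fun κ (_ : κ ∈ upF lam) => ih κ
    have h3 := Finset.sum_le_sum fun κ (_ : κ ∈ downF lam) => ih κ
    rw [← Finset.mul_sum] at h2 h3
    have h4 : walkCount (i + 1) lam =
      ∑ ν ∈ downF lam, walkCount i ν + ∑ ν ∈ upF lam, walkCount i ν := rfl
    rw [h1]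
    nlinarith

theorem downF_bot : downF ⊥ = ∅ :=
  Finset.eq_empty_of_forall_notMem fun ν hν => by
    have := (mem_downF.1 hν).2
    rw [YoungDiagram.card, YoungDiagram.cells_bot, Finset.card_empty] at this
    omega

theorem walkCount_bot_le (n : ℕ) :
    walkCount (2 * n) ⊥ ≤ ∏ k ∈ Finset.range n, (2 * k + 1) := by
  induction n with
  | zero => simp [walkCount]
  | succ n ih =>
    have h : walkCount (2 * (n + 1)) ⊥ =
      ∑ ν ∈ downF ⊥, walkCount (2 * n + 1) ν + ∑ ν ∈ upF ⊥, walkCount (2 * n + 1) ν := rfl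
    rw [h, downF_bot, Finset.sum_empty, zero_add, Finset.prod_range_succ,
      mul_comm (∏ k ∈ Finset.range n, (2 * k + 1))]
    exact (sum_upF_walkCount_le _ _).trans (Nat.mul_le_mul le_rfl ih)

theorem walkCount_eq_zero {i : ℕ} {lam : YoungDiagram} (h : i < lam.card) :
    walkCount i lam = 0 := by
  induction i generalizing lam with
  | zero => exact if_neg fun h' => by rw [h'] at h; simp [YoungDiagram.card] at h
  | succ i ih =>
    have h1 : ∀ ν ∈ downF lam, walkCount i ν = 0 := fun ν hν => ih (by
      have := (mem_downF.1 hν).2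
      omega)
    have h2 : ∀ ν ∈ upF lam, walkCount i ν = 0 := fun ν hν => ih (by
      have := (mem_upF.1 hν).2
      omega)
    rw [walkCount.eq_2, Finset.sum_eq_zero h1, Finset.sum_eq_zero h2, add_zero]

/-- The diagrams with at most `n` nodes. -/
noncomputable def diagramsLE (n : ℕ) : Finset YoungDiagram :=
  (YoungDiagram.finite_card_le n).toFinset

theorem mem_diagramsLE {n : ℕ} {μ : YoungDiagram} : μ ∈ diagramsLE n ↔ μ.card ≤ n := by
  simp [diagramsLE]

theorem sum_walkCount_mul_le {n a b : ℕ} (ha : a ≤ n) :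
    ∑ μ ∈ diagramsLE n, walkCount (a + 1) μ * walkCount b μ ≤
      ∑ μ ∈ diagramsLE n, walkCount a μ * walkCount (b + 1) μ := by
  classical
  have key : ∀ s t : YoungDiagram → Finset YoungDiagram, (∀ μ ν, ν ∈ s μ ↔ μ ∈ t ν) →
      ∑ μ ∈ diagramsLE n, (∑ ν ∈ s μ, walkCount a ν) * walkCount b μ ≤
      ∑ μ ∈ diagramsLE n, walkCount a μ * ∑ ν ∈ t μ, walkCount b ν := fun s t hst => by
    have h1 : ∀ μ, (∑ ν ∈ s μ, walkCount a ν) * walkCount b μ =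
        ∑ ν ∈ diagramsLE n, if ν ∈ s μ then walkCount a ν * walkCount b μ else 0 := fun μ => by
      rw [Finset.sum_mul, ← Finset.sum_filter]
      refine (Finset.sum_subset (fun ν hν => (Finset.mem_filter.1 hν).2) fun ν hν h => ?_).symm
      rw [walkCount_eq_zero, zero_mul]
      rw [Finset.mem_filter, mem_diagramsLE] at h
      by_contra hcon
      exact h ⟨by omega, hν⟩
    have h2 : ∀ ν, ∑ μ ∈ diagramsLE n, (if ν ∈ s μ then walkCount a ν * walkCount b μ else 0) ≤
        walkCount a ν * ∑ κ ∈ t ν, walkCount b κ := fun ν => by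
      rw [Finset.mul_sum, ← Finset.sum_filter]
      exact Finset.sum_le_sum_of_subset fun μ hμ => (hst μ ν).1 (Finset.mem_filter.1 hμ).2
    simp only [h1]
    rw [Finset.sum_comm]
    exact Finset.sum_le_sum fun ν _ => h2 ν
  have hd := key downF upF fun μ ν => mem_downF_iff
  have hu := key upF downF fun μ ν => mem_downF_iff.symm
  simp only [walkCount.eq_2, add_mul, mul_add, Finset.sum_add_distrib]
  omega

theorem sum_walkCount_sq_le (n : ℕ) :
    ∑ μ ∈ diagramsLE n, walkCount n μ ^ 2 ≤ ∏ k ∈ Finset.range n, (2 * k + 1) := by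
  have h : ∀ j ≤ n, ∑ μ ∈ diagramsLE n, walkCount n μ ^ 2 ≤
      ∑ μ ∈ diagramsLE n, walkCount (n - j) μ * walkCount (n + j) μ := by
    intro j hj
    induction j with
    | zero => simp [sq]
    | succ j ih =>
      refine (ih (by omega)).trans ?_
      have := sum_walkCount_mul_le (n := n) (a := n - (j + 1)) (b := n + j) (by omega)
      rwa [show n - (j + 1) + 1 = n - j by omega] at this
  refine ((h n le_rfl).trans ?_).trans (walkCount_bot_le n)
  rw [Nat.sub_self, ← two_mul, Finset.sum_eq_single_of_mem ⊥ (mem_diagramsLE.2 (by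
    simp [YoungDiagram.card]))]
  · simp [walkCount.eq_1]
  · intro μ _ hμ
    rw [walkCount.eq_1, if_neg hμ, zero_mul]

theorem WPath.exists_finset (i : ℕ) (x : YoungDiagram × ℕ) :
    ∃ A : Finset (WPath i x), (∀ t, t ∈ A) ∧ A.card ≤ walkCount i x.1 := by
  classical
  induction i generalizing x with
  | zero =>
    have hs : Subsingleton (WPath 0 x) := ⟨fun s t => Subtype.ext (funext fun k => by
      rw [show k = 0 from Fin.ext (by omega), s.2.1, t.2.1])⟩
    by_cases h : Nonempty (WPath 0 x)
    · obtain ⟨t⟩ := h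
      have hx : x = (⊥, 0) := t.2.2.1.symm.trans t.2.1
      refine ⟨{t}, fun s => Finset.mem_singleton.2 (Subsingleton.elim _ _), ?_⟩
      rw [Finset.card_singleton, hx, walkCount.eq_1, if_pos rfl]
    · exact ⟨∅, fun t => (h ⟨t⟩).elim, by simp⟩
  | succ i ih =>
    choose A hA hc using ih
    let f : YoungDiagram × ℕ → Finset (WPath (i + 1) x) := fun a =>
      if h : WEdge a x then (A a).image fun t => t.snoc h else ∅
    have hf : ∀ a, (f a).card ≤ walkCount i a.1 := fun a => by
      by_cases h : WEdge a x
      · simp only [f, dif_pos h]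
        exact Finset.card_image_le.trans (hc a)
      · simp [f, dif_neg h]
    refine ⟨(downF x.1).biUnion (fun ν => f (ν, x.2)) ∪ (upF x.1).biUnion (fun ν => f (ν, x.2 - 1)),
      fun t => ?_, ?_⟩
    · have key : t ∈ f (t.1 (Fin.last i).castSucc) := by
        simp only [f, dif_pos t.edge, Finset.mem_image]
        exact ⟨t.dropLast, hA _ _, t.snoc_dropLast⟩
      have he := t.edge
      generalize t.1 (Fin.last i).castSucc = a at key he
      obtain ⟨ν, l⟩ := a
      rw [Finset.mem_union, Finset.mem_biUnion, Finset.mem_biUnion]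
      rcases he with ⟨h1, h2, h3⟩ | ⟨h1, h2, h3⟩
      · exact .inl ⟨ν, mem_downF.2 ⟨h2, h3⟩, by rwa [h1]⟩
      · exact .inr ⟨ν, mem_upF.2 ⟨h2, h3⟩, by rwa [h1, Nat.add_sub_cancel]⟩
    · exact (Finset.card_union_le _ _).trans (Nat.add_le_add
        (Finset.card_biUnion_le.trans (Finset.sum_le_sum fun ν _ => hf _))
        (Finset.card_biUnion_le.trans (Finset.sum_le_sum fun ν _ => hf _)))

instance (i : ℕ) (x : YoungDiagram × ℕ) : Finite (WPath i x) := by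
  obtain ⟨A, hA, -⟩ := WPath.exists_finset i x
  exact Set.finite_univ_iff.1 (A.finite_toSet.subset fun t _ => hA t)

theorem WPath.natCard_le (i : ℕ) (x : YoungDiagram × ℕ) :
    Nat.card (WPath i x) ≤ walkCount i x.1 := by
  obtain ⟨A, hA, hc⟩ := WPath.exists_finset i x
  rw [← Set.ncard_univ, ← Set.eq_univ_of_forall (s := (A : Set (WPath i x))) hA,
    Set.ncard_coe_finset]
  exact hc

/-- The number of pairs of paths with a common endpoint is at most `(2 * n - 1)!!`. -/
theorem natCard_pairs_le (n : ℕ) :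
    Nat.card ((x : WLam n) × WPath n x.1 × WPath n x.1) ≤ ∏ k ∈ Finset.range n, (2 * k + 1) := by
  classical
  have := Fintype.ofFinite (WLam n)
  rw [Nat.card_sigma]
  refine le_trans ?_ (sum_walkCount_sq_le n)
  refine (Finset.sum_le_sum (g := fun x : WLam n => walkCount n x.1.1 ^ 2) fun x _ => ?_).trans ?_
  · rw [Nat.card_prod, sq]
    exact Nat.mul_le_mul (WPath.natCard_le _ _) (WPath.natCard_le _ _)
  · have hinj : Function.Injective fun x : WLam n => x.1.1 := by
      rintro ⟨⟨μ, l⟩, h1, h2⟩ ⟨⟨ν, m⟩, h3, h4⟩ h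
      change μ = ν at h
      subst h
      change 2 * l ≤ n at h1
      change 2 * m ≤ n at h3
      change μ.card = n - 2 * l at h2
      change μ.card = n - 2 * m at h4
      have : l = m := by omega
      subst this
      rfl
    rw [← Finset.sum_image (s := Finset.univ) (g := fun x : WLam n => x.1.1)
      (f := fun μ => walkCount n μ ^ 2) hinj.injOn]
    refine Finset.sum_le_sum_of_subset fun μ hμ => ?_
    obtain ⟨x, -, rfl⟩ := Finset.mem_image.1 hμ
    exact mem_diagramsLE.2 (x.2.2.le.trans (Nat.sub_le _ _))

end Counting

/-- Index set for the basis of the module of cup diagrams on `2 * k` points. -/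
def CupIx : ℕ → Type
  | 0 => Unit
  | k + 1 => Fin (2 * k + 1) × CupIx k

instance CupIx.fintype : (k : ℕ) → Fintype (CupIx k)
  | 0 => inferInstanceAs (Fintype Unit)
  | k + 1 => by
    have := CupIx.fintype k
    exact inferInstanceAs (Fintype (Fin (2 * k + 1) × CupIx k))

theorem CupIx.card (k : ℕ) : Fintype.card (CupIx k) = ∏ j ∈ Finset.range k, (2 * j + 1) := by
  induction k with
  | zero => rfl
  | succ k ih =>
    rw [Finset.prod_range_succ, ← ih, mul_comm]
    exact (Fintype.card_prod _ _).trans (by rw [Fintype.card_fin])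

/-- The free module on cup diagrams on `2 * k` points. -/
abbrev CupT (R : Type*) (k : ℕ) : Type _ := CupIx k → R

section CupModule
variable {R : Type*} [CommRing R] {M : Type*} [AddCommGroup M] [Module R M] {k : ℕ}

/-- The inclusion joining the first point to the `b`-th one by an arc above everything else
(zero when `b` is out of range). -/
def cupTh (b : ℕ) : CupT R k →ₗ[R] CupT R (k + 1) where
  toFun x := fun p : Fin (2 * k + 1) × CupIx k => if p.1.val + 2 = b then x p.2 else 0
  map_add' x y := funext fun p : Fin (2 * k + 1) × CupIx k => by
    change (if p.1.val + 2 = b then x p.2 + y p.2 else 0) =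
      (if p.1.val + 2 = b then x p.2 else 0) + (if p.1.val + 2 = b then y p.2 else 0)
    split_ifs <;> simp
  map_smul' c x := funext fun p : Fin (2 * k + 1) × CupIx k => by
    change (if p.1.val + 2 = b then c * x p.2 else 0) =
      c * (if p.1.val + 2 = b then x p.2 else 0)
    split_ifs <;> simp

/-- The index in `CupIx (k + 1)` with the given components. -/
def CupIx.mk (j : Fin (2 * k + 1)) (s : CupIx k) : CupIx (k + 1) := (j, s)

/-- The coordinates of a vector along the image of `cupTh (j + 2)`. -/
def cupRes (j : Fin (2 * k + 1)) : CupT R (k + 1) →ₗ[R] CupT R k where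
  toFun x := fun s => x (CupIx.mk j s)
  map_add' _ _ := rfl
  map_smul' _ _ := rfl

theorem cupRes_cupTh (j : Fin (2 * k + 1)) (b : ℕ) (x : CupT R k) :
    cupRes j (cupTh b x) = if j.val + 2 = b then x else 0 := by
  funext s
  change (if j.val + 2 = b then x s else 0) = (if j.val + 2 = b then x else 0) s
  split_ifs <;> rfl

/-- The linear map with prescribed restrictions along the inclusions `cupTh b`. -/
def cupLift (F : ℕ → CupT R k →ₗ[R] M) : CupT R (k + 1) →ₗ[R] M :=
  ∑ j : Fin (2 * k + 1), F (j.val + 2) ∘ₗ cupRes j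

theorem cupLift_cupTh (F : ℕ → CupT R k →ₗ[R] M) {b : ℕ} (x : CupT R k) (hb : 2 ≤ b)
    (hb' : b ≤ 2 * k + 2) : cupLift F (cupTh b x) = F b x := by
  obtain ⟨b, rfl⟩ := Nat.exists_eq_add_of_le' hb
  rw [cupLift, LinearMap.sum_apply, Finset.sum_eq_single ⟨b, by omega⟩]
  · rw [LinearMap.comp_apply, cupRes_cupTh, if_pos rfl]
  · intro j _ hj
    rw [LinearMap.comp_apply, cupRes_cupTh, if_neg fun h => hj (Fin.ext (by simpa using h)),
      map_zero]
  · simp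

theorem cupRes_ext {x y : CupT R (k + 1)} (h : ∀ j, cupRes j x = cupRes j y) : x = y :=
  funext fun p => congrFun (h p.1) p.2

theorem sum_cupTh_cupRes (x : CupT R (k + 1)) :
    ∑ j : Fin (2 * k + 1), cupTh (j.val + 2) (cupRes j x) = x := by
  refine cupRes_ext fun j => ?_
  rw [map_sum, Finset.sum_eq_single j]
  · rw [cupRes_cupTh, if_pos rfl]
  · intro i _ hi
    rw [cupRes_cupTh, if_neg fun h => hi (Fin.ext (by omega))]
  · simp

theorem cup_ext {f f' : CupT R (k + 1) →ₗ[R] M}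
    (h : ∀ b x, 2 ≤ b → b ≤ 2 * k + 2 → f (cupTh b x) = f' (cupTh b x)) : f = f' := by
  refine LinearMap.ext fun x => ?_
  rw [← sum_cupTh_cupRes x, map_sum, map_sum]
  exact Finset.sum_congr rfl fun j _ => h _ _ (by omega) (by omega)

/-- The map inserting a small cup at the points `i` and `i + 1`. -/
def cupN : (k : ℕ) → ℕ → CupT R k →ₗ[R] CupT R (k + 1)
  | 0, _ => cupTh 2
  | k + 1, i => if i = 1 then cupTh 2 else cupLift fun c =>
      if c < i then cupTh c ∘ₗ cupN k (i - 2) else cupTh (c + 2) ∘ₗ cupN k (i - 1)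

theorem cupN_one (x : CupT R k) : cupN k 1 x = cupTh 2 x := by
  cases k with
  | zero => rfl
  | succ k => rw [cupN, if_pos rfl]

theorem cupN_lt {i c : ℕ} (x : CupT R k) (h2 : 2 ≤ c) (hc : c ≤ 2 * k + 2) (h : c < i) :
    cupN (k + 1) i (cupTh c x) = cupTh c (cupN k (i - 2) x) := by
  rw [cupN, if_neg (by omega), cupLift_cupTh _ _ h2 hc, if_pos h]
  rfl

theorem cupN_ge {i c : ℕ} (x : CupT R k) (hi : 2 ≤ i) (h : i ≤ c) (hc : c ≤ 2 * k + 2) :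
    cupN (k + 1) i (cupTh c x) = cupTh (c + 2) (cupN k (i - 1) x) := by
  rw [cupN, if_neg (by omega), cupLift_cupTh _ _ (by omega) hc, if_neg (by omega)]
  rfl

/-- Insertions of disjoint cups commute. -/
theorem cupN_cupN {i j : ℕ} (x : CupT R k) (hj : 1 ≤ j) (hij : j ≤ i) (hi : i ≤ 2 * k + 1) :
    cupN (k + 1) j (cupN k i x) = cupN (k + 1) (i + 2) (cupN k j x) := by
  induction k generalizing i j with
  | zero =>
    obtain rfl : i = 1 := by omega
    obtain rfl : j = 1 := by omega
    simp only [cupN_one]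
    rw [cupN_lt _ le_rfl (by omega) (by omega), cupN_one]
  | succ k ih =>
    rcases eq_or_lt_of_le hj with rfl | hj
    · rw [cupN_one, cupN_one, cupN_lt _ le_rfl (by omega) (by omega), Nat.add_sub_cancel]
    · refine LinearMap.congr_fun (cup_ext (f := cupN (k + 2) j ∘ₗ cupN (k + 1) i)
        (f' := cupN (k + 2) (i + 2) ∘ₗ cupN (k + 1) j) fun c x hc hc' => ?_) x
      simp only [LinearMap.comp_apply]
      rcases le_or_gt i c with h | h
      · rw [cupN_ge x (by omega) h hc', cupN_ge x (by omega) (by omega) hc',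
          cupN_ge _ (by omega) (by omega) (by omega), cupN_ge _ (by omega) (by omega) (by omega),
          ih x (by omega) (by omega) (by omega), show i - 1 + 2 = i + 2 - 1 by omega]
      rcases le_or_gt j c with h' | h'
      · rw [cupN_lt x (by omega) hc' h, cupN_ge x (by omega) (by omega) hc',
          cupN_ge _ (by omega) (by omega) (by omega), cupN_lt _ (by omega) (by omega) (by omega),
          ih x (by omega) (by omega) (by omega), show i - 2 + 2 = i + 2 - 2 by omega]
      · rw [cupN_lt x (by omega) hc' h, cupN_lt x (by omega) hc' h',
          cupN_lt _ (by omega) (by omega) (by omega), cupN_lt _ (by omega) (by omega) (by omega),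
          ih x (by omega) (by omega) (by omega), show i - 2 + 2 = i + 2 - 2 by omega]

end CupModule

/-- The product `f 1 * f 2 * ⋯ * f m`. -/
def prodUp {A : Type*} [Monoid A] (f : ℕ → A) : ℕ → A
  | 0 => 1
  | m + 1 => prodUp f m * f (m + 1)

/-- The product `f m * ⋯ * f 2 * f 1`. -/
def prodDown {A : Type*} [Monoid A] (f : ℕ → A) : ℕ → A
  | 0 => 1
  | m + 1 => f (m + 1) * prodDown f m

/-- The parameters of the Birman–Murakami–Wenzl algebras. -/
structure CupPar (R : Type*) [CommRing R] where
  z : Rˣ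
  q : Rˣ
  d : R
  rel : ((z⁻¹ : Rˣ) : R) - (z : R) = (((q⁻¹ : Rˣ) : R) - (q : R)) * (d - 1)

namespace CupPar
variable {R : Type*} [CommRing R] (P : CupPar R) {k : ℕ}

/-- The inverse of the parameter `z`. -/
def zi : R := ((P.z⁻¹ : Rˣ) : R)

/-- The skein parameter `q - q⁻¹`. -/
def h : R := (P.q : R) - ((P.q⁻¹ : Rˣ) : R)

theorem z_mul_zi : (P.z : R) * P.zi = 1 := P.z.mul_inv

theorem zi_eq : P.zi = P.z + P.h * (1 - P.d) := by
  have := P.rel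
  rw [zi, h]
  linear_combination this

/-- The operators `g i` and `e i` on the module of cup diagrams. -/
noncomputable def ops : (k : ℕ) →
    (ℕ → Module.End R (CupT R k)) × (ℕ → Module.End R (CupT R k))
  | 0 => (0, 0)
  | k + 1 =>
    let g := (ops k).1
    let e := (ops k).2
    let p := prodUp fun j => g j - P.h • (1 : Module.End R (CupT R k)) + P.h • e j
    let G : ℕ → Module.End R (CupT R (k + 1)) := fun i => cupLift fun b =>
      if i + 1 < b then cupTh b ∘ₗ g (i - 1)
      else if b < i then cupTh b ∘ₗ g (i - 2)
      else if b = i then cupTh (b + 1)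
      else cupTh i + P.h • (cupTh (i + 1) - P.zi • (cupN k i ∘ₗ p (i - 2)))
    let E : ℕ → Module.End R (CupT R (k + 1)) := fun i => cupLift fun b =>
      if i + 1 < b then cupTh b ∘ₗ e (i - 1)
      else if b < i then cupTh b ∘ₗ e (i - 2)
      else if b = i then cupN k i ∘ₗ p (i - 2)
      else P.zi • (cupN k i ∘ₗ p (i - 2))
    (fun i => if i = 1 then cupLift fun b =>
        if b = 2 then P.zi • cupTh 2
        else prodDown (fun j => G (j + 2)) (b - 3) ∘ₗ cupN k 2
      else G i,
     fun i => if i = 1 then cupLift fun b =>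
        if b = 2 then P.d • cupTh 2
        else (P.z : R) • (cupTh 2 ∘ₗ prodDown g (b - 3))
      else E i)

/-- The braid generator on cup diagrams. -/
noncomputable def g (i : ℕ) : Module.End R (CupT R k) := (P.ops k).1 i

/-- The cup-cap generator on cup diagrams. -/
noncomputable def e (i : ℕ) : Module.End R (CupT R k) := (P.ops k).2 i

/-- The inverse braid generator on cup diagrams. -/
noncomputable def gi (i : ℕ) : Module.End R (CupT R k) :=
  P.g i - P.h • (1 : Module.End R (CupT R k)) + P.h • P.e i

/-- The product `g₁⁻¹ ⋯ g_m⁻¹`. -/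
noncomputable def p (m : ℕ) : Module.End R (CupT R k) := prodUp P.gi m

/-- The product `g_m ⋯ g₁`. -/
noncomputable def r (m : ℕ) : Module.End R (CupT R k) := prodDown P.g m

theorem gi_apply (i : ℕ) (x : CupT R k) : P.gi i x = P.g i x - P.h • x + P.h • P.e i x := rfl

theorem p_zero (x : CupT R k) : P.p 0 x = x := rfl

theorem p_succ (m : ℕ) (x : CupT R k) : P.p (m + 1) x = P.p m (P.gi (m + 1) x) := rfl

theorem r_zero (x : CupT R k) : P.r 0 x = x := rfl

theorem r_succ (m : ℕ) (x : CupT R k) : P.r (m + 1) x = P.g (m + 1) (P.r m x) := rfl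

variable {P} {i b : ℕ} (x : CupT R k)

theorem g_cupTh_lt (hi : 2 ≤ i) (hib : i + 1 < b) (hb : b ≤ 2 * k + 2) :
    P.g i (cupTh b x) = cupTh b (P.g (i - 1) x) := by
  change (if i = 1 then _ else _ : Module.End R (CupT R (k + 1))) _ = _
  rw [if_neg (by omega), cupLift_cupTh _ _ (by omega) hb, if_pos hib]
  rfl

theorem g_cupTh_gt (h2 : 2 ≤ b) (hib : b < i) (hb : b ≤ 2 * k + 2) :
    P.g i (cupTh b x) = cupTh b (P.g (i - 2) x) := by
  change (if i = 1 then _ else _ : Module.End R (CupT R (k + 1))) _ = _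
  rw [if_neg (by omega), cupLift_cupTh _ _ (by omega) hb, if_neg (by omega), if_pos hib]
  rfl

theorem g_cupTh_self (h2 : 2 ≤ b) (hb : b ≤ 2 * k + 2) :
    P.g b (cupTh b x) = cupTh (b + 1) x := by
  change (if b = 1 then _ else _ : Module.End R (CupT R (k + 1))) _ = _
  rw [if_neg (by omega), cupLift_cupTh _ _ (by omega) hb, if_neg (by omega), if_neg (by omega),
    if_pos rfl]

theorem g_cupTh_succ (h2 : 2 ≤ i) (hb : i + 1 ≤ 2 * k + 2) :
    P.g i (cupTh (i + 1) x) =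
      cupTh i x + P.h • (cupTh (i + 1) x - P.zi • cupN k i (P.p (i - 2) x)) := by
  change (if i = 1 then _ else _ : Module.End R (CupT R (k + 1))) _ = _
  rw [if_neg (by omega), cupLift_cupTh _ _ (by omega) hb, if_neg (by omega), if_neg (by omega),
    if_neg (by omega)]
  rfl

theorem g_one_cupTh_two : P.g 1 (cupTh 2 x) = P.zi • cupTh 2 x := by
  change (if 1 = 1 then _ else _ : Module.End R (CupT R (k + 1))) _ = _
  rw [if_pos rfl, cupLift_cupTh _ _ (by omega) (by omega), if_pos rfl]
  rfl

theorem g_one_cupTh_three (hk : 1 ≤ k) : P.g 1 (cupTh 3 x) = cupN k 2 x := by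
  change (if 1 = 1 then _ else _ : Module.End R (CupT R (k + 1))) _ = _
  rw [if_pos rfl, cupLift_cupTh _ _ (by omega) (by omega), if_neg (by omega)]
  rfl

theorem g_one_cupTh_add_one (h3 : 3 ≤ b) (hb : b + 1 ≤ 2 * k + 2) :
    P.g 1 (cupTh (b + 1) x) = P.g b (P.g 1 (cupTh b x)) := by
  obtain ⟨b, rfl⟩ := Nat.exists_eq_add_of_le' h3
  change (if 1 = 1 then _ else _ : Module.End R (CupT R (k + 1))) _ =
    P.g (b + 3) ((if 1 = 1 then _ else _ : Module.End R (CupT R (k + 1))) _)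
  rw [if_pos rfl, cupLift_cupTh _ _ (by omega) (by omega),
    if_neg (by omega), cupLift_cupTh (b := b + 3) _ _ (by omega) (by omega), if_neg (by omega)]
  rfl

theorem e_cupTh_lt (hi : 2 ≤ i) (hib : i + 1 < b) (hb : b ≤ 2 * k + 2) :
    P.e i (cupTh b x) = cupTh b (P.e (i - 1) x) := by
  change (if i = 1 then _ else _ : Module.End R (CupT R (k + 1))) _ = _
  rw [if_neg (by omega), cupLift_cupTh _ _ (by omega) hb, if_pos hib]
  rfl

theorem e_cupTh_gt (h2 : 2 ≤ b) (hib : b < i) (hb : b ≤ 2 * k + 2) :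
    P.e i (cupTh b x) = cupTh b (P.e (i - 2) x) := by
  change (if i = 1 then _ else _ : Module.End R (CupT R (k + 1))) _ = _
  rw [if_neg (by omega), cupLift_cupTh _ _ (by omega) hb, if_neg (by omega), if_pos hib]
  rfl

theorem e_cupTh_self (h2 : 2 ≤ b) (hb : b ≤ 2 * k + 2) :
    P.e b (cupTh b x) = cupN k b (P.p (b - 2) x) := by
  change (if b = 1 then _ else _ : Module.End R (CupT R (k + 1))) _ = _
  rw [if_neg (by omega), cupLift_cupTh _ _ (by omega) hb, if_neg (by omega), if_neg (by omega),
    if_pos rfl]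
  rfl

theorem e_cupTh_succ (h2 : 2 ≤ i) (hb : i + 1 ≤ 2 * k + 2) :
    P.e i (cupTh (i + 1) x) = P.zi • cupN k i (P.p (i - 2) x) := by
  change (if i = 1 then _ else _ : Module.End R (CupT R (k + 1))) _ = _
  rw [if_neg (by omega), cupLift_cupTh _ _ (by omega) hb, if_neg (by omega), if_neg (by omega),
    if_neg (by omega)]
  rfl

theorem e_one_cupTh_two : P.e 1 (cupTh 2 x) = P.d • cupTh 2 x := by
  change (if 1 = 1 then _ else _ : Module.End R (CupT R (k + 1))) _ = _
  rw [if_pos rfl, cupLift_cupTh _ _ (by omega) (by omega), if_pos rfl]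
  rfl

theorem e_one_cupTh (h3 : 3 ≤ b) (hb : b ≤ 2 * k + 2) :
    P.e 1 (cupTh b x) = (P.z : R) • cupTh 2 (P.r (b - 3) x) := by
  change (if 1 = 1 then _ else _ : Module.End R (CupT R (k + 1))) _ = _
  rw [if_pos rfl, cupLift_cupTh _ _ (by omega) (by omega), if_neg (by omega)]
  rfl

theorem exists_of_cupTh {M N : Type*} [AddCommGroup M] [Module R M] [AddCommGroup N] [Module R N]
    {f : CupT R (k + 1) →ₗ[R] M} {F : N →ₗ[R] M}
    (key : ∀ b x, 2 ≤ b → b ≤ 2 * k + 2 → ∃ u, f (cupTh b x) = F u) (y : CupT R (k + 1)) :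
    ∃ u, f y = F u := by
  choose! u hu using key
  refine ⟨∑ j : Fin (2 * k + 1), u (j.val + 2) (cupRes j y), ?_⟩
  conv_lhs => rw [← sum_cupTh_cupRes y]
  rw [map_sum, map_sum]
  exact Finset.sum_congr rfl fun j _ => hu _ _ (by omega) (by omega)

/-- The image of `e i` consists of diagrams with a small cup. -/
theorem exists_e_eq (hi : 1 ≤ i) (hi' : i ≤ 2 * k + 1) (y : CupT R (k + 1)) :
    ∃ u, P.e i y = cupN k i u := by
  induction k generalizing i with
  | zero =>
    refine exists_of_cupTh (fun b x hb hb' => ?_) y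
    obtain rfl : i = 1 := by omega
    obtain rfl : b = 2 := by omega
    exact ⟨P.d • x, by rw [e_one_cupTh_two, map_smul, cupN_one]⟩
  | succ k ih' =>
    refine exists_of_cupTh (fun b x hb hb' => ?_) y
    rcases eq_or_lt_of_le hi with rfl | hi
    · rcases eq_or_lt_of_le hb with rfl | hb
      · exact ⟨P.d • x, by rw [e_one_cupTh_two, map_smul, cupN_one]⟩
      · exact ⟨(P.z : R) • P.r (b - 3) x, by rw [e_one_cupTh _ hb hb', map_smul, cupN_one]⟩
    rcases lt_trichotomy b i with h | rfl | h
    · obtain ⟨u, hu⟩ := ih' (i := i - 2) (by omega) (by omega) x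
      exact ⟨cupTh b u, by rw [e_cupTh_gt _ hb h hb', hu, cupN_lt _ hb (by omega) h]⟩
    · exact ⟨_, e_cupTh_self _ hb hb'⟩
    rcases eq_or_lt_of_le (Nat.succ_le_of_lt h) with rfl | h
    · exact ⟨P.zi • P.p (i - 2) x, by rw [e_cupTh_succ _ hi hb', map_smul]⟩
    · obtain ⟨u, hu⟩ := ih' (i := i - 1) (by omega) (by omega) x
      refine ⟨cupTh (b - 2) u, ?_⟩
      rw [e_cupTh_lt _ hi h hb', hu, cupN_ge _ hi (by omega) (by omega),
        show b - 2 + 2 = b by omega]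

end CupPar

namespace CupPar
variable {R : Type*} [CommRing R] {P : CupPar R} {k : ℕ}

/-- The braid, skein and untwisting relations for the operators on cup diagrams. -/
structure RelA (P : CupPar R) (k : ℕ) : Prop where
  quad : ∀ {i} (y : CupT R k), 1 ≤ i → i + 1 ≤ 2 * k →
    P.g i (P.g i y) = y + P.h • (P.g i y - P.zi • P.e i y)
  braid : ∀ {i} (y : CupT R k), 1 ≤ i → i + 2 ≤ 2 * k →
    P.g i (P.g (i + 1) (P.g i y)) = P.g (i + 1) (P.g i (P.g (i + 1) y))
  far : ∀ {i j} (y : CupT R k), 1 ≤ i → i + 1 < j → j + 1 ≤ 2 * k →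
    P.g i (P.g j y) = P.g j (P.g i y)
  ge : ∀ {i} (y : CupT R k), 1 ≤ i → i + 1 ≤ 2 * k → P.g i (P.e i y) = P.zi • P.e i y

namespace RelA
variable (A : RelA P k) {i j m : ℕ} (y : CupT R k)
include A

theorem g_gi (hi : 1 ≤ i) (hi' : i + 1 ≤ 2 * k) : P.g i (P.gi i y) = y := by
  rw [gi_apply, map_add, map_sub, map_smul, map_smul, A.quad y hi hi', A.ge y hi hi']
  module

theorem gi_g (hi : 1 ≤ i) (hi' : i + 1 ≤ 2 * k) : P.gi i (P.g i y) = y := by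
  have h : P.g i * P.gi i = (1 : Module.End R (CupT R k)) :=
    LinearMap.ext fun y => A.g_gi y hi hi'
  exact LinearMap.congr_fun (mul_eq_one_comm.1 h) y

theorem gi_g_far (hi : 1 ≤ i) (hij : i + 1 < j) (hj : j + 1 ≤ 2 * k) :
    P.gi i (P.g j y) = P.g j (P.gi i y) := by
  conv_lhs => rw [← A.g_gi y hi (by omega), ← A.far _ hi hij hj, A.gi_g _ hi (by omega)]

theorem gi_g_far' (hi : 1 ≤ i) (hij : i + 1 < j) (hj : j + 1 ≤ 2 * k) :
    P.gi j (P.g i y) = P.g i (P.gi j y) := by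
  conv_lhs => rw [← A.g_gi y (i := j) (by omega) hj, A.far _ hi hij hj, A.gi_g _ (by omega) hj]

theorem p_g_far (hm : m + 1 < j) (hj : j + 1 ≤ 2 * k) :
    P.p m (P.g j y) = P.g j (P.p m y) := by
  induction m generalizing y with
  | zero => rfl
  | succ m ih => rw [p_succ, p_succ, A.gi_g_far y (by omega) hm hj, ih _ (by omega)]

theorem gi_gi_g (hi : 1 ≤ i) (hi' : i + 2 ≤ 2 * k) :
    P.gi i (P.gi (i + 1) (P.g i y)) = P.g (i + 1) (P.gi i (P.gi (i + 1) y)) := by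
  conv_lhs => rw [← A.g_gi y (i := i + 1) (by omega) hi',
    ← A.g_gi (P.gi (i + 1) y) (i := i) (by omega) (by omega), A.braid _ hi hi',
    A.gi_g _ (by omega) (by omega), A.gi_g _ (by omega) (by omega)]

theorem p_g (hi : 1 ≤ i) (him : i + 1 ≤ m) (hm : m + 1 ≤ 2 * k) :
    P.p m (P.g i y) = P.g (i + 1) (P.p m y) := by
  induction m generalizing y with
  | zero => omega
  | succ m ih =>
    rcases eq_or_lt_of_le him with h | h
    · obtain rfl : i = m := by omega
      obtain ⟨i, rfl⟩ := Nat.exists_eq_add_of_le' hi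
      rw [p_succ, p_succ, p_succ, p_succ, A.gi_gi_g _ hi (by omega),
        A.p_g_far _ (by omega) (by omega)]
    · rw [p_succ, p_succ, A.gi_g_far' _ hi h hm, ih _ (by omega) (by omega)]

end RelA

variable {i j b c m : ℕ} (x : CupT R k)

theorem g_cupTh_lt' (hi : 1 ≤ i) (hib : i + 2 < b) (hb : b ≤ 2 * k + 2) :
    P.g (i + 1) (cupTh b x) = cupTh b (P.g i x) :=
  g_cupTh_lt x (by omega) (by omega) hb

theorem g_cupTh_gt' (h2 : 2 ≤ b) (hib : b < i + 2) (hb : b ≤ 2 * k + 2) :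
    P.g (i + 2) (cupTh b x) = cupTh b (P.g i x) :=
  g_cupTh_gt x h2 hib hb

theorem g_cupTh_succ' (hb : i + 3 ≤ 2 * k + 2) :
    P.g (i + 2) (cupTh (i + 3) x) =
      cupTh (i + 2) x + P.h • (cupTh (i + 3) x - P.zi • cupN k (i + 2) (P.p i x)) :=
  g_cupTh_succ x (by omega) hb

theorem e_cupTh_lt' (hi : 1 ≤ i) (hib : i + 2 < b) (hb : b ≤ 2 * k + 2) :
    P.e (i + 1) (cupTh b x) = cupTh b (P.e i x) :=
  e_cupTh_lt x (by omega) (by omega) hb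

theorem e_cupTh_gt' (h2 : 2 ≤ b) (hib : b < i + 2) (hb : b ≤ 2 * k + 2) :
    P.e (i + 2) (cupTh b x) = cupTh b (P.e i x) :=
  e_cupTh_gt x h2 hib hb

theorem e_cupTh_self' (hb : i + 2 ≤ 2 * k + 2) :
    P.e (i + 2) (cupTh (i + 2) x) = cupN k (i + 2) (P.p i x) :=
  e_cupTh_self x (by omega) hb

theorem e_cupTh_succ' (hb : i + 3 ≤ 2 * k + 2) :
    P.e (i + 2) (cupTh (i + 3) x) = P.zi • cupN k (i + 2) (P.p i x) :=
  e_cupTh_succ x (by omega) hb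

theorem _root_.cupN_lt' (h2 : 2 ≤ c) (hc : c ≤ 2 * k + 2) (h : c < i + 2) :
    cupN (k + 1) (i + 2) (cupTh c x) = cupTh c (cupN k i x) :=
  cupN_lt x h2 hc h

theorem _root_.cupN_ge' (hi : 1 ≤ i) (h : i + 1 ≤ c) (hc : c ≤ 2 * k + 2) :
    cupN (k + 1) (i + 1) (cupTh c x) = cupTh (c + 2) (cupN k i x) :=
  cupN_ge x (by omega) h hc

/-- The relations between the operators on cup diagrams and the insertion of cups. -/
structure RelB (P : CupPar R) (k : ℕ) : Prop where
  tw : ∀ {i} (x : CupT R k), 1 ≤ i → i ≤ 2 * k + 1 →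
    P.g i (cupN k i x) = P.zi • cupN k i x
  up : ∀ {i} (x : CupT R k), 1 ≤ i → i ≤ 2 * k →
    P.g i (P.g (i + 1) (cupN k i x)) = cupN k (i + 1) x
  slide : ∀ {i} (x : CupT R k), 1 ≤ i → i ≤ 2 * k →
    P.g i (cupN k (i + 1) x) =
      P.g (i + 1) (cupN k i x) - P.h • cupN k i x + P.h • cupN k (i + 1) x
  down : ∀ {i} (x : CupT R k), 1 ≤ i → i ≤ 2 * k →
    P.g (i + 1) (P.g i (cupN k (i + 1) x)) = cupN k i x
  far_gt : ∀ {i j} (x : CupT R k), 1 ≤ j → i + 2 ≤ 2 * k + 1 → j < i + 1 →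
    P.g (i + 2) (cupN k j x) = cupN k j (P.g i x)
  far_lt : ∀ {i j} (x : CupT R k), 1 ≤ i → i + 1 < j → j ≤ 2 * k + 1 →
    P.g i (cupN k j x) = cupN k j (P.g i x)

namespace RelB
variable (B : RelB P k) (A' : RelA P (k + 1)) (A : RelA P k)
include B A'

theorem gi_tw (hi : 1 ≤ i) (hi' : i ≤ 2 * k + 1) :
    P.gi i (cupN k i x) = (P.z : R) • cupN k i x := by
  have := congrArg (fun y => (P.z : R) • P.gi i y) (B.tw x hi hi')
  simp only [A'.gi_g _ hi (by omega : i + 1 ≤ 2 * (k + 1)), map_smul, smul_smul, z_mul_zi,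
    one_smul] at this
  exact this.symm

theorem gi_up (hi : 1 ≤ i) (hi' : i ≤ 2 * k) :
    P.gi i (cupN k (i + 1) x) = P.g (i + 1) (cupN k i x) := by
  rw [← B.up x hi hi', A'.gi_g _ hi (by omega)]

theorem gi_down (hi : 1 ≤ i) (hi' : i ≤ 2 * k) :
    P.gi i (P.gi (i + 1) (cupN k i x)) = cupN k (i + 1) x := by
  rw [← B.down x hi hi', A'.gi_g _ (by omega) (by omega), A'.gi_g _ hi (by omega)]

/-- Braiding a small cup to the front. -/
theorem p_cupN (hm : m ≤ 2 * k) : P.p m (cupN k (m + 1) x) = cupTh (m + 2) x := by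
  induction m with
  | zero => exact cupN_one x
  | succ m ih =>
    rw [p_succ, B.gi_up _ A' (by omega) hm, A'.p_g_far _ (by omega) (by omega), ih (by omega),
      g_cupTh_self _ (by omega) (by omega)]

include A

theorem gi_far_gt (hj : 1 ≤ j) (hi : i + 2 ≤ 2 * k + 1) (h : j < i + 1) :
    P.gi (i + 2) (cupN k j x) = cupN k j (P.gi i x) := by
  conv_lhs => rw [← A.g_gi x (i := i) (by omega) (by omega),
    ← B.far_gt _ hj hi h, A'.gi_g _ (by omega) (by omega)]

theorem gi_far_lt (hi : 1 ≤ i) (h : i + 1 < j) (hj : j ≤ 2 * k + 1) :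
    P.gi i (cupN k j x) = cupN k j (P.gi i x) := by
  conv_lhs => rw [← A.g_gi x (i := i) (by omega) (by omega),
    ← B.far_lt _ hi h hj, A'.gi_g _ (by omega) (by omega)]

theorem p_far_lt (h : m + 1 < j) (hj : j ≤ 2 * k + 1) :
    P.p m (cupN k j x) = cupN k j (P.p m x) := by
  induction m generalizing x with
  | zero => rfl
  | succ m ih => rw [p_succ, p_succ, B.gi_far_lt _ A' A (by omega) h hj, ih _ (by omega)]

theorem p_cupN_gt (hj : 1 ≤ j) (hjm : j + 1 ≤ m) (hm : m ≤ 2 * k + 1) :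
    P.p m (cupN k j x) = cupN k (j + 1) (P.p (m - 2) x) := by
  induction m generalizing x with
  | zero => omega
  | succ m ih =>
    rcases eq_or_lt_of_le hjm with h | h
    · obtain rfl : j = m := by omega
      obtain ⟨j, rfl⟩ := Nat.exists_eq_add_of_le' hj
      rw [p_succ, p_succ, B.gi_down _ A' (by omega) (by omega),
        B.p_far_lt _ A' A (by omega) (by omega)]
      rfl
    · obtain ⟨m, rfl⟩ : ∃ m', m = m' + 2 := ⟨m - 2, by omega⟩
      rw [p_succ, B.gi_far_gt _ A' A hj hm (by omega), ih _ (by omega) (by omega)]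
      rfl

end RelB
end CupPar

theorem cup_ind {R M : Type*} [CommRing R] [AddCommGroup M] [Module R M] {k : ℕ}
    (f f' : CupT R (k + 1) →ₗ[R] M)
    (h : ∀ b x, 2 ≤ b → b ≤ 2 * k + 2 → f (cupTh b x) = f' (cupTh b x)) (x : CupT R (k + 1)) :
    f x = f' x :=
  LinearMap.congr_fun (cup_ext h) x

namespace CupPar
variable {R : Type*} [CommRing R] {P : CupPar R} {k : ℕ}

theorem zi_smul_z_smul {M : Type*} [AddCommGroup M] [Module R M] (x : M) :
    P.zi • (P.z : R) • x = x := by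
  rw [smul_smul, mul_comm, z_mul_zi, one_smul]

namespace RelB
variable {i j a c m : ℕ} (x : CupT R (k + 1)) (y : CupT R k)
  (B : RelB P k) (A' : RelA P (k + 1)) (A : RelA P k)
include B

theorem tw_succ (hi : 1 ≤ i) (hi' : i ≤ 2 * (k + 1) + 1) :
    P.g i (cupN (k + 1) i x) = P.zi • cupN (k + 1) i x := by
  rcases eq_or_lt_of_le hi with rfl | hi
  · rw [cupN_one, g_one_cupTh_two]
  refine cup_ind (P.g i ∘ₗ cupN (k + 1) i) (P.zi • cupN (k + 1) i) (fun c y hc hc' => ?_) x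
  simp only [LinearMap.comp_apply, LinearMap.smul_apply]
  rcases lt_or_ge c i with h | h
  · obtain ⟨i, rfl⟩ := Nat.exists_eq_add_of_le' hi
    rw [cupN_lt' _ hc hc' h, g_cupTh_gt' _ hc h (by omega), B.tw _ (by omega) (by omega),
      map_smul]
  · obtain ⟨i, rfl⟩ := Nat.exists_eq_add_of_le' hi
    rw [cupN_ge' _ (by omega) h hc', g_cupTh_lt' _ (by omega) (by omega) (by omega),
      B.tw _ (by omega) (by omega), map_smul]

theorem g_cupTh_cupN_two (ha : a ≤ 2 * k) :
    P.g (a + 2) (cupTh (a + 4) (cupN k (a + 1) y)) =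
      P.zi • cupTh (a + 4) (cupN k (a + 1) y) := by
  rw [g_cupTh_lt' _ (by omega) (by omega) (by omega), B.tw _ (by omega) (by omega), map_smul]

include A'

theorem g_cupTh_cupN_three (ha : a ≤ 2 * k) :
    P.g (a + 3) (cupTh (a + 4) (cupN k (a + 1) y)) =
      cupTh (a + 3) (cupN k (a + 1) y) + P.h • cupTh (a + 4) (cupN k (a + 1) y) -
        P.h • cupTh (a + 2) (cupN k (a + 1) y) := by
  rw [g_cupTh_succ' _ (by omega), p_succ, B.gi_tw _ A' (by omega) (by omega), map_smul, map_smul,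
    zi_smul_z_smul, B.p_cupN _ A' (by omega), cupN_lt' _ (by omega) (by omega) (by omega)]
  module

theorem g_cupTh_cupN_one (ha : a ≤ 2 * k) :
    P.g (a + 2) (cupTh (a + 3) (cupN k (a + 1) y)) =
      cupTh (a + 2) (cupN k (a + 1) y) + P.h • (cupTh (a + 3) (cupN k (a + 1) y) -
        P.zi • cupTh (a + 4) (cupN k (a + 1) y)) := by
  rw [g_cupTh_succ' _ (by omega), B.p_cupN _ A' (by omega),
    cupN_ge' _ (by omega) (by omega) (by omega)]

theorem up_succ (hi : 1 ≤ i) (hi' : i ≤ 2 * (k + 1)) :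
    P.g i (P.g (i + 1) (cupN (k + 1) i x)) = cupN (k + 1) (i + 1) x := by
  rcases eq_or_lt_of_le hi with rfl | hi
  · rw [cupN_one, g_cupTh_self _ (by omega) (by omega), g_one_cupTh_three _ (by omega)]
  refine cup_ind (P.g i ∘ₗ P.g (i + 1) ∘ₗ cupN (k + 1) i) (cupN (k + 1) (i + 1))
    (fun c y hc hc' => ?_) x
  simp only [LinearMap.comp_apply]
  rcases lt_trichotomy c i with h | rfl | h
  · obtain ⟨i, rfl⟩ : ∃ j, i = j + 3 := ⟨i - 3, by omega⟩
    rw [cupN_lt' _ hc hc' h, g_cupTh_gt' _ hc (by omega) (by omega),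
      g_cupTh_gt' _ hc (by omega) (by omega), B.up _ (by omega) (by omega),
      cupN_lt' _ hc hc' (by omega)]
  · obtain ⟨c, rfl⟩ := Nat.exists_eq_add_of_le' hc
    rw [cupN_ge' _ (by omega) (by omega) hc', B.g_cupTh_cupN_three _ A' (by omega), map_sub,
      map_add, map_smul, map_smul, B.g_cupTh_cupN_one _ A' (by omega),
      B.g_cupTh_cupN_two _ (by omega), g_cupTh_self _ (by omega) (by omega),
      cupN_lt' _ (by omega) (by omega) (by omega)]
    module
  · obtain ⟨i, rfl⟩ := Nat.exists_eq_add_of_le' hi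
    rw [cupN_ge' _ (by omega) (by omega) hc', g_cupTh_lt' _ (by omega) (by omega) (by omega),
      g_cupTh_lt' _ (by omega) (by omega) (by omega), B.up _ (by omega) (by omega),
      cupN_ge' _ (by omega) (by omega) hc']

theorem g_one_cupN_two : P.g 1 (cupN (k + 1) 2 x) =
    cupTh 3 x - P.h • cupTh 2 x + P.h • cupN (k + 1) 2 x := by
  refine cup_ind (P.g 1 ∘ₗ cupN (k + 1) 2) (cupTh 3 - P.h • cupTh 2 + P.h • cupN (k + 1) 2)
    (fun c y hc hc' => ?_) x
  simp only [LinearMap.comp_apply, LinearMap.add_apply, LinearMap.sub_apply,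
    LinearMap.smul_apply]
  induction c, hc using Nat.le_induction with
  | base =>
    rw [cupN_ge' _ le_rfl le_rfl hc', cupN_one, g_one_cupTh_add_one _ le_rfl (by omega),
      g_one_cupTh_three _ (by omega), cupN_ge' _ le_rfl le_rfl hc', cupN_one]
    have := B.g_cupTh_cupN_three (a := 0) y A' (by omega)
    rw [zero_add, cupN_one] at this
    linear_combination (norm := module) this
  | succ c hc ih =>
    have ih := congrArg (P.g (c + 2)) (ih (by omega))
    rw [cupN_ge' _ le_rfl (by omega) (by omega), ← g_one_cupTh_add_one _ (by omega) (by omega),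
      map_add, map_sub, map_smul, map_smul, g_cupTh_gt' _ (by omega) (by omega) (by omega),
      g_cupTh_gt' _ (by omega) (by omega) (by omega), g_cupTh_self _ (by omega) (by omega),
      g_cupTh_self _ (by omega) (by omega)] at ih
    rw [cupN_ge' _ le_rfl (by omega) (by omega)]
    exact ih

theorem slide_succ (hi : 1 ≤ i) (hi' : i ≤ 2 * (k + 1)) :
    P.g i (cupN (k + 1) (i + 1) x) = P.g (i + 1) (cupN (k + 1) i x) -
      P.h • cupN (k + 1) i x + P.h • cupN (k + 1) (i + 1) x := by
  rcases eq_or_lt_of_le hi with rfl | hi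
  · rw [cupN_one, g_cupTh_self _ (by omega) (by omega), B.g_one_cupN_two _ A']
  refine cup_ind (P.g i ∘ₗ cupN (k + 1) (i + 1)) (P.g (i + 1) ∘ₗ cupN (k + 1) i -
      P.h • cupN (k + 1) i + P.h • cupN (k + 1) (i + 1)) (fun c y hc hc' => ?_) x
  simp only [LinearMap.comp_apply, LinearMap.add_apply, LinearMap.sub_apply,
    LinearMap.smul_apply]
  rcases lt_trichotomy c i with h | rfl | h
  · obtain ⟨i, rfl⟩ : ∃ j, i = j + 3 := ⟨i - 3, by omega⟩
    rw [cupN_lt' _ hc hc' (by omega), cupN_lt' _ hc hc' h,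
      g_cupTh_gt' _ hc (by omega) (by omega), g_cupTh_gt' _ hc (by omega) (by omega),
      B.slide _ (by omega) (by omega), map_add, map_sub, map_smul, map_smul]
  · obtain ⟨c, rfl⟩ := Nat.exists_eq_add_of_le' hc
    rw [cupN_lt' _ (by omega) hc' (by omega), cupN_ge' _ (by omega) (by omega) hc',
      B.g_cupTh_cupN_three _ A' (by omega), g_cupTh_self _ (by omega) (by omega)]
    module
  · obtain ⟨i, rfl⟩ := Nat.exists_eq_add_of_le' hi
    rw [cupN_ge' _ (by omega) (by omega) hc', cupN_ge' _ (by omega) (by omega) hc',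
      g_cupTh_lt' _ (by omega) (by omega) (by omega),
      g_cupTh_lt' _ (by omega) (by omega) (by omega),
      B.slide _ (by omega) (by omega), map_add, map_sub, map_smul, map_smul]

theorem down_succ (hi : 1 ≤ i) (hi' : i ≤ 2 * (k + 1)) :
    P.g (i + 1) (P.g i (cupN (k + 1) (i + 1) x)) = cupN (k + 1) i x := by
  rcases eq_or_lt_of_le hi with rfl | hi
  · have h := g_cupTh_succ' (P := P) (i := 0) x (by omega)
    rw [p_zero] at h
    rw [B.g_one_cupN_two _ A', map_add, map_sub, map_smul, map_smul, h,
      g_cupTh_self _ (by omega) (by omega), B.tw_succ _ (by omega) (by omega), cupN_one]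
    module
  refine cup_ind (P.g (i + 1) ∘ₗ P.g i ∘ₗ cupN (k + 1) (i + 1)) (cupN (k + 1) i)
    (fun c y hc hc' => ?_) x
  simp only [LinearMap.comp_apply]
  rcases lt_trichotomy c i with h | rfl | h
  · obtain ⟨i, rfl⟩ : ∃ j, i = j + 3 := ⟨i - 3, by omega⟩
    rw [cupN_lt' _ hc hc' (by omega), g_cupTh_gt' _ hc (by omega) (by omega),
      g_cupTh_gt' _ hc (by omega) (by omega), B.down _ (by omega) (by omega),
      cupN_lt' _ hc hc' (by omega)]
  · obtain ⟨c, rfl⟩ := Nat.exists_eq_add_of_le' hc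
    rw [cupN_lt' _ (by omega) hc' (by omega), cupN_ge' _ (by omega) (by omega) hc',
      g_cupTh_self _ (by omega) (by omega), g_cupTh_self _ (by omega) (by omega)]
  · obtain ⟨i, rfl⟩ := Nat.exists_eq_add_of_le' hi
    rw [cupN_ge' _ (by omega) (by omega) hc', g_cupTh_lt' _ (by omega) (by omega) (by omega),
      g_cupTh_lt' _ (by omega) (by omega) (by omega), B.down _ (by omega) (by omega),
      cupN_ge' _ (by omega) (by omega) hc']

end RelB
end CupPar

namespace CupPar
variable {R : Type*} [CommRing R] {P : CupPar R} {k : ℕ}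

namespace RelB
variable {i j a c m : ℕ} (x : CupT R (k + 1)) (y : CupT R k)
  (B : RelB P k) (A' : RelA P (k + 1)) (A : RelA P k)
include B A' A

theorem far_gt_succ (hj : 1 ≤ j) (hi : i + 2 ≤ 2 * (k + 1) + 1) (hij : j < i + 1) :
    P.g (i + 2) (cupN (k + 1) j x) = cupN (k + 1) j (P.g i x) := by
  rcases eq_or_lt_of_le hj with rfl | hj
  · rw [cupN_one, cupN_one, g_cupTh_gt' _ le_rfl (by omega) (by omega)]
  refine cup_ind (P.g (i + 2) ∘ₗ cupN (k + 1) j) (cupN (k + 1) j ∘ₗ P.g i)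
    (fun c y hc hc' => ?_) x
  simp only [LinearMap.comp_apply]
  rcases lt_or_ge c j with h | h
  · obtain ⟨j, rfl⟩ := Nat.exists_eq_add_of_le' hj
    obtain ⟨i, rfl⟩ : ∃ l, i = l + 2 := ⟨i - 2, by omega⟩
    rw [cupN_lt' _ hc hc' h, g_cupTh_gt' _ hc (by omega) (by omega),
      g_cupTh_gt' _ hc (by omega) (by omega), B.far_gt _ (by omega) (by omega) (by omega),
      cupN_lt' _ hc hc' h]
  obtain ⟨j, rfl⟩ : ∃ l, j = l + 1 := ⟨j - 1, by omega⟩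
  rw [cupN_ge' _ (by omega) h hc']
  rcases lt_trichotomy c i with h' | rfl | h'
  · obtain ⟨i, rfl⟩ : ∃ l, i = l + 2 := ⟨i - 2, by omega⟩
    rw [g_cupTh_gt' _ (by omega) (by omega) (by omega), g_cupTh_gt' _ hc (by omega) (by omega),
      B.far_gt _ (by omega) (by omega) (by omega), cupN_ge' _ (by omega) h hc']
  · rw [g_cupTh_self _ (by omega) (by omega), g_cupTh_self _ (by omega) (by omega),
      cupN_ge' _ (by omega) (by omega) (by omega)]
  rcases eq_or_lt_of_le (Nat.succ_le_of_lt h') with rfl | h'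
  · obtain ⟨i, rfl⟩ : ∃ l, i = l + 2 := ⟨i - 2, by omega⟩
    rw [g_cupTh_succ' _ (by omega), g_cupTh_succ' _ (by omega),
      B.p_cupN_gt _ A' A (by omega) (by omega) (by omega), map_add, map_smul, map_sub, map_smul,
      cupN_ge' _ (by omega) (by omega) (by omega), cupN_ge' _ (by omega) (by omega) (by omega),
      cupN_cupN (i := i + 2) (j := j + 1) _ (by omega) (by omega) (by omega)]
    rfl
  · obtain ⟨i, rfl⟩ : ∃ l, i = l + 1 := ⟨i - 1, by omega⟩
    rw [g_cupTh_lt' _ (by omega) (by omega) (by omega),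
      g_cupTh_lt' _ (by omega) (by omega) (by omega),
      B.far_gt _ (by omega) (by omega) (by omega), cupN_ge' _ (by omega) h hc']

theorem far_lt_succ_of_two_le (hi : 2 ≤ i) (hij : i + 1 < j) (hj : j ≤ 2 * (k + 1) + 1) :
    P.g i (cupN (k + 1) j x) = cupN (k + 1) j (P.g i x) := by
  refine cup_ind (P.g i ∘ₗ cupN (k + 1) j) (cupN (k + 1) j ∘ₗ P.g i)
    (fun c y hc hc' => ?_) x
  simp only [LinearMap.comp_apply]
  obtain ⟨i, rfl⟩ := Nat.exists_eq_add_of_le' hi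
  obtain ⟨j, rfl⟩ : ∃ l, j = l + 2 := ⟨j - 2, by omega⟩
  rcases lt_trichotomy c (i + 2) with h | rfl | h
  · rw [cupN_lt' _ hc hc' (by omega), g_cupTh_gt' _ hc h (by omega), g_cupTh_gt' _ hc h (by omega),
      B.far_lt _ (by omega) (by omega) (by omega), cupN_lt' _ hc hc' (by omega)]
  · rw [cupN_lt' _ hc hc' (by omega), g_cupTh_self _ hc (by omega), g_cupTh_self _ hc (by omega),
      cupN_lt' _ (by omega) (by omega) (by omega)]
  rcases eq_or_lt_of_le (Nat.succ_le_of_lt h) with rfl | h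
  · rw [cupN_lt' _ hc hc' (by omega), g_cupTh_succ' _ (by omega), g_cupTh_succ' _ (by omega),
      B.p_far_lt _ A' A (by omega) (by omega), map_add, map_smul, map_sub, map_smul,
      cupN_lt' _ (by omega) (by omega) (by omega), cupN_lt' _ (by omega) (by omega) (by omega),
      cupN_cupN _ (by omega) (by omega) (by omega)]
  rcases lt_or_ge c (j + 2) with h' | h'
  · rw [cupN_lt' _ hc hc' h', g_cupTh_lt' _ (by omega) (by omega) (by omega),
      g_cupTh_lt' _ (by omega) (by omega) (by omega),
      B.far_lt _ (by omega) (by omega) (by omega), cupN_lt' _ hc hc' h']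
  · rw [cupN_ge' _ (by omega) h' hc', g_cupTh_lt' _ (by omega) (by omega) (by omega),
      g_cupTh_lt' _ (by omega) (by omega) (by omega),
      B.far_lt _ (by omega) (by omega) (by omega), cupN_ge' _ (by omega) h' hc']

theorem far_lt_one_cupTh_lt (hc : 2 ≤ c) (hcj : c < j) (hj3 : 3 ≤ j) (hj : j ≤ 2 * (k + 1) + 1)
    (hc' : c ≤ 2 * k + 2) :
    P.g 1 (cupN (k + 1) j (cupTh c y)) = cupN (k + 1) j (P.g 1 (cupTh c y)) := by
  obtain ⟨j, rfl⟩ : ∃ l, j = l + 2 := ⟨j - 2, by omega⟩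
  rcases eq_or_lt_of_le hc with rfl | hc
  · rw [cupN_lt' _ hc hc' hcj, g_one_cupTh_two, g_one_cupTh_two, map_smul, cupN_lt' _ hc hc' hcj]
  induction c, hc using Nat.le_induction with
  | base =>
    rw [cupN_lt' _ (by omega) hc' hcj, g_one_cupTh_three _ (by omega),
      g_one_cupTh_three _ (by omega), cupN_cupN _ (by omega) (by omega) (by omega)]
  | succ c hc ih =>
    have ih := ih (by omega) (by omega) (by omega)
    rw [cupN_lt' _ (by omega) hc' hcj, g_one_cupTh_add_one _ (by omega) (by omega),
      g_one_cupTh_add_one _ (by omega) (by omega),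
      ← B.far_lt_succ_of_two_le _ A' A (by omega) (by omega) hj, ← ih,
      cupN_lt' _ (by omega) (by omega) (by omega)]

theorem far_lt_succ (hi : 1 ≤ i) (hij : i + 1 < j) (hj : j ≤ 2 * (k + 1) + 1) :
    P.g i (cupN (k + 1) j x) = cupN (k + 1) j (P.g i x) := by
  rcases eq_or_lt_of_le hi with rfl | hi
  swap
  · exact B.far_lt_succ_of_two_le x A' A hi hij hj
  refine cup_ind (P.g 1 ∘ₗ cupN (k + 1) j) (cupN (k + 1) j ∘ₗ P.g 1)
    (fun c y hc hc' => ?_) x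
  simp only [LinearMap.comp_apply]
  rcases lt_or_ge c j with h | h
  · exact B.far_lt_one_cupTh_lt y A' A hc h hij hj hc'
  obtain ⟨j, rfl⟩ : ∃ l, j = l + 1 := ⟨j - 1, by omega⟩
  induction c, h using Nat.le_induction with
  | base =>
    have h := B.far_lt_one_cupTh_lt (j := j + 2) y A' A hc (by omega) (by omega) (by omega) hc'
    rw [cupN_lt' _ hc hc' (by omega)] at h
    rw [cupN_ge' _ (by omega) le_rfl hc', g_one_cupTh_add_one _ (by omega) (by omega),
      g_one_cupTh_add_one _ (by omega) (by omega), h, B.down_succ _ A' (by omega) (by omega)]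
  | succ c h ih =>
    have ih := ih (by omega) (by omega)
    rw [cupN_ge' _ (by omega) h (by omega)] at ih
    rw [cupN_ge' _ (by omega) (by omega) hc', g_one_cupTh_add_one _ (by omega) (by omega),
      ih,
      B.far_gt_succ _ A' A (by omega) (by omega) (by omega),
      ← g_one_cupTh_add_one _ (by omega) (by omega)]

theorem succ : RelB P (k + 1) where
  tw x := B.tw_succ x
  up x := B.up_succ x A'
  slide x := B.slide_succ x A'
  down x := B.down_succ x A'
  far_gt x := B.far_gt_succ x A' A
  far_lt x := B.far_lt_succ x A' A

end RelB

variable (P) in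
theorem relB_zero : RelB P 0 where
  tw {i} x hi hi' := by
    obtain rfl : i = 1 := by omega
    rw [cupN_one, g_one_cupTh_two]
  up x hi hi' := by omega
  slide x hi hi' := by omega
  down x hi hi' := by omega
  far_gt x := by omega
  far_lt x := by omega

variable (P) in
theorem relA_zero : RelA P 0 where
  quad x := by omega
  braid x := by omega
  far x := by omega
  ge x := by omega

end CupPar

namespace CupPar
variable {R : Type*} [CommRing R] {P : CupPar R} {k : ℕ}

theorem RelB.cupTh_e {a : ℕ} (B' : RelB P k) (A : RelA P (k + 1)) (x : CupT R (k + 1))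
    (ha : a ≤ 2 * k) :
    cupTh (a + 4) (P.e (a + 1) x) = cupN (k + 1) (a + 2) (P.p a (P.e (a + 1) x)) := by
  obtain ⟨u, hu⟩ := exists_e_eq (P := P) (i := a + 1) (by omega) (by omega) x
  rw [hu, B'.p_cupN _ A ha, cupN_ge' _ (by omega) (by omega) (by omega)]

namespace RelA
variable {i j a b c m : ℕ} (y : CupT R (k + 1)) (x : CupT R k) (A : RelA P k) (B : RelB P k)
include B

theorem ge_succ (hi : 1 ≤ i) (hi' : i + 1 ≤ 2 * (k + 1)) :
    P.g i (P.e i y) = P.zi • P.e i y := by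
  obtain ⟨u, hu⟩ := exists_e_eq (P := P) (i := i) hi (by omega) y
  rw [hu, B.tw _ hi (by omega)]

include A

theorem quad_succ_of_two_le (hi : 2 ≤ i) (hi' : i + 1 ≤ 2 * (k + 1)) :
    P.g i (P.g i y) = y + P.h • (P.g i y - P.zi • P.e i y) := by
  refine cup_ind (P.g i ∘ₗ P.g i) (LinearMap.id + P.h • (P.g i - P.zi • P.e i))
    (fun b x hb hb' => ?_) y
  simp only [LinearMap.comp_apply, LinearMap.add_apply, LinearMap.sub_apply,
    LinearMap.smul_apply, LinearMap.id_apply]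
  obtain ⟨i, rfl⟩ := Nat.exists_eq_add_of_le' hi
  rcases lt_trichotomy b (i + 2) with h | rfl | h
  · rw [g_cupTh_gt' _ hb h hb', g_cupTh_gt' _ hb h hb', e_cupTh_gt' _ hb h hb',
      A.quad _ (by omega) (by omega), map_add, map_smul, map_sub, map_smul]
  · rw [g_cupTh_self _ hb hb', g_cupTh_succ' _ (by omega), e_cupTh_self' _ hb']
  rcases eq_or_lt_of_le (Nat.succ_le_of_lt h) with rfl | h
  · rw [e_cupTh_succ' _ (by omega), g_cupTh_succ' _ (by omega), map_add, map_smul, map_sub,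
      map_smul, g_cupTh_self _ (by omega) (by omega), g_cupTh_succ' _ (by omega),
      B.tw _ (by omega) (by omega)]
  · rw [g_cupTh_lt' _ (by omega) h hb', g_cupTh_lt' _ (by omega) h hb',
      e_cupTh_lt' _ (by omega) h hb',
      A.quad _ (by omega) (by omega), map_add, map_smul, map_sub, map_smul]

theorem far_succ_of_two_le (hi : 2 ≤ i) (hij : i + 1 < j) (hj : j + 1 ≤ 2 * (k + 1)) :
    P.g i (P.g j y) = P.g j (P.g i y) := by
  refine cup_ind (P.g i ∘ₗ P.g j) (P.g j ∘ₗ P.g i) (fun b x hb hb' => ?_) y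
  simp only [LinearMap.comp_apply]
  obtain ⟨i, rfl⟩ := Nat.exists_eq_add_of_le' hi
  obtain ⟨j, rfl⟩ : ∃ l, j = l + 2 := ⟨j - 2, by omega⟩
  rcases lt_trichotomy b (i + 2) with h | rfl | h
  · rw [g_cupTh_gt' _ hb h hb', g_cupTh_gt' _ hb (by omega) hb',
      g_cupTh_gt' _ hb (by omega) hb', g_cupTh_gt' _ hb (by omega) hb',
      A.far _ (by omega) (by omega) (by omega)]
  · rw [g_cupTh_self _ hb hb', g_cupTh_gt' _ hb (by omega) hb', g_cupTh_self _ hb hb',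
      g_cupTh_gt' _ (by omega) (by omega) (by omega)]
  rcases eq_or_lt_of_le (Nat.succ_le_of_lt h) with rfl | h
  · rw [g_cupTh_succ' _ (by omega), g_cupTh_gt' _ (by omega) (by omega) (by omega),
      g_cupTh_succ' _ (by omega), map_add, map_smul, map_sub, map_smul,
      g_cupTh_gt' _ (by omega) (by omega) (by omega),
      g_cupTh_gt' _ (by omega) (by omega) (by omega),
      B.far_gt _ (by omega) (by omega) (by omega), A.p_g_far _ (by omega) (by omega)]
  rw [g_cupTh_lt' (i := i + 1) (b := b) _ (by omega) h hb']
  rcases lt_trichotomy b (j + 2) with h' | rfl | h'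
  · rw [g_cupTh_gt' _ hb h' hb', g_cupTh_gt' _ hb h' hb',
      g_cupTh_lt' (i := i + 1) _ (by omega) h hb', A.far _ (by omega) (by omega) (by omega)]
  · rw [g_cupTh_self _ hb hb', g_cupTh_self _ hb hb',
      g_cupTh_lt' (i := i + 1) _ (by omega) (by omega) (by omega)]
  rcases eq_or_lt_of_le (Nat.succ_le_of_lt h') with rfl | h'
  · rw [g_cupTh_succ' _ (by omega), g_cupTh_succ' _ (by omega), map_add, map_smul, map_sub,
      map_smul, g_cupTh_lt' (i := i + 1) _ (by omega) (by omega) (by omega),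
      g_cupTh_lt' (i := i + 1) _ (by omega) (by omega) (by omega),
      B.far_lt _ (by omega) (by omega) (by omega), A.p_g _ (by omega) (by omega) (by omega)]
  · rw [g_cupTh_lt' (i := j + 1) _ (by omega) h' hb', g_cupTh_lt' (i := j + 1) _ (by omega) h' hb',
      g_cupTh_lt' (i := i + 1) _ (by omega) h hb', A.far _ (by omega) (by omega) (by omega)]

theorem braid_succ_of_two_le (hE : ∀ (a : ℕ) (x : CupT R k), a + 2 ≤ 2 * k →
      cupTh (a + 4) (P.e (a + 1) x) = cupN k (a + 2) (P.p a (P.e (a + 1) x)))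
    (hi : 2 ≤ i) (hi' : i + 2 ≤ 2 * (k + 1)) :
    P.g i (P.g (i + 1) (P.g i y)) = P.g (i + 1) (P.g i (P.g (i + 1) y)) := by
  refine cup_ind (P.g i ∘ₗ P.g (i + 1) ∘ₗ P.g i) (P.g (i + 1) ∘ₗ P.g i ∘ₗ P.g (i + 1))
    (fun b x hb hb' => ?_) y
  simp only [LinearMap.comp_apply]
  obtain ⟨i, rfl⟩ := Nat.exists_eq_add_of_le' hi
  rcases lt_trichotomy b (i + 2) with h | rfl | h
  · simp only [g_cupTh_gt' (i := i) _ hb h hb',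
      g_cupTh_gt' (i := i + 1) _ hb (Nat.lt_succ_of_lt h) hb']
    rw [A.braid _ (by omega) (by omega)]
  · rw [g_cupTh_self _ hb hb', g_cupTh_self _ (by omega) (by omega),
      g_cupTh_gt' (i := i + 1) _ hb (by omega) hb', g_cupTh_self _ hb hb',
      g_cupTh_self _ (by omega) (by omega), g_cupTh_lt' (i := i + 1) _ (by omega) (by omega)
      (by omega)]
  rcases eq_or_lt_of_le (Nat.succ_le_of_lt h) with rfl | h
  · rw [g_cupTh_succ' _ (by omega), g_cupTh_self _ (by omega) (by omega),
      g_cupTh_lt' (i := i + 1) _ (by omega) (by omega) (by omega),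
      g_cupTh_succ' (i := i + 1) _ (by omega), p_succ, A.gi_g _ (by omega) (by omega)]
    simp only [map_add, map_smul, map_sub]
    rw [g_cupTh_self _ (by omega) (by omega), B.up _ (by omega) (by omega),
      g_cupTh_gt' (i := i + 1) _ (by omega) (by omega) (by omega),
      g_cupTh_self _ (by omega) (by omega),
      g_cupTh_lt' (i := i + 1) _ (by omega) (by omega) (by omega)]
  rcases eq_or_lt_of_le (Nat.succ_le_of_lt h) with rfl | h
  · have hp : P.p (i + 1) x = P.p i (P.g (i + 1) x) - P.h • P.p i x +
        P.h • P.p i (P.e (i + 1) x) := by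
      rw [p_succ, gi_apply, map_add, map_sub, map_smul, map_smul]
    have h1 : P.g (i + 2) (cupTh (i + 3) x) = cupTh (i + 2) x +
        P.h • (cupTh (i + 3) x - P.zi • cupN k (i + 2) (P.p i x)) := g_cupTh_succ' _ (by omega)
    have h2 (v : CupT R k) : P.g (i + 3) (cupTh (i + 4) v) = cupTh (i + 3) v +
        P.h • (cupTh (i + 4) v - P.zi • cupN k (i + 3) (P.p (i + 1) v)) :=
      g_cupTh_succ' _ (by omega)
    have h3 (v : CupT R k) : P.g (i + 2) (cupTh (i + 4) v) = cupTh (i + 4) (P.g (i + 1) v) :=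
      g_cupTh_lt' _ (by omega) (by omega) (by omega)
    have h4 (v : CupT R k) : P.g (i + 3) (cupTh (i + 3) v) = cupTh (i + 4) v :=
      g_cupTh_self _ (by omega) (by omega)
    have h5 (v : CupT R k) : P.g (i + 3) (cupTh (i + 2) v) = cupTh (i + 2) (P.g (i + 1) v) :=
      g_cupTh_gt' _ (by omega) (by omega) (by omega)
    have h6 := B.slide (i := i + 2) (P.p i x) (by omega) (by omega)
    have h7 := B.down (i := i + 2) (P.p (i + 1) x) (by omega) (by omega)
    have h8 := hE i x (by omega)
    have h9 := congrArg (cupTh (i + 4)) (A.quad (i := i + 1) x (by omega) (by omega))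
    have h1' : P.g (i + 2) (cupTh (i + 3) (P.g (i + 1) x)) = cupTh (i + 2) (P.g (i + 1) x) +
        P.h • (cupTh (i + 3) (P.g (i + 1) x) - P.zi • cupN k (i + 2) (P.p i (P.g (i + 1) x))) :=
      g_cupTh_succ' _ (by omega)
    change P.g (i + 2) (P.g (i + 3) (P.g (i + 2) (cupTh (i + 4) x))) =
      P.g (i + 3) (P.g (i + 2) (P.g (i + 3) (cupTh (i + 4) x)))
    rw [h3, h2, p_succ, A.gi_g _ (by omega) (by omega), h2]
    simp only [map_add, map_smul, map_sub] at h9 ⊢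
    rw [h1, h1', h3, h3, h7, h6]
    simp only [map_add, map_smul, map_sub]
    rw [h2, h5, h4, p_succ, A.gi_g _ (by omega) (by omega), hp]
    simp only [map_add, map_smul, map_sub]
    linear_combination (norm := module) P.h • h9 - (P.h * P.h * P.zi) • h8
  · obtain ⟨b, rfl⟩ : ∃ l, b = l + 1 := ⟨b - 1, by omega⟩
    simp only [g_cupTh_lt' (i := i + 1) (b := b + 1) _ (by omega) (by omega) hb',
      g_cupTh_lt' (i := i + 2) (b := b + 1) _ (by omega) (by omega) hb']
    rw [A.braid _ (by omega) (by omega)]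

end RelA
end CupPar

namespace CupPar
variable {R : Type*} [CommRing R] {P : CupPar R} {k : ℕ}

theorem gi_one_cupTh_two (x : CupT R k) : P.gi 1 (cupTh 2 x) = (P.z : R) • cupTh 2 x := by
  rw [gi_apply, g_one_cupTh_two, e_one_cupTh_two, zi_eq]
  module

/-- The skein parameter acts injectively on cup diagrams. -/
def HReg (P : CupPar R) : Prop := ∀ r : R, P.h * r = 0 → r = 0

theorem HReg.cancel (H : P.HReg) {v w : CupT R k} (h : P.h • v = P.h • w) : v = w :=
  funext fun s => sub_eq_zero.1 (H _ (by
    have := congrFun h s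
    simp only [Pi.smul_apply, smul_eq_mul] at this
    rw [mul_sub, this, sub_self]))

namespace RelA
variable {i j a b c m : ℕ} (y : CupT R (k + 1)) (x : CupT R k) (A : RelA P k) (B : RelB P k)
include A B

theorem g_gi_succ (hi : 2 ≤ i) (hi' : i + 1 ≤ 2 * (k + 1)) : P.g i (P.gi i y) = y := by
  rw [gi_apply, map_add, map_sub, map_smul, map_smul, A.quad_succ_of_two_le y B hi hi',
    ge_succ y B (by omega) hi']
  module

theorem gi_g_succ (hi : 2 ≤ i) (hi' : i + 1 ≤ 2 * (k + 1)) : P.gi i (P.g i y) = y := by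
  have h : P.g i * P.gi i = (1 : Module.End R (CupT R (k + 1))) :=
    LinearMap.ext fun y => A.g_gi_succ y B hi hi'
  exact LinearMap.congr_fun (mul_eq_one_comm.1 h) y

theorem e_g_g_succ (H : P.HReg) (hbr : ∀ y : CupT R (k + 1),
      P.g i (P.g (i + 1) (P.g i y)) = P.g (i + 1) (P.g i (P.g (i + 1) y)))
    (hi : 2 ≤ i) (hi' : i + 2 ≤ 2 * (k + 1)) :
    P.e (i + 1) (P.g i (P.g (i + 1) y)) = P.g i (P.g (i + 1) (P.e i y)) := by
  apply H.cancel
  have h1 : P.gi (i + 1) (P.g i (P.g (i + 1) y)) = P.g i (P.g (i + 1) (P.gi i y)) := by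
    conv_lhs => rw [← A.g_gi_succ y B (i := i) hi (by omega), hbr,
      A.gi_g_succ _ B (by omega) (by omega)]
  have h2 := hbr y
  rw [gi_apply, gi_apply] at h1
  simp only [map_add, map_sub, map_smul] at h1
  linear_combination (norm := module) h1 + h2

theorem e_three_cupN (hk : 1 ≤ k) : P.e 3 (cupN k 2 x) = cupN k 3 x := by
  obtain ⟨k, rfl⟩ := Nat.exists_eq_add_of_le' hk
  refine cup_ind (P.e 3 ∘ₗ cupN (k + 1) 2) (cupN (k + 1) 3) (fun c y hc hc' => ?_) x
  simp only [LinearMap.comp_apply]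
  rw [cupN_ge' _ le_rfl (by omega) hc', cupN_one]
  rcases eq_or_lt_of_le hc with rfl | hc
  · rw [e_cupTh_succ' _ (by omega), p_succ, p_zero, gi_one_cupTh_two, map_smul, zi_smul_z_smul]
  · rw [e_cupTh_lt' _ (by omega) (by omega) (by omega), e_cupTh_self' _ (by omega), p_zero,
      cupN_ge' _ (by omega) (by omega) hc']

theorem g_g_one_cupTh_lt (hb : 3 ≤ b) (hbj : b < j + 2) (hj : j + 3 ≤ 2 * (k + 1)) :
    P.g (j + 2) (P.g 1 (cupTh b x)) = P.g 1 (cupTh b (P.g j x)) := by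
  induction b, hb using Nat.le_induction with
  | base =>
    rw [g_one_cupTh_three _ (by omega), g_one_cupTh_three _ (by omega),
      B.far_gt _ (by omega) (by omega) (by omega)]
  | succ b hb ih =>
    rw [g_one_cupTh_add_one _ hb (by omega), ← A.far_succ_of_two_le _ B (by omega) hbj hj,
      ih (by omega), g_one_cupTh_add_one _ hb (by omega)]

variable (H : P.HReg) (hbr : ∀ {i} (y : CupT R (k + 1)), 2 ≤ i → i + 2 ≤ 2 * (k + 1) →
      P.g i (P.g (i + 1) (P.g i y)) = P.g (i + 1) (P.g i (P.g (i + 1) y)))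
include hbr

theorem g_g_one_cupTh_gt (hj : 3 ≤ j) (hb : j + 2 ≤ b) (hb' : b ≤ 2 * k + 2) :
    P.g j (P.g 1 (cupTh b x)) = P.g 1 (cupTh b (P.g (j - 1) x)) := by
  induction b, hb using Nat.le_induction with
  | base =>
    obtain ⟨j, rfl⟩ : ∃ l, j = l + 1 := ⟨j - 1, by omega⟩
    rw [g_one_cupTh_add_one _ (by omega) (by omega), g_one_cupTh_add_one _ (by omega) (by omega),
      hbr _ (by omega) (by omega), A.g_g_one_cupTh_lt _ B (by omega) (by omega) (by omega),
      ← g_one_cupTh_add_one _ (by omega) (by omega), ← g_one_cupTh_add_one _ (by omega) (by omega)]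
    rfl
  | succ b hb ih =>
    rw [g_one_cupTh_add_one _ (by omega) (by omega),
      A.far_succ_of_two_le _ B (by omega) (by omega) (by omega), ih (by omega),
      g_one_cupTh_add_one _ (by omega) (by omega)]

include H

theorem e_g_one_cupTh (hm : 3 ≤ m) (hm' : m ≤ 2 * k + 1) :
    P.e m (P.g 1 (cupTh m x)) = P.g 1 (cupN k m (P.p (m - 2) x)) := by
  induction m, hm using Nat.le_induction generalizing x with
  | base =>
    rw [g_one_cupTh_three _ (by omega), A.e_three_cupN _ B (by omega), p_succ, p_zero,
      B.far_lt _ (by omega) (by omega) (by omega), A.g_gi _ (by omega) (by omega)]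
  | succ m hm ih =>
    obtain ⟨m, rfl⟩ : ∃ l, m = l + 2 := ⟨m - 2, by omega⟩
    rw [g_one_cupTh_add_one _ (by omega) (by omega)]
    conv_lhs => rw [← A.g_gi x (i := m + 1) (by omega) (by omega),
      ← A.g_g_one_cupTh_lt _ B (by omega) (by omega) (by omega)]
    rw [A.e_g_g_succ _ B H (fun y => hbr y (by omega) (by omega)) (by omega) (by omega),
      ih _ (by omega), B.far_lt _ (by omega) (by omega) (by omega),
      B.up _ (by omega) (by omega), B.far_lt _ (by omega) (by omega) (by omega)]
    rfl

theorem far_one_succ (hj : 2 < j) (hj' : j + 1 ≤ 2 * (k + 1)) :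
    P.g 1 (P.g j y) = P.g j (P.g 1 y) := by
  refine cup_ind (P.g 1 ∘ₗ P.g j) (P.g j ∘ₗ P.g 1) (fun b x hb hb' => ?_) y
  simp only [LinearMap.comp_apply]
  rcases eq_or_lt_of_le hb with rfl | hb
  · rw [g_cupTh_gt _ le_rfl hj hb', g_one_cupTh_two, g_one_cupTh_two, map_smul,
      g_cupTh_gt _ le_rfl hj hb']
  rcases lt_trichotomy b j with h | rfl | h
  · obtain ⟨j, rfl⟩ : ∃ l, j = l + 2 := ⟨j - 2, by omega⟩
    rw [A.g_g_one_cupTh_lt _ B hb h hj', g_cupTh_gt' _ (by omega) h hb']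
  · rw [g_cupTh_self _ (by omega) hb', g_one_cupTh_add_one _ hb (by omega)]
  rcases eq_or_lt_of_le (Nat.succ_le_of_lt h) with rfl | h
  · rw [g_cupTh_succ _ (by omega) hb', g_one_cupTh_add_one _ hj hb',
      A.quad_succ_of_two_le _ B (by omega) hj', A.e_g_one_cupTh _ B H hbr hj (by omega)]
    simp only [map_add, map_sub, map_smul]
    rw [g_one_cupTh_add_one _ hj hb']
  · rw [A.g_g_one_cupTh_gt _ B hbr hj h hb', g_cupTh_lt _ (by omega) h hb']

theorem quad_one_succ : P.g 1 (P.g 1 y) = y + P.h • (P.g 1 y - P.zi • P.e 1 y) := by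
  refine cup_ind (P.g 1 ∘ₗ P.g 1) (LinearMap.id + P.h • (P.g 1 - P.zi • P.e 1))
    (fun b x hb hb' => ?_) y
  simp only [LinearMap.comp_apply, LinearMap.add_apply, LinearMap.sub_apply,
    LinearMap.smul_apply, LinearMap.id_apply]
  rcases eq_or_lt_of_le hb with rfl | hb
  · have h : P.zi * P.zi = 1 + P.h * P.zi * (1 - P.d) := by
      linear_combination P.zi * P.zi_eq + P.z_mul_zi
    rw [g_one_cupTh_two, map_smul, g_one_cupTh_two, e_one_cupTh_two, smul_smul, h]
    module
  induction b, hb using Nat.le_induction with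
  | base =>
    rw [g_one_cupTh_three _ (by omega), B.slide _ le_rfl (by omega), e_one_cupTh _ le_rfl hb',
      cupN_one, g_cupTh_self _ le_rfl (by omega), zi_smul_z_smul, r_zero]
    module
  | succ b hb ih =>
    have ih := congrArg (P.g b) (ih (by omega) (by omega))
    obtain ⟨b, rfl⟩ : ∃ l, b = l + 2 := ⟨b - 2, by omega⟩
    rw [← A.far_one_succ _ B H hbr (by omega) (by omega),
      ← g_one_cupTh_add_one _ (by omega) (by omega), e_one_cupTh _ (by omega) (by omega),
      zi_smul_z_smul, map_add, map_smul, map_sub, ← g_one_cupTh_add_one _ (by omega) (by omega),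
      g_cupTh_self _ (by omega) (by omega), g_cupTh_gt' _ le_rfl (by omega) (by omega)] at ih
    rw [ih, e_one_cupTh _ (by omega) (by omega), zi_smul_z_smul]
    obtain ⟨b, rfl⟩ : ∃ l, b = l + 1 := ⟨b - 1, by omega⟩
    rfl

theorem braid_one_succ (hk : 1 ≤ k) :
    P.g 1 (P.g 2 (P.g 1 y)) = P.g 2 (P.g 1 (P.g 2 y)) := by
  refine cup_ind (P.g 1 ∘ₗ P.g 2 ∘ₗ P.g 1) (P.g 2 ∘ₗ P.g 1 ∘ₗ P.g 2)
    (fun b x hb hb' => ?_) y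
  simp only [LinearMap.comp_apply]
  rcases eq_or_lt_of_le hb with rfl | hb
  · rw [g_one_cupTh_two, map_smul, map_smul, g_cupTh_self _ le_rfl hb', g_one_cupTh_three _ hk,
      B.tw _ (by omega) (by omega)]
  rcases eq_or_lt_of_le (Nat.succ_le_of_lt hb) with rfl | hb
  · have h := g_cupTh_succ' (P := P) (i := 0) x (by omega)
    have hd := B.down x le_rfl (by omega)
    have hs := B.slide x le_rfl (by omega)
    rw [p_zero] at h
    change P.g 1 (P.g 2 (P.g 1 (cupTh 3 x))) = P.g 2 (P.g 1 (P.g 2 (cupTh 3 x)))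
    rw [cupN_one] at hd hs
    rw [g_cupTh_self _ le_rfl (by omega)] at hs
    rw [g_one_cupTh_three _ hk, B.tw _ (by omega) (by omega), h]
    simp only [map_add, map_smul, map_sub]
    rw [g_one_cupTh_three _ hk, g_one_cupTh_two, map_smul, g_cupTh_self _ le_rfl (by omega),
      B.tw _ (by omega) (by omega), hd, hs]
    module
  have hb : 4 ≤ b := hb
  induction b, hb using Nat.le_induction with
  | base =>
    rw [g_one_cupTh_add_one _ le_rfl hb', g_one_cupTh_three _ hk, B.up _ (by omega) (by omega),
      g_cupTh_lt' _ le_rfl (by omega) hb', g_one_cupTh_add_one _ le_rfl hb',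
      g_one_cupTh_three _ hk, B.up _ (by omega) (by omega),
      B.far_lt _ (by omega) (by omega) (by omega)]
  | succ b hb ih =>
    have ih := congrArg (P.g b) (ih (by omega) (by omega) (by omega) (by omega))
    simp only [← A.far_one_succ _ B H hbr (j := b) (by omega) (by omega),
      ← A.far_succ_of_two_le _ B (i := 2) (j := b) le_rfl (by omega) (by omega),
      g_cupTh_self x (b := b) (by omega) (by omega)] at ih
    exact ih

omit hbr in
theorem succ (hE : ∀ (a : ℕ) (x : CupT R k), a + 2 ≤ 2 * k →
      cupTh (a + 4) (P.e (a + 1) x) = cupN k (a + 2) (P.p a (P.e (a + 1) x))) :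
    RelA P (k + 1) := by
  have hbr {i} (y : CupT R (k + 1)) (hi : 2 ≤ i) (hi' : i + 2 ≤ 2 * (k + 1)) :=
    A.braid_succ_of_two_le y B hE hi hi'
  constructor
  · intro i y hi hi'
    rcases eq_or_lt_of_le hi with rfl | hi
    · exact A.quad_one_succ y B H hbr
    · exact A.quad_succ_of_two_le y B hi hi'
  · intro i y hi hi'
    rcases eq_or_lt_of_le hi with rfl | hi
    · exact A.braid_one_succ y B H hbr (by omega)
    · exact hbr y hi hi'
  · intro i j y hi hij hj
    rcases eq_or_lt_of_le hi with rfl | hi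
    · exact A.far_one_succ y B H hbr hij hj
    · exact A.far_succ_of_two_le y B hi hij hj
  · intro i y hi hi'
    exact ge_succ y B hi hi'

end RelA

theorem HReg.rel (H : P.HReg) (k : ℕ) : RelA P k ∧ RelB P k := by
  suffices h : (RelA P k ∧ RelB P k) ∧ RelA P (k + 1) from h.1
  induction k with
  | zero =>
    exact ⟨⟨P.relA_zero, P.relB_zero⟩, P.relA_zero.succ P.relB_zero H fun a x ha => by omega⟩
  | succ k ih =>
    obtain ⟨⟨A, B⟩, A'⟩ := ih
    have B' := B.succ A' A
    exact ⟨⟨A', B'⟩, A'.succ B' H fun a x ha => B.cupTh_e A' x (by omega)⟩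

end CupPar

namespace CupPar
variable {R : Type*} [CommRing R] {P : CupPar R} {k : ℕ}

namespace RelA
variable {i j : ℕ} (A : RelA P k) (H : P.HReg) (y : CupT R k)
include A

theorem gi_e (hi : 1 ≤ i) (hi' : i + 1 ≤ 2 * k) : P.gi i (P.e i y) = (P.z : R) • P.e i y := by
  have := congrArg (fun v => (P.z : R) • P.gi i v) (A.ge y hi hi')
  simp only [A.gi_g _ hi hi', map_smul, smul_smul, z_mul_zi, one_smul] at this
  exact this.symm

theorem gi_gi_far (hi : 1 ≤ i) (hij : i + 1 < j) (hj : j + 1 ≤ 2 * k) :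
    P.gi i (P.gi j y) = P.gi j (P.gi i y) := by
  conv_rhs => rw [← A.g_gi y (i := j) (by omega) hj, A.gi_g_far _ hi hij hj,
    A.gi_g _ (by omega) hj]

include H

theorem eg (hi : 1 ≤ i) (hi' : i + 1 ≤ 2 * k) : P.e i (P.g i y) = P.zi • P.e i y := by
  apply H.cancel
  have h1 := A.gi_g y hi hi'
  have h2 := A.g_gi y hi hi'
  have h3 := A.ge y hi hi'
  rw [gi_apply] at h1 h2
  simp only [map_add, map_sub, map_smul] at h2
  linear_combination (norm := module) h1 - h2 + P.h • h3

theorem e_gi (hi : 1 ≤ i) (hi' : i + 1 ≤ 2 * k) : P.e i (P.gi i y) = (P.z : R) • P.e i y := by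
  have := congrArg ((P.z : R) • ·) (A.eg H (P.gi i y) hi hi')
  simp only [A.g_gi _ hi hi', smul_smul, z_mul_zi, one_smul] at this
  exact this.symm

theorem e_e (hi : 1 ≤ i) (hi' : i + 1 ≤ 2 * k) : P.e i (P.e i y) = P.d • P.e i y := by
  apply H.cancel
  have h1 := A.gi_e y hi hi'
  have h2 := A.ge y hi hi'
  have h3 : P.h * P.d = P.z + P.h - P.zi := by rw [P.zi_eq]; ring
  rw [gi_apply, h2] at h1
  rw [smul_smul, h3]
  linear_combination (norm := module) h1

theorem e_g_far (hi : 1 ≤ i) (hij : i + 1 < j) (hj : j + 1 ≤ 2 * k) :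
    P.e i (P.g j y) = P.g j (P.e i y) := by
  apply H.cancel
  have h1 := A.gi_g_far y hi hij hj
  have h2 := A.far y hi hij hj
  rw [gi_apply, gi_apply] at h1
  simp only [map_add, map_sub, map_smul] at h1
  linear_combination (norm := module) h1 - h2

theorem e_g_far' (hi : 1 ≤ i) (hij : i + 1 < j) (hj : j + 1 ≤ 2 * k) :
    P.e j (P.g i y) = P.g i (P.e j y) := by
  apply H.cancel
  have h1 := A.gi_g_far' y hi hij hj
  have h2 := A.far y hi hij hj
  rw [gi_apply, gi_apply] at h1
  simp only [map_add, map_sub, map_smul] at h1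
  linear_combination (norm := module) h1 + h2

theorem e_gi_far (hi : 1 ≤ i) (hij : i + 1 < j) (hj : j + 1 ≤ 2 * k) :
    P.e i (P.gi j y) = P.gi j (P.e i y) := by
  conv_rhs => rw [← A.g_gi y (i := j) (by omega) hj, A.e_g_far H _ hi hij hj,
    A.gi_g _ (by omega) hj]

theorem e_e_far (hi : 1 ≤ i) (hij : i + 1 < j) (hj : j + 1 ≤ 2 * k) :
    P.e i (P.e j y) = P.e j (P.e i y) := by
  apply H.cancel
  have h1 := A.e_gi_far H y hi hij hj
  have h2 := A.e_g_far H y hi hij hj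
  rw [gi_apply, gi_apply] at h1
  simp only [map_add, map_sub, map_smul] at h1
  linear_combination (norm := module) h1 - h2

theorem e_succ_g_g (hi : 1 ≤ i) (hi' : i + 2 ≤ 2 * k) :
    P.e (i + 1) (P.g i (P.g (i + 1) y)) = P.g i (P.g (i + 1) (P.e i y)) := by
  apply H.cancel
  have h1 : P.gi (i + 1) (P.g i (P.g (i + 1) y)) = P.g i (P.g (i + 1) (P.gi i y)) := by
    conv_lhs => rw [← A.g_gi y (i := i) hi (by omega), A.braid _ hi hi',
      A.gi_g _ (by omega) (by omega)]
  have h2 := A.braid y hi hi'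
  rw [gi_apply, gi_apply] at h1
  simp only [map_add, map_sub, map_smul] at h1
  linear_combination (norm := module) h1 + h2

theorem e_g_succ_g (hi : 1 ≤ i) (hi' : i + 2 ≤ 2 * k) :
    P.e i (P.g (i + 1) (P.g i y)) = P.g (i + 1) (P.g i (P.e (i + 1) y)) := by
  apply H.cancel
  have h1 : P.gi i (P.g (i + 1) (P.g i y)) = P.g (i + 1) (P.g i (P.gi (i + 1) y)) := by
    conv_lhs => rw [← A.g_gi y (i := i + 1) (by omega) (by omega), ← A.braid _ hi hi',
      A.gi_g _ hi (by omega)]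
  have h2 := A.braid y hi hi'
  rw [gi_apply, gi_apply] at h1
  simp only [map_add, map_sub, map_smul] at h1
  linear_combination (norm := module) h1 - h2

end RelA

namespace RelB
variable {i : ℕ} (B : RelB P k) (A : RelA P (k + 1)) (H : P.HReg) (x : CupT R k)
  (y : CupT R (k + 1))
include B A H

theorem e_succ_cupN (hi : 1 ≤ i) (hi' : i ≤ 2 * k) :
    P.e (i + 1) (cupN k i x) = cupN k (i + 1) x := by
  apply H.cancel
  have h1 := congrArg (P.g i) (B.gi_down x A hi hi')
  have h2 := B.slide x hi hi'
  rw [A.g_gi _ hi (by omega), gi_apply] at h1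
  linear_combination (norm := module) h1 + h2

theorem e_cupN_succ (hi : 1 ≤ i) (hi' : i ≤ 2 * k) :
    P.e i (cupN k (i + 1) x) = cupN k i x := by
  apply H.cancel
  have h1 := B.gi_up x A hi hi'
  have h2 := B.slide x hi hi'
  rw [gi_apply] at h1
  linear_combination (norm := module) h1 - h2

theorem e_e_succ_e (hi : 1 ≤ i) (hi' : i ≤ 2 * k) :
    P.e i (P.e (i + 1) (P.e i y)) = P.e i y := by
  obtain ⟨u, hu⟩ := exists_e_eq (P := P) hi (by omega) y
  rw [hu, B.e_succ_cupN A H _ hi hi', B.e_cupN_succ A H _ hi hi']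

theorem e_succ_e_e (hi : 1 ≤ i) (hi' : i ≤ 2 * k) :
    P.e (i + 1) (P.e i (P.e (i + 1) y)) = P.e (i + 1) y := by
  obtain ⟨u, hu⟩ := exists_e_eq (P := P) (i := i + 1) (by omega) (by omega) y
  rw [hu, B.e_cupN_succ A H _ hi hi', B.e_succ_cupN A H _ hi hi']

theorem g_g_succ_e (hi : 1 ≤ i) (hi' : i ≤ 2 * k) :
    P.g i (P.g (i + 1) (P.e i y)) = P.e (i + 1) (P.e i y) := by
  obtain ⟨u, hu⟩ := exists_e_eq (P := P) hi (by omega) y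
  rw [hu, B.e_succ_cupN A H _ hi hi', B.up _ hi hi']

theorem g_succ_g_e (hi : 1 ≤ i) (hi' : i ≤ 2 * k) :
    P.g (i + 1) (P.g i (P.e (i + 1) y)) = P.e i (P.e (i + 1) y) := by
  obtain ⟨u, hu⟩ := exists_e_eq (P := P) (i := i + 1) (by omega) (by omega) y
  rw [hu, B.e_cupN_succ A H _ hi hi', B.down _ hi hi']

theorem e_g_succ_e (hi : 1 ≤ i) (hi' : i ≤ 2 * k) :
    P.e i (P.g (i + 1) (P.e i y)) = (P.z : R) • P.e i y := by
  obtain ⟨u, hu⟩ := exists_e_eq (P := P) hi (by omega) y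
  rw [hu, ← B.gi_up _ A hi hi', A.e_gi H _ hi (by omega), B.e_cupN_succ A H _ hi hi']

theorem e_succ_g_e (hi : 1 ≤ i) (hi' : i ≤ 2 * k) :
    P.e (i + 1) (P.g i (P.e (i + 1) y)) = (P.z : R) • P.e (i + 1) y := by
  obtain ⟨u, hu⟩ := exists_e_eq (P := P) (i := i + 1) (by omega) (by omega) y
  rw [hu, ← B.gi_down _ A hi hi', A.g_gi _ hi (by omega), A.e_gi H _ (by omega) (by omega),
    B.e_succ_cupN A H _ hi hi', B.gi_down _ A hi hi']

end RelB

end CupPar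

namespace CupPar
variable {R : Type*} [CommRing R] {P : CupPar R}

/-- The diagram of nested cups. -/
def nest (R : Type*) [CommRing R] : (k : ℕ) → CupT R k
  | 0 => fun _ => 1
  | k + 1 => cupTh (2 * k + 2) (nest R k)

theorem g_one_cupTh_cupTh {k b : ℕ} (y : CupT R k) (h3 : 3 ≤ b) (hb : b ≤ 2 * k + 3) :
    P.g 1 (cupTh b (cupTh (2 * k + 2) y)) = cupTh (2 * k + 4) (cupTh (b - 1) y) := by
  induction b, h3 using Nat.le_induction with
  | base =>
    rw [g_one_cupTh_three _ (by omega), cupN_ge' _ le_rfl (by omega) (by omega), cupN_one]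
  | succ b h3 ih =>
    obtain ⟨b, rfl⟩ : ∃ l, b = l + 1 := ⟨b - 1, by omega⟩
    rw [g_one_cupTh_add_one _ h3 (by omega), ih (by omega),
      g_cupTh_lt' _ (by omega) (by omega) (by omega), Nat.add_sub_cancel,
      g_cupTh_self _ (by omega) (by omega)]
    rfl

theorem g_nest {n i j : ℕ} (hi : 1 ≤ i) (hin : i < n) (hij : i + j = 2 * n) :
    P.g i (nest R n) = P.g j (nest R n) := by
  induction n generalizing i j with
  | zero => omega
  | succ n ih =>
    rcases eq_or_lt_of_le hi with rfl | hi
    · obtain ⟨n, rfl⟩ : ∃ l, n = l + 1 := ⟨n - 1, by omega⟩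
      obtain rfl : j = 2 * n + 3 := by omega
      change P.g 1 (cupTh (2 * n + 3 + 1) (cupTh (2 * n + 2) (nest R n))) =
        P.g (2 * n + 3) (cupTh (2 * n + 3 + 1) (cupTh (2 * n + 2) (nest R n)))
      rw [g_one_cupTh_add_one _ (by omega) (by omega),
        g_one_cupTh_cupTh _ (by omega) (by omega)]
      rfl
    · obtain ⟨i, rfl⟩ : ∃ l, i = l + 1 := ⟨i - 1, by omega⟩
      obtain ⟨j, rfl⟩ : ∃ l, j = l + 1 := ⟨j - 1, by omega⟩
      change P.g (i + 1) (cupTh _ _) = P.g (j + 1) (cupTh _ _)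
      rw [g_cupTh_lt' (i := i) _ (by omega) (by omega) (by omega),
        g_cupTh_lt' (i := j) _ (by omega) (by omega) (by omega),
        ih (i := i) (j := j) (by omega) (by omega) (by omega)]

variable (H : P.HReg)
include H

theorem gi_nest {n i j : ℕ} (hi : 1 ≤ i) (hin : i < n) (hij : i + j = 2 * n) :
    P.gi j (nest R n) = P.gi i (nest R n) := by
  have A := (H.rel n).1
  conv_lhs => rw [← A.gi_g (nest R n) hi (by omega), g_nest hi hin hij,
    ← A.gi_gi_far _ hi (by omega) (by omega), A.gi_g _ (by omega) (by omega)]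

theorem eq_top_of_nest_mem {n : ℕ} (U : Submodule R (CupT R n)) (h0 : nest R n ∈ U)
    (hg : ∀ i y, 1 ≤ i → i < n → y ∈ U → P.g i y ∈ U)
    (he : ∀ i y, 1 ≤ i → i < n → y ∈ U → P.e i y ∈ U)
    (hgi : ∀ i y, n < i → i + 1 ≤ 2 * n → y ∈ U → P.gi i y ∈ U) : U = ⊤ := by
  induction n with
  | zero =>
    refine Submodule.eq_top_iff'.2 fun x => ?_
    have : x = x () • nest R 0 := funext fun _ => (mul_one _).symm
    rw [this]
    exact U.smul_mem _ h0
  | succ n ih =>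
    have A := (H.rel n).1
    have A' := (H.rel (n + 1)).1
    have htop : U.comap (cupTh (2 * n + 2)) = ⊤ := by
      refine ih _ h0 (fun i y hi hin hy => ?_) (fun i y hi hin hy => ?_)
        fun i y hin hi hy => ?_
      · rw [Submodule.mem_comap, ← g_cupTh_lt' (P := P) y hi (by omega) le_rfl]
        exact hg _ _ (by omega) (by omega) hy
      · rw [Submodule.mem_comap, ← e_cupTh_lt' (P := P) y hi (by omega) le_rfl]
        exact he _ _ (by omega) (by omega) hy
      · have := hgi (i + 1) _ (by omega) (by omega) hy
        rw [gi_apply, g_cupTh_lt' _ (by omega) (by omega) le_rfl,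
          e_cupTh_lt' _ (by omega) (by omega) le_rfl, ← map_smul, ← map_smul, ← map_sub,
          ← map_add] at this
        exact this
    have hlast (x : CupT R n) : cupTh (2 * n + 2) x ∈ U := by
      have : x ∈ U.comap (cupTh (2 * n + 2)) := htop ▸ Submodule.mem_top
      exact this
    have hbig {m : ℕ} (hm : m ≤ n) (x : CupT R n) : cupTh (2 * n + 2 - m) x ∈ U := by
      induction m with
      | zero => exact hlast x
      | succ m ihm =>
        have h := hgi (2 * n + 2 - (m + 1)) _ (by omega) (by omega) (ihm (by omega))
        rw [show 2 * n + 2 - m = 2 * n + 2 - (m + 1) + 1 by omega,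
          ← g_cupTh_self (P := P) _ (by omega) (by omega), A'.gi_g _ (by omega) (by omega)] at h
        exact h
    have hr (m : ℕ) (hm : m + 1 ≤ 2 * n) (x : CupT R n) : ∃ y, P.r m y = x := by
      induction m generalizing x with
      | zero => exact ⟨x, rfl⟩
      | succ m ihm =>
        obtain ⟨y, hy⟩ := ihm (by omega) (P.gi (m + 1) x)
        exact ⟨y, by rw [r_succ, hy, A.g_gi _ (by omega) hm]⟩
    have htwo (x : CupT R n) : cupTh 2 x ∈ U := by
      rcases Nat.eq_zero_or_pos n with rfl | hn
      · exact hlast x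
      obtain ⟨y, rfl⟩ := hr (2 * n + 2 - 3) (by omega) x
      have h := U.smul_mem P.zi (he 1 _ le_rfl (by omega) (hlast y))
      rwa [e_one_cupTh _ (by omega) le_rfl, zi_smul_z_smul] at h
    have hsmall {b : ℕ} (h2 : 2 ≤ b) (hb : b ≤ n + 1) (x : CupT R n) : cupTh b x ∈ U := by
      induction b, h2 using Nat.le_induction with
      | base => exact htwo x
      | succ b h2 ihb =>
        rw [← g_cupTh_self (P := P) _ h2 (by omega)]
        exact hg _ _ (by omega) (by omega) (ihb (by omega))
    refine Submodule.eq_top_iff'.2 fun x => ?_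
    rw [← sum_cupTh_cupRes x]
    refine sum_mem fun j _ => ?_
    rcases le_or_gt (j.val + 2) (n + 1) with h | h
    · exact hsmall (by omega) h _
    · have := hbig (m := 2 * n - j.val) (by omega) (cupRes j x)
      rwa [show 2 * n + 2 - (2 * n - j.val) = j.val + 2 by omega] at this

end CupPar

namespace CupPar
variable {R : Type} [CommRing R] (P : CupPar R) {k : ℕ}

/-- The action of the generators of the Birman–Murakami–Wenzl algebra on cup diagrams. -/
noncomputable def genAct (n : ℕ) : FreeAlgebra R (BMWGen n) →ₐ[R] Module.End R (CupT R n) :=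
  FreeAlgebra.lift R fun
    | .G i => P.g i
    | .GI i => P.gi i
    | .E i => P.e i

theorem genAct_G {n : ℕ} (i) : P.genAct n (FreeAlgebra.ι R (.G i)) = P.g i :=
  FreeAlgebra.lift_ι_apply _ _

theorem genAct_GI {n : ℕ} (i) : P.genAct n (FreeAlgebra.ι R (.GI i)) = P.gi i :=
  FreeAlgebra.lift_ι_apply _ _

theorem genAct_E {n : ℕ} (i) : P.genAct n (FreeAlgebra.ι R (.E i)) = P.e i :=
  FreeAlgebra.lift_ι_apply _ _

variable {P} (H : P.HReg)
include H

theorem genAct_rel {x y : FreeAlgebra R (BMWGen (k + 1))} (h : BMWRel R P.z P.q P.d (k + 1) x y) :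
    P.genAct (k + 1) x = P.genAct (k + 1) y := by
  have A := (H.rel (k + 1)).1
  have B := (H.rel k).2
  refine LinearMap.ext fun v => ?_
  cases h <;> simp only [map_mul, map_sub, map_one, AlgHom.commutes, genAct_G, genAct_GI, genAct_E,
    Module.End.mul_apply, Module.End.one_apply, LinearMap.sub_apply, Module.algebraMap_end_apply]
  case invR i => exact A.g_gi _ i.2.1 (by omega)
  case invL i => exact A.gi_g _ i.2.1 (by omega)
  case idem i => exact A.e_e H _ i.2.1 (by omega)
  case braid i j h =>
    rw [h]
    exact A.braid _ i.2.1 (by omega)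
  case braidComm i j h =>
    rcases h with h | h
    · exact A.far _ i.2.1 h (by omega)
    · exact (A.far _ j.2.1 h (by omega)).symm
  case geComm i j h =>
    rcases h with h | h
    · exact (A.e_g_far' H _ i.2.1 h (by omega)).symm
    · exact (A.e_g_far H _ j.2.1 h (by omega)).symm
  case eeComm i j h =>
    rcases h with h | h
    · exact A.e_e_far H _ i.2.1 h (by omega)
    · exact (A.e_e_far H _ j.2.1 h (by omega)).symm
  case tangle1 i j h =>
    rcases h with h | h <;> rw [h]
    · exact B.e_e_succ_e A H _ i.2.1 (by omega)
    · exact B.e_succ_e_e A H _ j.2.1 (by omega)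
  case tangle2 i j h =>
    rcases h with h | h <;> rw [h]
    · exact B.g_g_succ_e A H _ i.2.1 (by omega)
    · exact B.g_succ_g_e A H _ j.2.1 (by omega)
  case tangle3 i j h =>
    rcases h with h | h <;> rw [h]
    · rw [A.e_g_succ_g H _ i.2.1 (by omega), B.g_succ_g_e A H _ i.2.1 (by omega)]
    · rw [A.e_succ_g_g H _ j.2.1 (by omega), B.g_g_succ_e A H _ j.2.1 (by omega)]
  case skein i =>
    rw [gi_apply, h]
    module
  case untwistR i => exact A.ge _ i.2.1 (by omega)
  case untwistL i => exact A.eg H _ i.2.1 (by omega)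
  case untwistE i j h =>
    rcases h with h | h <;> rw [h]
    · exact B.e_g_succ_e A H _ i.2.1 (by omega)
    · exact B.e_succ_g_e A H _ j.2.1 (by omega)

/-- The action of the Birman–Murakami–Wenzl algebra on cup diagrams. -/
noncomputable def bmwAct (k : ℕ) :
    BMW R P.z P.q P.d (k + 1) →ₐ[R] Module.End R (CupT R (k + 1)) :=
  RingQuot.liftAlgHom R ⟨P.genAct (k + 1), fun _ _ h => genAct_rel H h⟩

theorem bmwAct_mk (x : FreeAlgebra R (BMWGen (k + 1))) :
    bmwAct H k (RingQuot.mkAlgHom R (BMWRel R P.z P.q P.d (k + 1)) x) = P.genAct (k + 1) x :=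
  RingQuot.liftAlgHom_mkAlgHom_apply R _ _ _

theorem gi_bmwAct {i : ℕ} (hi : k + 1 < i) (hi' : i + 1 ≤ 2 * (k + 1))
    (w : BMW R P.z P.q P.d (k + 1)) :
    P.gi i * bmwAct H k w = bmwAct H k w * P.gi i := by
  have A := (H.rel (k + 1)).1
  obtain ⟨x, rfl⟩ := RingQuot.mkAlgHom_surjective R (BMWRel R P.z P.q P.d (k + 1)) w
  rw [bmwAct_mk]
  induction x using FreeAlgebra.induction with
  | grade0 r => rw [AlgHom.commutes]; exact (Algebra.commutes r _).symm
  | grade1 x =>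
    refine LinearMap.ext fun y => ?_
    cases x with
    | G j => rw [genAct_G]; exact A.gi_g_far' y j.2.1 (by omega) hi'
    | GI j => rw [genAct_GI]; exact (A.gi_gi_far y j.2.1 (by omega) hi').symm
    | E j => rw [genAct_E]; exact (A.e_gi_far H y j.2.1 (by omega) hi').symm
  | mul a b ha hb => rw [map_mul, ← mul_assoc, ha, mul_assoc, hb, mul_assoc]
  | add a b ha hb => rw [map_add, mul_add, add_mul, ha, hb]

theorem bmwAct_nest_surjective (k : ℕ) :
    Function.Surjective ((LinearMap.applyₗ (nest R (k + 1))).comp (bmwAct H k).toLinearMap) := by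
  rw [← LinearMap.range_eq_top]
  have hmk (x : FreeAlgebra R (BMWGen (k + 1))) (w : BMW R P.z P.q P.d (k + 1)) :
      P.genAct (k + 1) x (bmwAct H k w (nest R (k + 1))) ∈ LinearMap.range
        ((LinearMap.applyₗ (nest R (k + 1))).comp (bmwAct H k).toLinearMap) :=
    ⟨RingQuot.mkAlgHom R _ x * w, by
      rw [← bmwAct_mk H]
      change bmwAct H k (_ * _) _ = _
      rw [map_mul]
      rfl⟩
  refine eq_top_of_nest_mem H _ ⟨1, ?_⟩ ?_ ?_ ?_
  · change bmwAct H k 1 _ = _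
    rw [map_one]
    rfl
  · rintro i _ hi hi' ⟨w, rfl⟩
    have := hmk (FreeAlgebra.ι R (.G ⟨i, hi, hi'⟩)) w
    rwa [genAct_G] at this
  · rintro i _ hi hi' ⟨w, rfl⟩
    have := hmk (FreeAlgebra.ι R (.E ⟨i, hi, hi'⟩)) w
    rwa [genAct_E] at this
  · rintro i _ hi hi' ⟨w, rfl⟩
    obtain ⟨j, hj⟩ : ∃ j, j + i = 2 * (k + 1) := ⟨2 * (k + 1) - i, by omega⟩
    refine ⟨w * bmwGI R P.z P.q P.d (k + 1) j, ?_⟩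
    change bmwAct H k (_ * _) _ =
      (P.gi i * bmwAct H k w : Module.End R (CupT R (k + 1))) (nest R (k + 1))
    rw [gi_bmwAct H hi hi', map_mul, ← mkAlgHom_GI ⟨j, by omega⟩, bmwAct_mk, genAct_GI,
      Module.End.mul_apply, Module.End.mul_apply, gi_nest H (by omega) (by omega) hj]

omit H in
/-- A spanning family of the Birman–Murakami–Wenzl algebra with at most `(2 * n - 1)!!` elements
is linearly independent. -/
theorem linearIndependent_of_span [Nontrivial R] {n : ℕ} (hn : 1 ≤ n) (H : P.HReg)
    {ι : Type*} [Finite ι]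
    (hι : Nat.card ι ≤ ∏ j ∈ Finset.range n, (2 * j + 1)) (b : ι → BMW R P.z P.q P.d n)
    (hb : Submodule.span R (Set.range b) = ⊤) : LinearIndependent R b := by
  obtain ⟨k, rfl⟩ := Nat.exists_eq_add_of_le' hn
  have := Fintype.ofFinite ι
  rw [Nat.card_eq_fintype_card, ← CupIx.card] at hι
  let f := (LinearMap.applyₗ (nest R (k + 1))).comp (bmwAct H k).toLinearMap
  refine LinearIndependent.of_comp f (linearIndependent_of_top_le_span_of_card_le_finrank ?_
    (hι.trans_eq (Module.finrank_fintype_fun_eq_card R).symm))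
  rw [Set.range_comp, Submodule.span_image, hb, Submodule.map_top,
    LinearMap.range_eq_top.2 (bmwAct_nest_surjective H k)]

end CupPar

section Final

theorem isDomain_hReg {R : Type} [CommRing R] [IsDomain R] (P : CupPar R) (h : P.h ≠ 0) :
    P.HReg := fun _ hr => (mul_eq_zero.1 hr).resolve_left h

theorem skein_ne_zero {R : Type} [CommRing R] {q : Rˣ} {q' : ℚˣ} (hq : (q' : ℚ) = 2)
    (f : R →+* ℚ) (hf : f q = q') : (q : R) - ((q⁻¹ : Rˣ) : R) ≠ 0 := by
  intro h
  have h2 : f q * f ((q⁻¹ : Rˣ) : R) = 1 := by rw [← map_mul, Units.mul_inv, map_one]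
  rw [← sub_eq_zero.1 h, hf, hq] at h2
  norm_num at h2

variable {R W : Type*} [CommRing R] [Ring W] [Algebra R W]
variable {z q : Rˣ} {δ : R} {n : ℕ} {g gi e : ℕ → W}

namespace BMWSys
variable (S : BMWSys z q δ n g gi e) {st : W →ₗ[R] W} (I : AntiInv st g e)
  (htop : ∀ w, w ∈ lvl R g e n)
include S I htop

theorem span_range_cell : Submodule.span R
    (Set.range fun p : (x : WLam n) × (WPath n x.1 × WPath n x.1) =>
      st (dPathW q g e n p.2.1) * cellW q g e n p.1.1 * dPathW q g e n p.2.2) = ⊤ := by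
  refine eq_top_iff.2 ((S.span_cellSet I htop).ge.trans (Submodule.span_mono ?_))
  rintro _ ⟨m, u, w, -, hu, hw, rfl⟩
  obtain ⟨s, rfl⟩ := isD_iff.1 hu
  obtain ⟨t, rfl⟩ := isD_iff.1 hw
  exact ⟨⟨m, s, t⟩, rfl⟩

theorem mul_mem_span_cell (x : WLam n) (t : WPath n x.1) (a : W) :
    ∃ r : WPath n x.1 →₀ R, ∀ s : WPath n x.1,
      (st (dPathW q g e n s) * cellW q g e n x.1 * dPathW q g e n t) * a
        - r.sum (fun v rv => rv •
            (st (dPathW q g e n s) * cellW q g e n x.1 * dPathW q g e n v)) ∈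
      Submodule.span R {y : W | ∃ (m : WLam n) (u w : WPath n m.1), wGT m.1 x.1 ∧
        y = st (dPathW q g e n u) * cellW q g e n m.1 * dPathW q g e n w} := by
  obtain ⟨b, hb, c, hc, h⟩ := Submodule.mem_sup.1 (S.cellW_mul_mem I htop x (dPathW q g e n t * a))
  have hset : {y | ∃ w, IsD q g e n x.1 w ∧ y = cellW q g e n x.1 * w} =
      Set.range fun v : WPath n x.1 => cellW q g e n x.1 * dPathW q g e n v := by
    ext y
    constructor
    · rintro ⟨w, hw, rfl⟩
      obtain ⟨v, rfl⟩ := isD_iff.1 hw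
      exact ⟨v, rfl⟩
    · rintro ⟨v, rfl⟩
      exact ⟨_, isD_iff.2 ⟨v, rfl⟩, rfl⟩
  rw [hset, Finsupp.mem_span_range_iff_exists_finsupp] at hb
  obtain ⟨r, rfl⟩ := hb
  refine ⟨r, fun s => ?_⟩
  have hle : Submodule.span R (cellSet st q g e n fun m => wGT m x.1) ≤
      Submodule.span R {y : W | ∃ (m : WLam n) (u w : WPath n m.1), wGT m.1 x.1 ∧
        y = st (dPathW q g e n u) * cellW q g e n m.1 * dPathW q g e n w} := by
    refine Submodule.span_mono ?_
    rintro _ ⟨m, u, w, hm, hu, hw, rfl⟩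
    obtain ⟨u, rfl⟩ := isD_iff.1 hu
    obtain ⟨w, rfl⟩ := isD_iff.1 hw
    exact ⟨m, u, w, hm, rfl⟩
  convert hle (S.cellN_le I htop x (mul_mem_cellN hc (st (dPathW q g e n s)))) using 1
  rw [mul_assoc, mul_assoc, ← h, mul_add, Finsupp.sum, Finsupp.sum, Finset.mul_sum,
    sub_eq_iff_eq_add, add_comm]
  simp only [mul_smul_comm, mul_assoc]

omit htop in
theorem map_cell (x : WLam n) (a b : W) :
    st (st a * cellW q g e n x.1 * b) = st b * cellW q g e n x.1 * a := by
  rw [I.mul, I.mul, I.inv, S.map_cellW I, mul_assoc]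

end BMWSys
end Final

/-- **Statement 15** (Murphy-type cellular basis of the BMW algebra).
Let `R = ℤ[z^{±1}, q^{±1}, δ]/(z⁻¹ - z = (q⁻¹ - q)(δ - 1))` be the generic ground
ring of the BMW algebras (characterized by its universal property), and let
`W_i = BMW R z q δ i` be the Birman–Murakami–Wenzl algebra, with its involution `*`
fixing the generators `g_j, e_j` and with the elements `g_v` (`v ∈ S_i`) determined
by reduced expressions.  Then for each `i ≥ 1` the set
`𝒲_i = {d_s* c_{(λ,l)} d_t : (λ,l) ∈ Ŵ_i, s,t ∈ Ŵ_i^{(λ,l)}}` is an `R`-basis of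
`W_i`, and `(W_i, *, Ŵ_i, ⊵, 𝒲_i)` is a cell datum for `W_i` (with
`Ŵ_i = {(λ,l) : 0 ≤ l ≤ ⌊i/2⌋, λ ⊢ i-2l}` ordered by
`(λ,l) ⊵ (μ,m)` iff `l > m`, or `l = m` and `λ ⊵ μ` in the dominance order, and
with the index sets the paths on the branching diagram obtained by reflections from
Young's lattice). -/
theorem bmw_cellular_basis
    -- the generic ground ring
    (R : Type) [CommRing R] [IsDomain R] (z q : Rˣ) (δ : R)
    (hrel : ((z⁻¹ : Rˣ) : R) - (z : R) = (((q⁻¹ : Rˣ) : R) - (q : R)) * (δ - 1))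
    (huniv : ∀ (S : Type) [CommRing S], ∀ (z' q' : Sˣ) (δ' : S),
      ((z'⁻¹ : Sˣ) : S) - (z' : S) = (((q'⁻¹ : Sˣ) : S) - (q' : S)) * (δ' - 1) →
      ∃! f : R →+* S, f z = z' ∧ f q = q' ∧ f δ = δ')
    (i : ℕ) (hi : 1 ≤ i)
    -- the involution of W_i, fixing the generators
    (st : BMW R z q δ i →ₗ[R] BMW R z q δ i)
    (hst_mul : ∀ x y, st (x * y) = st y * st x)
    (hst_st : ∀ x, st (st x) = x)
    (hst_g : ∀ j : ℕ, st (bmwG R z q δ i j) = bmwG R z q δ i j)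
    (hst_e : ∀ j : ℕ, st (bmwE R z q δ i j) = bmwE R z q δ i j)
    -- the elements g_v, characterized by reduced expressions
    (gw : Equiv.Perm (Fin i) → BMW R z q δ i)
    (hgw1 : gw 1 = 1)
    (hgwmul : ∀ (v : Equiv.Perm (Fin i)) (j : ℕ), 1 ≤ j → j < i →
      invCount (swN i j * v) = invCount v + 1 →
        gw (swN i j * v) = gw v * bmwG R z q δ i j) :
    -- the set 𝒲_i is an R-basis of W_i ...
    (LinearIndependent R
      (fun p : (x : WLam i) × (WPath i x.1 × WPath i x.1) =>
        st (dPathBMW R z q δ i i p.2.1) * cBMW R z q δ i gw p.1.1.1 p.1.1.2 *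
          dPathBMW R z q δ i i p.2.2) ∧
    Submodule.span R (Set.range
      (fun p : (x : WLam i) × (WPath i x.1 × WPath i x.1) =>
        st (dPathBMW R z q δ i i p.2.1) * cBMW R z q δ i gw p.1.1.1 p.1.1.2 *
          dPathBMW R z q δ i i p.2.2)) = ⊤) ∧
    -- ... the poset and index sets are finite ...
    (Finite (WLam i) ∧ ∀ x : WLam i, Finite (WPath i x.1)) ∧
    -- ... the cellular multiplication axiom holds ...
    (∀ (x : WLam i) (t : WPath i x.1) (a : BMW R z q δ i),
      ∃ r : WPath i x.1 →₀ R, ∀ s : WPath i x.1,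
        (st (dPathBMW R z q δ i i s) * cBMW R z q δ i gw x.1.1 x.1.2 *
            dPathBMW R z q δ i i t) * a
          - r.sum (fun v rv => rv •
              (st (dPathBMW R z q δ i i s) * cBMW R z q δ i gw x.1.1 x.1.2 *
                dPathBMW R z q δ i i v)) ∈
        Submodule.span R {y : BMW R z q δ i |
          ∃ (m : WLam i) (u w : WPath i m.1), wGT m.1 x.1 ∧
            y = st (dPathBMW R z q δ i i u) * cBMW R z q δ i gw m.1.1 m.1.2 *
              dPathBMW R z q δ i i w}) ∧
    -- ... and the cellular star axiom holds.
    (∀ (x : WLam i) (s t : WPath i x.1),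
      st (st (dPathBMW R z q δ i i s) * cBMW R z q δ i gw x.1.1 x.1.2 *
          dPathBMW R z q δ i i t)
        - (st (dPathBMW R z q δ i i t) * cBMW R z q δ i gw x.1.1 x.1.2 *
            dPathBMW R z q δ i i s) ∈
        Submodule.span R {y : BMW R z q δ i |
          ∃ (m : WLam i) (u w : WPath i m.1), wGT m.1 x.1 ∧
            y = st (dPathBMW R z q δ i i u) * cBMW R z q δ i gw m.1.1 m.1.2 *
              dPathBMW R z q δ i i w}) := by
  have I : AntiInv st (bmwG R z q δ i) (bmwE R z q δ i) := ⟨hst_mul, hst_st, hst_g, hst_e⟩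
  have S := bmwSys (R := R) (z := z) (q := q) (δ := δ) (n := i)
  have hd {x} (t : WPath i x) : dPathBMW R z q δ i i t =
      dPathW q (bmwG R z q δ i) (bmwE R z q δ i) i t := rfl
  have hc (x : WLam i) : cBMW R z q δ i gw x.1.1 x.1.2 =
      cellW q (bmwG R z q δ i) (bmwE R z q δ i) i x.1 := by
    rw [cBMW, sum_rowStab hgw1 hgwmul (x.2.2.trans_le (Nat.sub_le _ _))]
    rfl
  simp only [hd, hc]
  have hspan := S.span_range_cell I mem_lvl_bmw
  let P : CupPar R := ⟨z, q, δ, hrel⟩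
  obtain ⟨f, ⟨-, hf, -⟩, -⟩ := huniv ℚ 1 (Units.mk0 2 two_ne_zero) 1 (by simp)
  have H : P.HReg := isDomain_hReg P (skein_ne_zero rfl f hf)
  refine ⟨⟨CupPar.linearIndependent_of_span (P := P) hi H (natCard_pairs_le i) _ hspan, hspan⟩,
    ⟨inferInstance, fun _ => inferInstance⟩, S.mul_mem_span_cell I mem_lvl_bmw, fun x s t => ?_⟩
  rw [S.map_cell I, sub_self]
  exact zero_mem _
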